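/- Let D and D′ be domains in ℝ^n, n ≥ 3, let φ be nondecreasing with ∫_{t_*}^∞ (t/φ(t))^{1/(n−2)} dt < ∞, let p ∈ (n, n + 1/(n−2)), and let f:D→D′ be a homeomorphism of finite distortion of class W^{1,φ}_loc. Then there is a positive constant c_5 depending only on n and p such that for every x_0 ∈ D and every ε > 0 with B(x_0,4ε) ⊂ D: d(f B(x_0,ε))/ε ≤ c_5 · (⨍_{B(x_0,4ε)} K_p(x,f)^{(n−1)/(p−n+1)} dm)^{j_1} · (⨍_{B(x_0,2ε)} K_p(x,f)^{(n−1)/(p−n+1)} dm)^{j_2}, where d(·) denotes Euclidean diameter, j_1 = n((1−n)(p−n+1)+p)(p−n+1)/(p(n(p−n+1)−p)) and j_2 = (n−1)(p−n+1)/p. -/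

import Mathlib

open MeasureTheory Metric Set Filter
open scoped ENNReal NNReal Topology RealInnerProductSpace Classical

noncomputable section

abbrev Eucl (n : ℕ) : Type := EuclideanSpace ℝ (Fin n)

/-- A `k`-dimensional surface in `ℝⁿ`: a continuous map defined on an open subset of the
one-point compactification of `ℝᵏ`. -/
structure Surface (n k : ℕ) where
  dom : Set (OnePoint (Eucl k))
  isOpen_dom : IsOpen dom
  toFun : OnePoint (Eucl k) → Eucl n
  continuousOn : ContinuousOn toFun dom

namespace Surface

variable {n k : ℕ}

/-- The multiplicity function `N(S,y)` of a surface. -/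
def mult (S : Surface n k) (y : Eucl n) : ℝ≥0∞ :=
  ((S.dom ∩ S.toFun ⁻¹' {y}).encard : ℕ∞)

/-- The integral `∫_S ρ dA = ∫ ρ(y) N(S,y) dH^k(y)` of `ρ` over the surface `S`. -/
def sint (S : Surface n k) (ρ : Eucl n → ℝ≥0∞) : ℝ≥0∞ :=
  ∫⁻ y, ρ y * S.mult y ∂(μH[(k : ℝ)] : Measure (Eucl n))

end Surface

/-- Admissible functions for a family of `k`-surfaces. -/
def surfAdm {n : ℕ} (k : ℕ) (Γ : Set (Surface n k)) : Set (Eucl n → ℝ≥0∞) :=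
  {ρ | Measurable ρ ∧ ∀ S ∈ Γ, 1 ≤ S.sint fun y => ρ y ^ k}

/-- The `p`-modulus of a family of `k`-surfaces. -/
def surfModulus {n : ℕ} (p : ℝ) (k : ℕ) (Γ : Set (Surface n k)) : ℝ≥0∞ :=
  ⨅ ρ ∈ surfAdm k Γ, ∫⁻ x, ρ x ^ p

/-- Extensively `p`-admissible functions: admissibility may fail on a subfamily of
`p`-modulus zero. -/
def extAdm {n : ℕ} (p : ℝ) (k : ℕ) (Γ : Set (Surface n k)) : Set (Eucl n → ℝ≥0∞) :=
  {ρ | Measurable ρ ∧ surfModulus p k {S ∈ Γ | ¬ 1 ≤ S.sint fun y => ρ y ^ k} = 0}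

/-- The family of the (injectively parametrized, nonempty) surfaces `S(x₀,r) ∩ D`,
`r ∈ I`. -/
def sphereFam {n : ℕ} (D : Set (Eucl n)) (x₀ : Eucl n) (I : Set ℝ) :
    Set (Surface n (n - 1)) :=
  {S | ∃ r ∈ I, S.dom.Nonempty ∧ Set.InjOn S.toFun S.dom ∧
      S.toFun '' S.dom = sphere x₀ r ∩ D}

/-- The image of a family of surfaces under a map `f`. -/
def imageFam {n k : ℕ} (f : Eucl n → Eucl n) (Γ : Set (Surface n k)) :
    Set (Surface n k) :=
  {S' | ∃ S ∈ Γ, S'.dom = S.dom ∧ Set.EqOn S'.toFun (f ∘ S.toFun) S.dom}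

/-- The spherical ring `R(x₀,a,b)`. -/
def ringA {n : ℕ} (x₀ : Eucl n) (a b : ℝ) : Set (Eucl n) :=
  {x | a < dist x x₀ ∧ dist x x₀ < b}

/-- `‖Q‖_α(r) = (∫_{D ∩ S(x₀,r)} Q^α dA)^{1/α}`. -/
def sphNorm {n : ℕ} (D : Set (Eucl n)) (x₀ : Eucl n) (Q : Eucl n → ℝ≥0∞)
    (α : ℝ) (r : ℝ) : ℝ≥0∞ :=
  (∫⁻ x in D ∩ sphere x₀ r, Q x ^ α ∂(μH[((n : ℝ) - 1)] : Measure (Eucl n))) ^ (1 / α)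

/-- `f` is a lower `Q`-homeomorphism w.r.t. the `p`-modulus at `x₀`. -/
def IsLowerQHomeoAt {n : ℕ} (D : Set (Eucl n)) (f : Eucl n → Eucl n)
    (Q : Eucl n → ℝ≥0∞) (p : ℝ) (x₀ : Eucl n) (d₀ : ℝ≥0∞) : Prop :=
  ∀ ε ε₀ : ℝ, 0 < ε → ε < ε₀ → ENNReal.ofReal ε₀ < d₀ →
    (⨅ ρ ∈ extAdm p (n - 1) (sphereFam D x₀ (Ioo ε ε₀)),
        ∫⁻ x in ringA x₀ ε ε₀, ρ x ^ p / Q x) ≤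
      surfModulus p (n - 1) (imageFam f (sphereFam D x₀ (Ioo ε ε₀)))

/-- `f` is a homeomorphism of `D` onto `D'`. -/
structure IsHomeoOn {n : ℕ} (f : Eucl n → Eucl n) (D D' : Set (Eucl n)) : Prop where
  continuousOn : ContinuousOn f D
  injOn : Set.InjOn f D
  image_eq : f '' D = D'
  isOpenMapOn : ∀ U : Set (Eucl n), U ⊆ D → IsOpen U → IsOpen (f '' U)

/-- `Df` is the weak (Sobolev) derivative of `f` on `D`, and `f ∈ W^{1,1}_loc(D)`. -/
def IsWeakDerivOn {n m : ℕ} (D : Set (Eucl n)) (f : Eucl n → Eucl m)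
    (Df : Eucl n → Eucl n →L[ℝ] Eucl m) : Prop :=
  LocallyIntegrableOn f D volume ∧ LocallyIntegrableOn Df D volume ∧
  ∀ ψ : Eucl n → ℝ, ContDiff ℝ (⊤ : ℕ∞) ψ → HasCompactSupport ψ → tsupport ψ ⊆ D →
    ∀ v : Eucl n, ∫ x, ψ x • Df x v = - ∫ x, fderiv ℝ ψ x v • f x

/-- The Frobenius norm `|∇f| = (Σ_{i,j} (∂f_i/∂x_j)²)^{1/2}` of a linear map. -/
def frobNorm {n m : ℕ} (A : Eucl n →L[ℝ] Eucl m) : ℝ :=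
  Real.sqrt (∑ i : Fin m, ∑ j : Fin n, (A (EuclideanSpace.single j 1) i) ^ 2)

/-- The Orlicz–Sobolev class `W^{1,φ}_loc(D)` (with explicit weak derivative `Df`). -/
def MemOrliczSobolevOn {n m : ℕ} (φ : ℝ → ℝ) (D : Set (Eucl n))
    (f : Eucl n → Eucl m) (Df : Eucl n → Eucl n →L[ℝ] Eucl m) : Prop :=
  IsWeakDerivOn D f Df ∧
  ∀ K : Set (Eucl n), K ⊆ D → IsCompact K →
    (∫⁻ x in K, ENNReal.ofReal (φ (frobNorm (Df x)))) < ⊤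

/-- `φ` is nondecreasing and positive on `(0,∞)`. -/
def NondecPos (φ : ℝ → ℝ) : Prop :=
  (∀ s t : ℝ, 0 < s → s ≤ t → φ s ≤ φ t) ∧ ∀ t : ℝ, 0 < t → 0 < φ t

/-- The Calderón-type condition `∫_{t₀}^∞ (t/φ(t))^{1/(n-2)} dt < ∞`. -/
def CalderonCond (n : ℕ) (φ : ℝ → ℝ) : Prop :=
  ∃ t₀ : ℝ, 0 < t₀ ∧
    IntegrableOn (fun t => (t / φ t) ^ (1 / ((n : ℝ) - 2))) (Ioi t₀) volume

/-- `f` (with a.e. derivative `Df`) has finite distortion on `D`. -/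
def HasFiniteDistortionOn {n : ℕ} (D : Set (Eucl n))
    (Df : Eucl n → Eucl n →L[ℝ] Eucl n) : Prop :=
  ∃ K : Eucl n → ℝ, AEMeasurable K (volume.restrict D) ∧
    ∀ᵐ x ∂volume.restrict D, 1 ≤ K x ∧ ‖Df x‖ ^ n ≤ K x * (Df x).det

/-- The distortion `K_p(x,f)` for a map with derivative `Df`. -/
def distortionKp {n : ℕ} (p : ℝ) (Df : Eucl n → Eucl n →L[ℝ] Eucl n)
    (x : Eucl n) : ℝ≥0∞ :=
  if (Df x).det ≠ 0 then ENNReal.ofReal (‖Df x‖ ^ p / (Df x).det)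
  else if Df x = 0 then 1 else ⊤

/-- The multiplicity function of a curve `γ : [0,1] → ℝⁿ`. -/
def curveMult {n : ℕ} (γ : ℝ → Eucl n) (y : Eucl n) : ℝ≥0∞ :=
  (({t ∈ Icc (0:ℝ) 1 | γ t = y}).encard : ℕ∞)

/-- The line integral `∫_γ ρ ds = ∫ ρ(y) N(γ,y) dH¹(y)`. -/
def curveInt {n : ℕ} (γ : ℝ → Eucl n) (ρ : Eucl n → ℝ≥0∞) : ℝ≥0∞ :=
  ∫⁻ y, ρ y * curveMult γ y ∂(μH[(1 : ℝ)] : Measure (Eucl n))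

/-- The family of curves joining `A` and `B` in `G`. -/
def curveJoin {n : ℕ} (A B G : Set (Eucl n)) : Set (ℝ → Eucl n) :=
  {γ | ContinuousOn γ (Icc 0 1) ∧ γ 0 ∈ A ∧ γ 1 ∈ B ∧ Set.MapsTo γ (Icc 0 1) G}

/-- The `q`-modulus of a family of curves. -/
def curveModulus {n : ℕ} (q : ℝ) (Γ : Set (ℝ → Eucl n)) : ℝ≥0∞ :=
  ⨅ ρ ∈ {ρ : Eucl n → ℝ≥0∞ | Measurable ρ ∧ ∀ γ ∈ Γ, 1 ≤ curveInt γ ρ},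
    ∫⁻ x, ρ x ^ q

/-- The `q`-capacity of the condenser `(A,C)`, via the modulus of joining curves. -/
def condenserCap {n : ℕ} (q : ℝ) (A C : Set (Eucl n)) : ℝ≥0∞ :=
  curveModulus q (curveJoin (frontier A) (frontier C) (A \ C))

/-- `L(x₀,f) = limsup_{x→x₀} |f(x)-f(x₀)|/|x-x₀|`. -/
def LAt {n : ℕ} (f : Eucl n → Eucl n) (x₀ : Eucl n) : ℝ≥0∞ :=
  limsup (fun x => edist (f x) (f x₀) / edist x x₀) (𝓝[≠] x₀)

/-- `k_p(x₀) = limsup_{ε→0} (⨍_{B(x₀,ε)} K_p(x,f)^{(n-1)/(p-n+1)} dm)^{(p-n+1)/(n-1)}`. -/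
def kpAt {n : ℕ} (p : ℝ) (Df : Eucl n → Eucl n →L[ℝ] Eucl n) (x₀ : Eucl n) : ℝ≥0∞ :=
  limsup (fun ε : ℝ =>
      ((∫⁻ x in ball x₀ ε, distortionKp p Df x ^ (((n:ℝ)-1)/(p-(n:ℝ)+1))) /
        volume (ball x₀ ε)) ^ ((p-(n:ℝ)+1)/((n:ℝ)-1)))
    (𝓝[>] (0:ℝ))

/-- `f` is absolutely continuous on `S` w.r.t. `d`-dimensional Hausdorff measure. -/
def ACOnSet {n m : ℕ} (f : Eucl n → Eucl m) (S : Set (Eucl n)) (d : ℝ) : Prop :=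
  ∀ ε : ℝ, 0 < ε → ∃ δ : ℝ, 0 < δ ∧ ∀ A : Set (Eucl n), A ⊆ S →
    (μH[d] : Measure (Eucl n)) A < ENNReal.ofReal δ →
      (μH[d] : Measure (Eucl m)) (f '' A) < ENNReal.ofReal ε

/-- `f` is locally absolutely continuous on `S` w.r.t. `H^d`. -/
def LocACOnSet {n m : ℕ} (f : Eucl n → Eucl m) (S : Set (Eucl n)) (d : ℝ) : Prop :=
  ∀ x ∈ S, ∃ V ∈ 𝓝 x, ACOnSet f (S ∩ V) d

/-- The Luzin (N)-property of `f` on `S` w.r.t. `d`-dimensional Hausdorff measure. -/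
def LusinNOn {n m : ℕ} (f : Eucl n → Eucl m) (S : Set (Eucl n)) (d : ℝ) : Prop :=
  ∀ A : Set (Eucl n), A ⊆ S → (μH[d] : Measure (Eucl n)) A = 0 →
    (μH[d] : Measure (Eucl m)) (f '' A) = 0

end

open MeasureTheory Metric Set Filter
open scoped ENNReal NNReal Topology RealInnerProductSpace Classical

/-- averaged segment integral -/
noncomputable def segP {d : ℕ} (Q : Set (Fin d → ℝ)) (x : Fin d → ℝ) (η : ℝ)
    (g : (Fin d → ℝ) → ℝ≥0∞) : ℝ≥0∞ :=
  ∫⁻ l in Ioc η 1, ∫⁻ y in Q, g (x + l • (y - x))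

lemma segP_smooth {d : ℕ} {W : Type*} [NormedAddCommGroup W] [NormedSpace ℝ W] [CompleteSpace W]
    {u : (Fin d → ℝ) → W} (hu : ContDiff ℝ 1 u) {Q : Set (Fin d → ℝ)}
    {x : Fin d → ℝ} {ℓ : ℝ} (hQm : MeasurableSet Q) (hℓ : ∀ y ∈ Q, ‖y - x‖ ≤ ℓ) {η : ℝ}
    (hη1 : η ≤ 1) :
    ∫⁻ y in Q, ‖u y - u (x + η • (y - x))‖ₑ ≤
      ENNReal.ofReal ℓ * segP Q x η (fun z => ‖fderiv ℝ u z‖ₑ) := by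
  have hc : Continuous (fderiv ℝ u) := hu.continuous_fderiv one_ne_zero
  have key : ∀ y ∈ Q, ‖u y - u (x + η • (y - x))‖ₑ ≤
      ∫⁻ l in Ioc η 1, ENNReal.ofReal ℓ * ‖fderiv ℝ u (x + l • (y - x))‖ₑ := by
    intro y hy
    have h1 : ∀ l ∈ uIcc η 1, HasDerivAt (fun l : ℝ => u (x + l • (y - x)))
        (fderiv ℝ u (x + l • (y - x)) (y - x)) l := by
      intro l _
      have h2 : HasDerivAt (fun l : ℝ => x + l • (y - x)) (y - x) l := by
        simpa using ((hasDerivAt_id l).smul_const (y - x)).const_add x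
      exact ((hu.differentiable one_ne_zero _).hasFDerivAt).comp_hasDerivAt l h2
    have h3 := intervalIntegral.integral_eq_sub_of_hasDerivAt h1
      (Continuous.intervalIntegrable (by fun_prop) _ _)
    have h4 : u y - u (x + η • (y - x)) =
        ∫ l in Ioc η 1, fderiv ℝ u (x + l • (y - x)) (y - x) := by
      rw [← intervalIntegral.integral_of_le hη1, h3]; simp
    rw [h4]
    refine (enorm_integral_le_lintegral_enorm _).trans (lintegral_mono fun l => ?_)
    refine (ContinuousLinearMap.le_opENorm _ _).trans ?_
    rw [mul_comm]
    gcongr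
    rw [← ofReal_norm]
    exact ENNReal.ofReal_le_ofReal (hℓ y hy)
  refine (setLIntegral_mono' hQm key).trans ?_
  rw [segP, lintegral_lintegral_swap, ← lintegral_const_mul']
  · refine lintegral_mono fun l => ?_
    rw [lintegral_const_mul' _ _ ENNReal.ofReal_ne_top]
  · exact ENNReal.ofReal_ne_top
  · apply Continuous.aemeasurable
    apply ENNReal.continuous_const_mul ENNReal.ofReal_ne_top |>.comp
    exact (hc.comp (by fun_prop)).enorm

lemma map_homothety {d : ℕ} (x : Fin d → ℝ) {l : ℝ} (hl : 0 < l) :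
    Measure.map (fun y : Fin d → ℝ => x + l • (y - x)) volume =
      ENNReal.ofReal ((l ^ d)⁻¹) • (volume : Measure (Fin d → ℝ)) := by
  have h1 : (fun y : Fin d → ℝ => x + l • (y - x)) =
      (fun z => (x - l • x) + z) ∘ (fun y => l • y) := by
    ext1 y; simp [smul_sub]; abel
  rw [h1, ← Measure.map_map (by fun_prop) (by fun_prop), Measure.map_addHaar_smul _ hl.ne',
    Measure.map_smul, map_add_left_eq_self]
  simp [abs_of_pos hl]

lemma lintegral_homothety_le {d : ℕ} (x : Fin d → ℝ) {l : ℝ} (hl : 0 < l)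
    {Q S : Set (Fin d → ℝ)} (hQ : MeasurableSet Q) (hS : MeasurableSet S)
    (hQS : ∀ y ∈ Q, x + l • (y - x) ∈ S)
    {g : (Fin d → ℝ) → ℝ≥0∞} (hg : Measurable g) :
    ∫⁻ y in Q, g (x + l • (y - x)) ≤ ENNReal.ofReal ((l ^ d)⁻¹) * ∫⁻ y in S, g y := by
  calc ∫⁻ y in Q, g (x + l • (y - x))
      ≤ ∫⁻ y in Q, (S.indicator g) (x + l • (y - x)) := by
        refine setLIntegral_mono' hQ fun y hy => ?_
        rw [indicator_of_mem (hQS y hy)]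
    _ ≤ ∫⁻ y, (S.indicator g) (x + l • (y - x)) := setLIntegral_le_lintegral _ _
    _ = ∫⁻ z, S.indicator g z ∂(Measure.map (fun y : Fin d → ℝ => x + l • (y - x)) volume) := by
        rw [lintegral_map (hg.indicator hS) (by fun_prop)]
    _ = _ := by
        rw [map_homothety x hl, lintegral_smul_measure, lintegral_indicator hS, smul_eq_mul]

lemma segP_le_L1 {d : ℕ} {Q : Set (Fin d → ℝ)} (hQ : MeasurableSet Q) (hQc : Convex ℝ Q)
    {x : Fin d → ℝ} (hx : x ∈ Q) {η : ℝ} (hη : 0 < η)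
    {g : (Fin d → ℝ) → ℝ≥0∞} (hg : Measurable g) :
    segP Q x η g ≤ ENNReal.ofReal ((η ^ d)⁻¹) * ∫⁻ y in Q, g y := by
  have : ∀ l ∈ Ioc η 1, ∫⁻ y in Q, g (x + l • (y - x)) ≤
      ENNReal.ofReal ((η ^ d)⁻¹) * ∫⁻ y in Q, g y := by
    intro l hl
    have hl0 := hη.trans hl.1
    refine (lintegral_homothety_le x hl0 hQ hQ (fun y hy => ?_) hg).trans ?_
    · exact hQc.add_smul_sub_mem hx hy ⟨hl0.le, hl.2⟩
    · gcongr
      exact hl.1.le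
  refine (setLIntegral_mono' measurableSet_Ioc this).trans ?_
  rw [setLIntegral_const]
  refine mul_le_of_le_one_right' ?_
  rw [Real.volume_Ioc, ← ENNReal.ofReal_one]
  exact ENNReal.ofReal_le_ofReal (by linarith)

lemma segP_mono {d : ℕ} {Q : Set (Fin d → ℝ)} {x : Fin d → ℝ} {η η' : ℝ} (h : η' ≤ η)
    {g g' : (Fin d → ℝ) → ℝ≥0∞} (hg : ∀ z, g z ≤ g' z) : segP Q x η g ≤ segP Q x η' g' := by
  unfold segP
  refine (lintegral_mono fun l => lintegral_mono fun y => hg _).trans ?_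
  exact lintegral_mono_set (Ioc_subset_Ioc_left h)

lemma segP_add {d : ℕ} {Q : Set (Fin d → ℝ)} {x : Fin d → ℝ} {η : ℝ}
    {g g' : (Fin d → ℝ) → ℝ≥0∞} (hg : Measurable g) :
    segP Q x η (fun z => g z + g' z) = segP Q x η g + segP Q x η g' := by
  unfold segP
  rw [← lintegral_add_left]
  · refine lintegral_congr fun l => ?_
    rw [lintegral_add_left]
    exact hg.comp (by fun_prop)
  · apply Measurable.lintegral_prod_right' (f := fun q : ℝ × (Fin d → ℝ) => g (x + q.1 • (q.2 - x)))
    exact hg.comp (by fun_prop)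

/-- the limiting segment inequality -/
lemma segP_limit {d : ℕ} {W : Type*} [NormedAddCommGroup W] [NormedSpace ℝ W] [CompleteSpace W]
    [FiniteDimensional ℝ W] [MeasurableSpace W] [BorelSpace W]
    {u : (Fin d → ℝ) → W} {U : ℕ → (Fin d → ℝ) → W} (hU : ∀ k, ContDiff ℝ 1 (U k))
    {G : (Fin d → ℝ) → ((Fin d → ℝ) →L[ℝ] W)} (hG : Measurable G)
    {Q : Set (Fin d → ℝ)} (hQm : MeasurableSet Q) (hQc : Convex ℝ Q)
    (hlim : ∀ y ∈ Q, Tendsto (fun k => U k y) atTop (𝓝 (u y)))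
    (hL : Tendsto (fun k => ∫⁻ y in Q, ‖fderiv ℝ (U k) y - G y‖ₑ) atTop (𝓝 0))
    (hu : ContinuousOn u Q)
    {x : Fin d → ℝ} (hx : x ∈ Q) {ℓ : ℝ} (hℓ : ∀ y ∈ Q, ‖y - x‖ ≤ ℓ) :
    ∫⁻ y in Q, ‖u y - u x‖ₑ ≤ ENNReal.ofReal ℓ * segP Q x 0 (fun z => ‖G z‖ₑ) := by
  have hGm : Measurable fun z => ‖G z‖ₑ := hG.enorm
  -- fixed η
  have step : ∀ η : ℝ, 0 < η → η ≤ 1 → ∫⁻ y in Q, ‖u y - u (x + η • (y - x))‖ₑ ≤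
      ENNReal.ofReal ℓ * segP Q x 0 (fun z => ‖G z‖ₑ) := by
    intro η hη hη1
    have hmem : ∀ y ∈ Q, x + η • (y - x) ∈ Q := fun y hy =>
      hQc.add_smul_sub_mem hx hy ⟨hη.le, hη1⟩
    have hk : ∀ k, ∫⁻ y in Q, ‖U k y - U k (x + η • (y - x))‖ₑ ≤
        ENNReal.ofReal ℓ * segP Q x 0 (fun z => ‖G z‖ₑ) + ENNReal.ofReal ℓ *
          (ENNReal.ofReal ((η ^ d)⁻¹) * ∫⁻ y in Q, ‖fderiv ℝ (U k) y - G y‖ₑ) := by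
      intro k
      refine (segP_smooth (hU k) hQm hℓ hη1).trans ?_
      rw [← mul_add]
      gcongr
      have hm : Measurable fun z => ‖fderiv ℝ (U k) z - G z‖ₑ :=
        ((((hU k).continuous_fderiv one_ne_zero).measurable).sub hG).enorm
      calc segP Q x η (fun z => ‖fderiv ℝ (U k) z‖ₑ)
          ≤ segP Q x η (fun z => ‖G z‖ₑ + ‖fderiv ℝ (U k) z - G z‖ₑ) := by
            refine segP_mono le_rfl fun z => ?_
            simpa using enorm_add_le (G z) (fderiv ℝ (U k) z - G z)
        _ = _ := segP_add hGm
        _ ≤ _ := add_le_add (segP_mono hη.le fun _ => le_rfl) (segP_le_L1 hQm hQc hx hη hm)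
    have hf : ∫⁻ y in Q, ‖u y - u (x + η • (y - x))‖ₑ =
        ∫⁻ y in Q, liminf (fun k => ‖U k y - U k (x + η • (y - x))‖ₑ) atTop := by
      refine setLIntegral_congr_fun hQm fun y hy => ?_
      exact (((hlim y hy).sub (hlim _ (hmem y hy))).enorm.liminf_eq).symm
    rw [hf]
    refine (lintegral_liminf_le fun k => ?_).trans ?_
    · exact (((hU k).continuous).sub ((hU k).continuous.comp (by fun_prop))).enorm.measurable
    refine (liminf_le_liminf (Eventually.of_forall hk)).trans ?_
    refine (Tendsto.liminf_eq ?_).le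
    have := (ENNReal.Tendsto.const_mul (a := ENNReal.ofReal ℓ)
      (ENNReal.Tendsto.const_mul (a := ENNReal.ofReal ((η ^ d)⁻¹)) hL
        (Or.inr ENNReal.ofReal_ne_top)) (Or.inr ENNReal.ofReal_ne_top)).const_add
        (ENNReal.ofReal ℓ * segP Q x 0 (fun z => ‖G z‖ₑ))
    simpa using this
  have hlim2 : ∀ y ∈ Q, Tendsto (fun k : ℕ => ‖u y - u (x + ((1:ℝ) / (k + 1)) • (y - x))‖ₑ) atTop
      (𝓝 ‖u y - u x‖ₑ) := by
    intro y hy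
    refine (tendsto_const_nhds.sub ?_).enorm
    have h1 : Tendsto (fun k : ℕ => x + ((1:ℝ) / (k + 1)) • (y - x)) atTop (𝓝[Q] x) := by
      refine tendsto_nhdsWithin_iff.2 ⟨?_, Eventually.of_forall fun k => ?_⟩
      · have := (tendsto_one_div_add_atTop_nhds_zero_nat (𝕜 := ℝ)).smul_const (y - x)
        simpa using this.const_add x
      · exact hQc.add_smul_sub_mem hx hy ⟨by positivity, by
          rw [div_le_one (by positivity)]; linarith [(Nat.cast_nonneg k : (0:ℝ) ≤ k)]⟩
    exact (hu x hx).tendsto.comp h1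
  have hf : ∫⁻ y in Q, ‖u y - u x‖ₑ =
      ∫⁻ y in Q, liminf (fun k : ℕ => ‖u y - u (x + ((1:ℝ) / (k + 1)) • (y - x))‖ₑ) atTop := by
    refine setLIntegral_congr_fun hQm fun y hy => ((hlim2 y hy).liminf_eq).symm
  rw [hf]
  refine (lintegral_liminf_le' fun k => ?_).trans ?_
  · have h1 : ContinuousOn (fun y => u y - u (x + ((1:ℝ) / (k + 1)) • (y - x))) Q := by
      refine hu.sub (hu.comp (by fun_prop) fun y hy => ?_)
      exact hQc.add_smul_sub_mem hx hy ⟨by positivity, by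
          rw [div_le_one (by positivity)]; linarith [(Nat.cast_nonneg k : (0:ℝ) ≤ k)]⟩
    exact (h1.aemeasurable hQm).enorm
  · refine liminf_le_of_frequently_le' (Frequently.of_forall fun k => step _ (by positivity) ?_)
    rw [div_le_one (by positivity)]; linarith [(Nat.cast_nonneg k : (0:ℝ) ≤ k)]

open MeasureTheory Metric Set Filter
open scoped ENNReal NNReal Topology RealInnerProductSpace Classical

lemma lint_inv_pow {d : ℕ} (hd : 2 ≤ d) {b : ℝ} (hb : 0 < b) :
    ∫⁻ l in Ioc b 1, ENNReal.ofReal ((l ^ d)⁻¹) ≤ ENNReal.ofReal ((b ^ (d - 1))⁻¹) := by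
  have h0 : ∀ l ∈ Ioc b 1, ENNReal.ofReal ((l ^ d)⁻¹) ≤
      ENNReal.ofReal ((b ^ (d - 2))⁻¹) * ENNReal.ofReal (l ^ (-2 : ℝ)) := by
    intro l hl
    have hl0 : 0 < l := hb.trans hl.1
    rw [← ENNReal.ofReal_mul (by positivity)]
    apply ENNReal.ofReal_le_ofReal
    obtain ⟨e, rfl⟩ := Nat.exists_eq_add_of_le hd
    have h2 : l ^ (-2 : ℝ) = (l ^ 2)⁻¹ := by
      rw [Real.rpow_neg hl0.le]; norm_num
    rw [h2, Nat.add_sub_cancel_left, ← mul_inv]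
    apply inv_anti₀ (by positivity)
    rw [pow_add, mul_comm]
    gcongr
    exact hl.1.le
  refine (setLIntegral_mono' measurableSet_Ioc h0).trans ?_
  rw [lintegral_const_mul' _ _ ENNReal.ofReal_ne_top]
  have h3 : ∫⁻ l in Ioc b 1, ENNReal.ofReal (l ^ (-2 : ℝ)) ≤ ENNReal.ofReal (b⁻¹) := by
    refine (lintegral_mono_set (t := Ioi b) Ioc_subset_Ioi_self).trans ?_
    rw [← ofReal_integral_eq_lintegral_ofReal (integrableOn_Ioi_rpow_of_lt (by norm_num) hb)]
    · rw [integral_Ioi_rpow_of_lt (by norm_num) hb]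
      apply ENNReal.ofReal_le_ofReal
      norm_num [Real.rpow_neg_one]
    · filter_upwards [ae_restrict_mem measurableSet_Ioi] with l hl
      have : 0 < l := hb.trans hl
      positivity
  calc _ ≤ ENNReal.ofReal ((b ^ (d - 2))⁻¹) * ENNReal.ofReal (b⁻¹) := by gcongr
    _ = _ := by
      rw [← ENNReal.ofReal_mul (by positivity), ← mul_inv, ← pow_succ]
      congr 4; omega

lemma segP_ind {d : ℕ} (hd : 2 ≤ d) {Q : Set (Fin d → ℝ)} (hQ : MeasurableSet Q)
    (hQc : Convex ℝ Q) {L : ℝ} (hL : 0 < L) (hvol : volume Q = ENNReal.ofReal L ^ d)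
    {x : Fin d → ℝ} (hx : x ∈ Q) {A : Set (Fin d → ℝ)} (hA : MeasurableSet A) :
    segP Q x 0 (A.indicator 1) ≤
      2 * ENNReal.ofReal L ^ (d - 1) * (volume (A ∩ Q)) ^ (1 / (d:ℝ)) := by
  have hd0 : (d:ℝ) ≠ 0 := by positivity
  have hAm : Measurable (A.indicator (1 : (Fin d → ℝ) → ℝ≥0∞)) := measurable_one.indicator hA
  have hint : ∫⁻ y in Q, A.indicator (1 : (Fin d → ℝ) → ℝ≥0∞) y = volume (A ∩ Q) := by
    rw [lintegral_indicator hA, Measure.restrict_restrict hA]; simp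
  have hinner : ∀ l ∈ Ioc (0:ℝ) 1, ∫⁻ y in Q, A.indicator (1 : (Fin d → ℝ) → ℝ≥0∞)
      (x + l • (y - x)) ≤ ENNReal.ofReal ((l ^ d)⁻¹) * volume (A ∩ Q) := by
    intro l hl
    rw [← hint]
    exact lintegral_homothety_le x hl.1 hQ hQ
      (fun y hy => hQc.add_smul_sub_mem hx hy ⟨hl.1.le, hl.2⟩) hAm
  have hinner2 : ∀ l : ℝ, ∫⁻ y in Q, A.indicator (1 : (Fin d → ℝ) → ℝ≥0∞)
      (x + l • (y - x)) ≤ ENNReal.ofReal L ^ d := by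
    intro l
    rw [← hvol]
    refine (lintegral_mono (g := fun _ => 1) fun y => ?_).trans (by simp)
    exact indicator_le_self' (by simp) _
  have hafin : volume (A ∩ Q) ≤ ENNReal.ofReal (L ^ d) := by
    rw [ENNReal.ofReal_pow hL.le, ← hvol]; exact measure_mono inter_subset_right
  have hatop : volume (A ∩ Q) ≠ ⊤ := (hafin.trans_lt ENNReal.ofReal_lt_top).ne
  by_cases ha : volume (A ∩ Q) = 0
  · have : segP Q x 0 (A.indicator 1) ≤ 0 := by
      unfold segP
      refine (setLIntegral_mono' measurableSet_Ioc hinner).trans ?_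
      simp [ha]
    exact this.trans (zero_le)
  set a := (volume (A ∩ Q)).toReal with hadef
  have hapos : 0 < a := ENNReal.toReal_pos ha hatop
  have haeq : volume (A ∩ Q) = ENNReal.ofReal a := (ENNReal.ofReal_toReal hatop).symm
  have haL : a ≤ L ^ d := by
    rw [haeq] at hafin
    exact (ENNReal.ofReal_le_ofReal_iff (by positivity)).1 hafin
  set c := a ^ (1 / (d:ℝ)) with hc
  have hcpos : 0 < c := by positivity
  have hcd : c ^ d = a := by
    rw [hc, ← Real.rpow_natCast, ← Real.rpow_mul hapos.le]; simp [hd0]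
  have hcL : c ≤ L := by
    rw [← hcd] at haL
    exact (pow_le_pow_iff_left₀ hcpos.le hL.le (by omega)).1 haL
  set b := c / L with hb
  have hbpos : 0 < b := by positivity
  have hb1 : b ≤ 1 := by rw [hb, div_le_one hL]; exact hcL
  have hsplit : Ioc (0:ℝ) 1 = Ioc 0 b ∪ Ioc b 1 := (Ioc_union_Ioc_eq_Ioc hbpos.le hb1).symm
  have e1 : ENNReal.ofReal L ^ d * ENNReal.ofReal b ≤ ENNReal.ofReal L ^ (d - 1) * ENNReal.ofReal c := by
    rw [← ENNReal.ofReal_pow hL.le, ← ENNReal.ofReal_pow hL.le, ← ENNReal.ofReal_mul (by positivity),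
      ← ENNReal.ofReal_mul (by positivity)]
    apply ENNReal.ofReal_le_ofReal
    obtain ⟨e, rfl⟩ : ∃ e, d = e + 1 := ⟨d - 1, by omega⟩
    simp only [Nat.add_sub_cancel, hb, pow_succ]
    field_simp; exact le_rfl
  have e2 : ENNReal.ofReal ((b ^ (d - 1))⁻¹) * ENNReal.ofReal a ≤
      ENNReal.ofReal L ^ (d - 1) * ENNReal.ofReal c := by
    rw [← ENNReal.ofReal_pow hL.le, ← ENNReal.ofReal_mul (by positivity),
      ← ENNReal.ofReal_mul (by positivity)]
    apply ENNReal.ofReal_le_ofReal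
    rw [← hcd]
    obtain ⟨e, rfl⟩ : ∃ e, d = e + 1 := ⟨d - 1, by omega⟩
    simp only [Nat.add_sub_cancel, hb, pow_succ, div_pow]
    field_simp; exact le_rfl
  have : segP Q x 0 (A.indicator 1) ≤ ENNReal.ofReal L ^ d * ENNReal.ofReal b +
      ENNReal.ofReal ((b ^ (d - 1))⁻¹) * ENNReal.ofReal a := by
    unfold segP
    rw [hsplit]
    refine (lintegral_union_le _ _ _).trans (add_le_add ?_ ?_)
    · refine (lintegral_mono hinner2).trans ?_
      simp
    · refine (setLIntegral_mono' measurableSet_Ioc fun l hl => hinner l ⟨hbpos.trans hl.1, hl.2⟩).trans ?_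
      rw [haeq, lintegral_mul_const' _ _ ENNReal.ofReal_ne_top]
      gcongr
      exact lint_inv_pow hd hbpos
  refine this.trans ((add_le_add e1 e2).trans ?_)
  rw [haeq, ENNReal.ofReal_rpow_of_pos hapos, ← hc, two_mul, add_mul]

lemma level_decomp {g : ℝ≥0∞} (hg : g ≠ ⊤) {t : ℝ≥0} (ht : 0 < t) :
    g ≤ t + ∑' k : ℕ, (if (t:ℝ≥0∞) * 2 ^ k < g ∧ g ≤ t * 2 ^ (k+1) then (t:ℝ≥0∞) * 2 ^ (k+1) else 0) := by
  by_cases h : g ≤ t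
  · exact h.trans le_self_add
  push Not at h
  have hex : ∃ k : ℕ, g ≤ (t:ℝ≥0∞) * 2 ^ k := by
    lift g to ℝ≥0 using hg
    obtain ⟨k, hk⟩ := pow_unbounded_of_one_lt (g / t) (one_lt_two)
    refine ⟨k, ?_⟩
    rw [div_lt_iff₀ ht] at hk
    rw [mul_comm]
    exact_mod_cast hk.le
  have h1 := Nat.find_spec hex
  have h2 : Nat.find hex ≠ 0 := by
    intro h0
    rw [h0] at h1
    simp at h1
    exact absurd h1 (not_le.2 h)
  obtain ⟨k, hk⟩ := Nat.exists_eq_succ_of_ne_zero h2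
  have h3 := Nat.find_min hex (m := k) (by omega)
  rw [hk] at h1
  refine le_trans ?_ le_add_self
  refine le_trans ?_ (ENNReal.le_tsum k)
  rw [if_pos ⟨not_le.1 h3, h1⟩]
  exact h1

/-- Oscillation bound on a cube -/
lemma segP_osc {d : ℕ} (hd : 2 ≤ d) {Q : Set (Fin d → ℝ)} (hQ : MeasurableSet Q)
    (hQc : Convex ℝ Q) {L : ℝ} (hL : 0 < L) (hvol : volume Q = ENNReal.ofReal L ^ d)
    {x : Fin d → ℝ} (hx : x ∈ Q) {g h : (Fin d → ℝ) → ℝ≥0∞} (hg : Measurable g)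
    (hgt : ∀ z, g z ≠ ⊤) (hh : Measurable h)
    {t : ℝ≥0} (ht : 0 < t) {b : ℕ → ℝ≥0∞} (hb0 : ∀ k, b k ≠ 0) (hbt : ∀ k, b k ≠ ⊤)
    (hbh : ∀ k z, (t:ℝ≥0∞) * 2 ^ k < g z → b k ≤ h z) :
    segP Q x 0 g ≤ ENNReal.ofReal L ^ (d - 1) * (t * ENNReal.ofReal L + 4 *
      ((∑' k, (((t:ℝ≥0∞) * 2 ^ k) ^ (d:ℝ) / b k) ^ (1 / ((d:ℝ) - 1))) ^ (((d:ℝ) - 1) / d) *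
       (∫⁻ y in Q ∩ {z | (t:ℝ≥0∞) < g z}, h y) ^ (1 / (d:ℝ)))) := by
  have hd1 : (1:ℝ) < d := by exact_mod_cast hd
  have hd0 : (0:ℝ) < d := by linarith
  set A : ℕ → Set (Fin d → ℝ) := fun k => {z | (t:ℝ≥0∞) * 2 ^ k < g z ∧ g z ≤ t * 2 ^ (k+1)} with hAdef
  have hA : ∀ k, MeasurableSet (A k) := fun k =>
    (measurableSet_lt measurable_const hg).inter (measurableSet_le hg measurable_const)
  have hdec : ∀ z, g z ≤ t + ∑' k, ((t:ℝ≥0∞) * 2 ^ (k+1)) * (A k).indicator 1 z := by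
    intro z
    refine (level_decomp (hgt z) ht).trans_eq ?_
    congr 2
    ext k
    by_cases hz : z ∈ A k
    · have hz' := hz
      simp only [hAdef, mem_setOf_eq] at hz'
      rw [indicator_of_mem hz, if_pos hz']; simp
    · have hz' := hz
      simp only [hAdef, mem_setOf_eq] at hz'
      rw [indicator_of_notMem hz, if_neg hz']; simp
  have hmi : ∀ k, Measurable fun z => ((t:ℝ≥0∞) * 2 ^ (k+1)) * (A k).indicator 1 z := fun k =>
    (measurable_one.indicator (hA k)).const_mul _
  have h1 : segP Q x 0 g ≤ t * ENNReal.ofReal L ^ d +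
      ∑' k, ((t:ℝ≥0∞) * 2 ^ (k+1)) * segP Q x 0 ((A k).indicator 1) := by
    refine (segP_mono le_rfl hdec).trans ?_
    rw [segP_add measurable_const]
    refine add_le_add ?_ ?_
    · unfold segP
      simp [hvol]
    · unfold segP
      have hm1 : ∀ k, Measurable fun l : ℝ => ∫⁻ y in Q,
          ((t:ℝ≥0∞) * 2 ^ (k+1)) * (A k).indicator 1 (x + l • (y - x)) := by
        intro k
        apply Measurable.lintegral_prod_right' (f := fun q : ℝ × (Fin d → ℝ) =>
          ((t:ℝ≥0∞) * 2 ^ (k+1)) * (A k).indicator 1 (x + q.1 • (q.2 - x)))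
        exact (hmi k).comp (by fun_prop)
      have hin : ∀ l : ℝ, ∫⁻ y in Q, ∑' k, ((t:ℝ≥0∞) * 2 ^ (k+1)) * (A k).indicator 1 (x + l • (y - x))
          = ∑' k, ∫⁻ y in Q, ((t:ℝ≥0∞) * 2 ^ (k+1)) * (A k).indicator 1 (x + l • (y - x)) := by
        intro l
        rw [lintegral_tsum]
        intro k
        exact ((hmi k).comp (by fun_prop)).aemeasurable
      simp_rw [hin]
      rw [lintegral_tsum (fun k => (hm1 k).aemeasurable)]
      apply ENNReal.tsum_le_tsum
      intro k
      have hne : (t:ℝ≥0∞) * 2 ^ (k+1) ≠ ⊤ := by finiteness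
      rw [← lintegral_const_mul' _ _ hne]
      apply lintegral_mono
      intro l
      simp only
      rw [lintegral_const_mul' _ _ hne]
  set M : ℕ → ℝ≥0∞ := fun k => ∫⁻ y in Q ∩ A k, h y with hM
  have hcheb : ∀ k, volume (A k ∩ Q) ≤ M k / b k := by
    intro k
    rw [ENNReal.le_div_iff_mul_le (Or.inl (hb0 k)) (Or.inl (hbt k)), mul_comm, inter_comm,
      ← setLIntegral_const]
    exact setLIntegral_mono' (hQ.inter (hA k)) fun z hz => hbh k z hz.2.1
  have hMs : ∑' k, M k ≤ ∫⁻ y in Q ∩ {z | (t:ℝ≥0∞) < g z}, h y := by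
    rw [hM, ← lintegral_iUnion]
    · apply lintegral_mono_set
      refine iUnion_subset fun k z hz => ⟨hz.1, ?_⟩
      refine lt_of_le_of_lt ?_ hz.2.1
      exact le_mul_of_one_le_right' (one_le_pow₀ (by norm_num))
    · exact fun k => hQ.inter (hA k)
    · have key : ∀ i j, i < j → Disjoint (Q ∩ A i) (Q ∩ A j) := by
        intro i j hij
        rw [Set.disjoint_left]
        rintro z ⟨_, hz⟩ ⟨_, hz'⟩
        have h5 : (t:ℝ≥0∞) * 2 ^ (i+1) ≤ t * 2 ^ j := by
          gcongr
          · norm_num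
          · omega
        exact absurd (hz.2.trans h5) (not_le.2 hz'.1)
      intro i j hij
      rcases lt_or_gt_of_ne hij with h | h
      · exact key i j h
      · exact (key j i h).symm
  have hterm : ∀ k, ((t:ℝ≥0∞) * 2 ^ (k+1)) * segP Q x 0 ((A k).indicator 1) ≤
      4 * ENNReal.ofReal L ^ (d - 1) * (((((t:ℝ≥0∞) * 2 ^ k) ^ (d:ℝ) / b k) ^ (1 / (d:ℝ))) * M k ^ (1 / (d:ℝ))) := by
    intro k
    have e1 : ((((t:ℝ≥0∞) * 2 ^ k) ^ (d:ℝ) / b k) ^ (1 / (d:ℝ))) * M k ^ (1 / (d:ℝ)) =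
        ((t:ℝ≥0∞) * 2 ^ k) * (M k / b k) ^ (1 / (d:ℝ)) := by
      rw [← ENNReal.mul_rpow_of_nonneg _ _ (by positivity)]
      have : ((t:ℝ≥0∞) * 2 ^ k) ^ (d:ℝ) / b k * M k = ((t:ℝ≥0∞) * 2 ^ k) ^ (d:ℝ) * (M k / b k) := by
        simp only [div_eq_mul_inv]; ring
      rw [this, ENNReal.mul_rpow_of_nonneg _ _ (by positivity), ← ENNReal.rpow_mul,
        mul_one_div_cancel hd0.ne', ENNReal.rpow_one]
    rw [e1]
    calc _ ≤ ((t:ℝ≥0∞) * 2 ^ (k+1)) * (2 * ENNReal.ofReal L ^ (d - 1) * (M k / b k) ^ (1 / (d:ℝ))) := by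
          gcongr
          refine (segP_ind hd hQ hQc hL hvol hx (hA k)).trans ?_
          gcongr
          exact hcheb k
      _ = _ := by rw [pow_succ]; ring
  have hhol : ∑' k, ((((t:ℝ≥0∞) * 2 ^ k) ^ (d:ℝ) / b k) ^ (1 / (d:ℝ))) * M k ^ (1 / (d:ℝ)) ≤
      (∑' k, (((t:ℝ≥0∞) * 2 ^ k) ^ (d:ℝ) / b k) ^ (1 / ((d:ℝ) - 1))) ^ (((d:ℝ) - 1) / d) *
        (∑' k, M k) ^ (1 / (d:ℝ)) := by
    have hpq : ((d:ℝ) / (d - 1)).HolderConjugate d := by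
      have := (Real.HolderConjugate.conjExponent hd1).symm
      simpa [Real.conjExponent] using this
    have := ENNReal.lintegral_mul_le_Lp_mul_Lq (Measure.count : Measure ℕ) hpq
      (f := fun k => (((t:ℝ≥0∞) * 2 ^ k) ^ (d:ℝ) / b k) ^ (1 / (d:ℝ)))
      (g := fun k => M k ^ (1 / (d:ℝ))) (measurable_of_countable _).aemeasurable
      (measurable_of_countable _).aemeasurable
    simp only [lintegral_count, Pi.mul_apply] at this
    refine this.trans_eq ?_
    congr 1
    · rw [one_div_div]
      congr 2
      ext k
      rw [← ENNReal.rpow_mul]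
      congr 1
      field_simp
    · congr 2
      ext k
      rw [← ENNReal.rpow_mul, one_div_mul_cancel hd0.ne', ENNReal.rpow_one]
  refine h1.trans ?_
  have e3 : (t:ℝ≥0∞) * ENNReal.ofReal L ^ d = ENNReal.ofReal L ^ (d-1) * (t * ENNReal.ofReal L) := by
    have : d = (d - 1) + 1 := by omega
    rw [this, pow_succ]; simp; ring
  rw [mul_add, e3]
  gcongr
  refine (ENNReal.tsum_le_tsum hterm).trans ?_
  rw [ENNReal.tsum_mul_left]
  calc _ ≤ 4 * ENNReal.ofReal L ^ (d - 1) * ((∑' k, (((t:ℝ≥0∞) * 2 ^ k) ^ (d:ℝ) / b k) ^ (1 / ((d:ℝ) - 1))) ^ (((d:ℝ) - 1) / d) *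
        (∑' k, M k) ^ (1 / (d:ℝ))) := by gcongr
    _ ≤ 4 * ENNReal.ofReal L ^ (d - 1) * ((∑' k, (((t:ℝ≥0∞) * 2 ^ k) ^ (d:ℝ) / b k) ^ (1 / ((d:ℝ) - 1))) ^ (((d:ℝ) - 1) / d) *
        (∫⁻ y in Q ∩ {z | (t:ℝ≥0∞) < g z}, h y) ^ (1 / (d:ℝ))) := by gcongr
    _ = _ := by ring

open MeasureTheory Metric Set Filter
open scoped ENNReal NNReal Topology RealInnerProductSpace Classical

/-- dyadic cell -/
def dcell (d N : ℕ) (k : Fin d → ℤ) : Set (Fin d → ℝ) := {x | ∀ j, ⌊x j * 2 ^ N⌋ = k j}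

lemma dcell_eq {d N : ℕ} (k : Fin d → ℤ) : dcell d N k =
    Set.pi univ (fun j => Ico ((k j : ℝ) * (1/2) ^ N) (((k j : ℝ) + 1) * (1/2) ^ N)) := by
  ext x
  simp only [dcell, mem_ofPred_eq, Set.mem_pi, mem_univ, true_imp_iff, mem_Ico, Int.floor_eq_iff]
  refine forall_congr' fun j => ?_
  have h2 : (0:ℝ) < 2 ^ N := by positivity
  rw [one_div, inv_pow, ← div_eq_mul_inv, ← div_eq_mul_inv, div_le_iff₀ h2, lt_div_iff₀ h2]

lemma dcell_vol {d N : ℕ} (k : Fin d → ℤ) :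
    volume (dcell d N k) = ENNReal.ofReal ((1/2) ^ N) ^ d := by
  rw [dcell_eq, Real.volume_pi_Ico]
  simp [add_mul]

lemma dcell_meas {d N : ℕ} (k : Fin d → ℤ) : MeasurableSet (dcell d N k) := by
  rw [dcell_eq]; exact MeasurableSet.univ_pi fun _ => measurableSet_Ico

lemma dcell_convex {d N : ℕ} (k : Fin d → ℤ) : Convex ℝ (dcell d N k) := by
  rw [dcell_eq]; exact convex_pi fun _ _ => convex_Ico _ _

lemma dcell_norm {d N : ℕ} {k : Fin d → ℤ} {x y : Fin d → ℝ} (hx : x ∈ dcell d N k)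
    (hy : y ∈ dcell d N k) : ‖y - x‖ ≤ (1/2) ^ N := by
  rw [dcell_eq] at hx hy
  rw [pi_norm_le_iff_of_nonneg (by positivity)]
  intro j
  have h1 := hx j (mem_univ _)
  have h2 := hy j (mem_univ _)
  simp only [mem_Ico] at h1 h2
  rw [Real.norm_eq_abs, abs_le, Pi.sub_apply]
  constructor <;> linarith

lemma dcell_succ {d N : ℕ} {x y : Fin d → ℝ}
    (h : y ∈ dcell d (N+1) (fun j => ⌊x j * 2 ^ (N+1)⌋)) :
    y ∈ dcell d N (fun j => ⌊x j * 2 ^ N⌋) := by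
  intro j
  have h1 := h j
  have key : ∀ a : ℝ, ⌊a * 2 ^ N⌋ = ⌊a * 2 ^ (N+1)⌋ / 2 := by
    intro a
    have := Int.mul_cast_floor_div_cancel_of_pos (n := 2) (by norm_num) (a * 2 ^ N)
    rw [pow_succ, ← mul_assoc]
    exact_mod_cast this.symm
  simp only at h1 ⊢
  rw [key, key, h1]

lemma covering {d : ℕ} {Z : Type*} [MeasurableSpace Z] (μ : Measure Z)
    (ν : Measure (Fin d → ℝ)) {u : (Fin d → ℝ) → Z} {U : Set (Fin d → ℝ)} (hU : IsOpen U)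
    (H : ∀ N k, dcell d N k ⊆ U → μ (u '' dcell d N k) ≤ ν (dcell d N k)) :
    μ (u '' U) ≤ ν U := by
  set V : ℕ → Set (Fin d → ℝ) := fun N => {x | dcell d N (fun j => ⌊x j * 2 ^ N⌋) ⊆ U} with hV
  have hself : ∀ N x, x ∈ dcell d N (fun j => ⌊x j * 2 ^ N⌋) := fun N x j => rfl
  have hmono : Monotone V := monotone_nat_of_le_succ fun N x hx y hy => hx (dcell_succ hy)
  have hVU : ∀ N, V N ⊆ U := fun N x hx => hx (hself N x)
  have hun : ⋃ N, V N = U := by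
    refine subset_antisymm (iUnion_subset hVU) fun x hx => ?_
    obtain ⟨δ, hδ, hb⟩ := Metric.isOpen_iff.1 hU x hx
    obtain ⟨N, hN⟩ := exists_pow_lt_of_lt_one hδ (show (1/2:ℝ) < 1 by norm_num)
    refine mem_iUnion.2 ⟨N, fun y hy => hb ?_⟩
    rw [mem_ball, dist_eq_norm]
    exact (dcell_norm (hself N x) hy).trans_lt hN
  have hbound : ∀ N, μ (u '' V N) ≤ ν U := by
    intro N
    set I : Set (Fin d → ℤ) := {k | dcell d N k ⊆ U}
    have hVeq : V N = ⋃ k ∈ I, dcell d N k := by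
      ext x
      simp only [mem_iUnion]
      constructor
      · intro hx
        exact ⟨_, hx, hself N x⟩
      · rintro ⟨k, hk, hx⟩
        have : k = fun j => ⌊x j * 2 ^ N⌋ := by ext j; exact (hx j).symm
        subst this
        exact hk
    calc μ (u '' V N) = μ (⋃ k ∈ I, u '' dcell d N k) := by rw [hVeq, image_iUnion₂]
      _ ≤ ∑' k : I, μ (u '' dcell d N k) := measure_biUnion_le _ (to_countable I) _
      _ ≤ ∑' k : I, ν (dcell d N k) := ENNReal.tsum_le_tsum fun k => H N k k.2
      _ = ν (⋃ k ∈ I, dcell d N k) := by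
        rw [measure_biUnion (to_countable I) ?_ fun k _ => dcell_meas k]
        intro k _ k' _ hne
        refine Set.disjoint_left.2 fun x hx hx' => hne ?_
        ext j
        rw [← hx j, ← hx' j]
      _ ≤ ν U := measure_mono (hVeq ▸ hVU N)
  calc μ (u '' U) = μ (⋃ N, u '' V N) := by rw [← image_iUnion, hun]
    _ = ⨆ N, μ (u '' V N) := Monotone.measure_iUnion fun a b hab => image_mono (hmono hab)
    _ ≤ _ := iSup_le hbound

lemma ennreal_add_pow_le (a b : ℝ≥0∞) (d : ℕ) : (a + b) ^ d ≤ 2 ^ d * (a ^ d + b ^ d) := by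
  have h : a + b ≤ 2 * max a b := by
    rw [two_mul]; exact add_le_add (le_max_left _ _) (le_max_right _ _)
  calc (a + b) ^ d ≤ (2 * max a b) ^ d := by gcongr
    _ = 2 ^ d * max a b ^ d := mul_pow _ _ _
    _ ≤ _ := by
      gcongr
      rcases max_choice a b with h | h <;> rw [h]
      · exact le_self_add
      · exact le_add_self

/-- constant in `image_bound` -/
noncomputable def imC (d : ℕ) (c0 : ℝ≥0) : ℝ≥0∞ := (2 * c0) ^ d * 2 ^ d

lemma image_bound_level {d : ℕ} (hd : 2 ≤ d) {Z : Type*} [MeasurableSpace Z] [PseudoEMetricSpace Z]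
    (μ : Measure Z) (hμ : ∀ S, μ S ≤ ediam S ^ d) {c0 : ℝ≥0}
    {u : (Fin d → ℝ) → Z} {U : Set (Fin d → ℝ)} (hU : IsOpen U) (hUf : volume U ≠ ⊤)
    {g h : (Fin d → ℝ) → ℝ≥0∞} (hg : Measurable g) (hgt : ∀ z, g z ≠ ⊤) (hh : Measurable h)
    (hhU : ∫⁻ y in U, h y ≠ ⊤)
    {b : ℝ≥0 → ℝ≥0∞} (hb0 : ∀ t, 0 < t → b t ≠ 0) (hbt : ∀ t, b t ≠ ⊤)
    (hbh : ∀ (t : ℝ≥0) z, 0 < t → (t:ℝ≥0∞) < g z → b t ≤ h z)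
    (hS : ∀ t : ℝ≥0, 0 < t → ∑' k : ℕ, (((t:ℝ≥0∞) * 2 ^ k) ^ (d:ℝ) / b (t * 2 ^ k)) ^ (1 / ((d:ℝ) - 1)) ≠ ⊤)
    (H : ∀ Q, MeasurableSet Q → Convex ℝ Q → Q ⊆ U → ∀ x ∈ Q, ∀ ℓ : ℝ, (∀ y ∈ Q, ‖y - x‖ ≤ ℓ) →
      ∫⁻ y in Q, edist (u y) (u x) ≤ ENNReal.ofReal ℓ * (c0 * segP Q x 0 g))
    (hum : ∀ x ∈ U, ∀ Q ⊆ U, MeasurableSet Q → AEMeasurable (fun y => edist (u y) (u x)) (volume.restrict Q))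
    {t : ℝ≥0} (ht : 0 < t) {E : Set (Fin d → ℝ)} (hE : MeasurableSet E) (hEU : E ⊆ U)
    (hEg : ∀ z ∈ E, g z ≤ t) : μ (u '' E) ≤ imC d c0 * (t ^ d * volume E) := by
  have hd1 : (1:ℝ) < d := by exact_mod_cast hd
  have hd0 : (0:ℝ) < d := by linarith
  set S := ∑' k : ℕ, (((t:ℝ≥0∞) * 2 ^ k) ^ (d:ℝ) / b (t * 2 ^ k)) ^ (1 / ((d:ℝ) - 1)) with hSdef
  set T : Set (Fin d → ℝ) := {z | (t:ℝ≥0∞) < g z} with hT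
  have hTm : MeasurableSet T := measurableSet_lt measurable_const hg
  set C' : ℝ≥0∞ := 4 ^ d * S ^ ((d:ℝ) - 1) with hC'
  have hC't : C' ≠ ⊤ := ENNReal.mul_ne_top (by finiteness)
    (ENNReal.rpow_ne_top_of_nonneg (by linarith) (hS t ht))
  set ν : Measure (Fin d → ℝ) := (imC d c0) • ((t:ℝ≥0∞) ^ d • volume + C' • volume.withDensity (T.indicator h)) with hν
  have himC : imC d c0 ≠ ⊤ := by unfold imC; finiteness
  have hνap : ∀ A, MeasurableSet A → ν A = imC d c0 * (t ^ d * volume A + C' * ∫⁻ y in A ∩ T, h y) := by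
    intro A hA
    simp only [hν, Measure.smul_apply, Measure.add_apply, smul_eq_mul]
    rw [withDensity_apply _ hA, lintegral_indicator hTm, Measure.restrict_restrict hTm, inter_comm]
  have hcell : ∀ N k, dcell d N k ⊆ U → μ (u '' dcell d N k) ≤ ν (dcell d N k) := by
    intro N k hQU
    set Q := dcell d N k with hQ
    set L : ℝ := (1/2) ^ N with hL
    have hLpos : 0 < L := by positivity
    have hLp : ENNReal.ofReal L ≠ 0 := by simpa using hLpos
    have hv : volume Q = ENNReal.ofReal L ^ d := dcell_vol k
    set B : ℝ≥0∞ := t * ENNReal.ofReal L + 4 * (S ^ (((d:ℝ) - 1) / d) * (∫⁻ y in Q ∩ T, h y) ^ (1 / (d:ℝ))) with hB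
    have hav : ∀ x ∈ Q, ∫⁻ y in Q, edist (u y) (u x) ≤ volume Q * (c0 * B) := by
      intro x hx
      refine (H Q (dcell_meas k) (dcell_convex k) hQU x hx L fun y hy => dcell_norm hx hy).trans ?_
      have h1 := segP_osc hd (dcell_meas k) (dcell_convex k) hLpos hv hx hg hgt hh ht
        (b := fun k => b (t * 2 ^ k)) (fun k => hb0 _ (by positivity)) (fun k => hbt _)
        (fun k z hz => hbh _ z (by positivity) (by push_cast; exact hz))
      calc _ ≤ ENNReal.ofReal L * (c0 * (ENNReal.ofReal L ^ (d - 1) * B)) := by gcongr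
        _ = ENNReal.ofReal L ^ (d - 1 + 1) * (c0 * B) := by rw [pow_succ]; ring
        _ = _ := by rw [hv]; congr 2; omega
    have hed : ∀ x ∈ Q, ∀ x' ∈ Q, edist (u x) (u x') ≤ 2 * c0 * B := by
      intro x hx x' hx'
      have h1 : volume Q * edist (u x) (u x') ≤ volume Q * (2 * c0 * B) := by
        calc volume Q * edist (u x) (u x') = ∫⁻ y in Q, edist (u x) (u x') := by
              rw [setLIntegral_const, mul_comm]
          _ ≤ ∫⁻ y in Q, (edist (u y) (u x) + edist (u y) (u x')) :=
              lintegral_mono fun y => edist_triangle_left _ _ _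
          _ = _ := lintegral_add_left' (hum x (hQU hx) Q hQU (dcell_meas k)) _
          _ ≤ _ := add_le_add (hav x hx) (hav x' hx')
          _ = _ := by ring
      refine (ENNReal.mul_le_mul_iff_right ?_ ?_).1 h1
      · rw [hv]; exact pow_ne_zero _ hLp
      · rw [hv]; finiteness
    have hdiam : ediam (u '' Q) ≤ 2 * c0 * B := by
      refine ediam_le ?_
      rintro _ ⟨x, hx, rfl⟩ _ ⟨x', hx', rfl⟩
      exact hed x hx x' hx'
    rw [hνap _ (dcell_meas k)]
    calc μ (u '' Q) ≤ ediam (u '' Q) ^ d := hμ _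
      _ ≤ (2 * c0 * B) ^ d := by gcongr
      _ = (2 * c0) ^ d * B ^ d := mul_pow _ _ _
      _ ≤ (2 * c0) ^ d * (2 ^ d * ((t * ENNReal.ofReal L) ^ d + (4 * (S ^ (((d:ℝ) - 1) / d) * (∫⁻ y in Q ∩ T, h y) ^ (1 / (d:ℝ)))) ^ d)) := by
        gcongr
        exact ennreal_add_pow_le _ _ _
      _ = _ := by
        rw [imC, hv, hC']
        have e1 : (S ^ (((d:ℝ) - 1) / d)) ^ d = S ^ ((d:ℝ) - 1) := by
          rw [← ENNReal.rpow_natCast, ← ENNReal.rpow_mul, div_mul_cancel₀ _ hd0.ne']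
        have e2 : ∀ y : ℝ≥0∞, (y ^ (1 / (d:ℝ))) ^ d = y := by
          intro y
          rw [← ENNReal.rpow_natCast, ← ENNReal.rpow_mul, one_div_mul_cancel hd0.ne', ENNReal.rpow_one]
        simp only [mul_pow, e1, e2]
        ring
  have hopen : ∀ V, IsOpen V → V ⊆ U → μ (u '' V) ≤ ν V := fun V hV hVU =>
    covering μ ν hV fun N k hk => hcell N k (hk.trans hVU)
  have hfin : IsFiniteMeasure (ν.restrict U) := by
    refine ⟨?_⟩
    rw [Measure.restrict_apply_univ, hνap _ hU.measurableSet]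
    refine ENNReal.mul_lt_top himC.lt_top (ENNReal.add_lt_top.2 ⟨?_, ?_⟩)
    · exact ENNReal.mul_lt_top (by finiteness) hUf.lt_top
    · refine ENNReal.mul_lt_top hC't.lt_top (lt_of_le_of_lt ?_ hhU.lt_top)
      exact lintegral_mono_set inter_subset_left
  have hνE : (ν.restrict U) E = imC d c0 * (t ^ d * volume E) := by
    rw [Measure.restrict_eq_self _ hEU, hνap _ hE]
    have : E ∩ T = ∅ := by
      ext z; simp only [hT, mem_inter_iff, mem_ofPred_eq, mem_empty_iff_false, iff_false, not_and, not_lt]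
      exact hEg z
    simp [this]
  rw [← hνE, Set.measure_eq_iInf_isOpen E (ν.restrict U)]
  refine le_iInf₂ fun V hEV => le_iInf fun hV => ?_
  rw [Measure.restrict_apply hV.measurableSet]
  exact (measure_mono (image_mono (subset_inter hEV hEU))).trans (hopen _ (hV.inter hU) inter_subset_right)

lemma image_bound {d : ℕ} (hd : 2 ≤ d) {Z : Type*} [MeasurableSpace Z] [PseudoEMetricSpace Z]
    (μ : Measure Z) (hμ : ∀ S, μ S ≤ ediam S ^ d) {c0 : ℝ≥0}
    {u : (Fin d → ℝ) → Z} {U : Set (Fin d → ℝ)} (hU : IsOpen U) (hUf : volume U ≠ ⊤)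
    {g h : (Fin d → ℝ) → ℝ≥0∞} (hg : Measurable g) (hgt : ∀ z, g z ≠ ⊤) (hh : Measurable h)
    (hhU : ∫⁻ y in U, h y ≠ ⊤)
    {b : ℝ≥0 → ℝ≥0∞} (hb0 : ∀ t, 0 < t → b t ≠ 0) (hbt : ∀ t, b t ≠ ⊤)
    (hbh : ∀ (t : ℝ≥0) z, 0 < t → (t:ℝ≥0∞) < g z → b t ≤ h z)
    (hS : ∀ t : ℝ≥0, 0 < t → ∑' k : ℕ, (((t:ℝ≥0∞) * 2 ^ k) ^ (d:ℝ) / b (t * 2 ^ k)) ^ (1 / ((d:ℝ) - 1)) ≠ ⊤)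
    (H : ∀ Q, MeasurableSet Q → Convex ℝ Q → Q ⊆ U → ∀ x ∈ Q, ∀ ℓ : ℝ, (∀ y ∈ Q, ‖y - x‖ ≤ ℓ) →
      ∫⁻ y in Q, edist (u y) (u x) ≤ ENNReal.ofReal ℓ * (c0 * segP Q x 0 g))
    (hum : ∀ x ∈ U, ∀ Q ⊆ U, MeasurableSet Q → AEMeasurable (fun y => edist (u y) (u x)) (volume.restrict Q))
    {E : Set (Fin d → ℝ)} (hE : MeasurableSet E) (hEU : E ⊆ U) :
    μ (u '' E) ≤ imC d c0 * 2 ^ d * ∫⁻ y in E, g y ^ d := by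
  have himC : imC d c0 ≠ ⊤ := by unfold imC; finiteness
  have key := fun (t : ℝ≥0) (ht : 0 < t) (E : Set (Fin d → ℝ)) =>
    image_bound_level hd μ hμ hU hUf hg hgt hh hhU hb0 hbt hbh hS H hum ht (E := E)
  set E0 := E ∩ {z | g z = 0} with hE0
  set A : ℤ → Set (Fin d → ℝ) := fun j => E ∩ {z | (2:ℝ≥0∞) ^ j < g z ∧ g z ≤ 2 ^ (j+1)} with hA
  have hE0m : MeasurableSet E0 := hE.inter (measurableSet_eq_fun hg measurable_const)
  have hAm : ∀ j, MeasurableSet (A j) := fun j => hE.inter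
    ((measurableSet_lt measurable_const hg).inter (measurableSet_le hg measurable_const))
  have hcov : E ⊆ E0 ∪ ⋃ j, A j := by
    intro z hz
    by_cases h0 : g z = 0
    · exact Or.inl ⟨hz, h0⟩
    · obtain ⟨j, hj⟩ := ENNReal.exists_mem_Ioc_zpow h0 (hgt z) (y := 2) (by norm_num) (by norm_num)
      exact Or.inr (mem_iUnion.2 ⟨j, hz, hj⟩)
  have h0 : μ (u '' E0) = 0 := by
    have hlim : Tendsto (fun k : ℕ => imC d c0 * ((((1/2:ℝ≥0) ^ k : ℝ≥0) : ℝ≥0∞) ^ d * volume E0)) atTop (𝓝 0) := by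
      have hvf : volume E0 ≠ ⊤ := ne_top_of_le_ne_top hUf (measure_mono (inter_subset_left.trans hEU))
      have h1 : Tendsto (fun k : ℕ => (((1/2:ℝ≥0) ^ k : ℝ≥0) : ℝ≥0∞) ^ d) atTop (𝓝 0) := by
        have h2 : Tendsto (fun k : ℕ => ((1/2:ℝ≥0) ^ k) ^ d) atTop (𝓝 0) := by
          have := (NNReal.tendsto_pow_atTop_nhds_zero_of_lt_one (r := 1/2) (by
            rw [div_lt_one] <;> norm_num)).pow d
          simpa [zero_pow (show d ≠ 0 by omega)] using this
        have h3 := ENNReal.tendsto_coe.2 h2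
        simpa only [ENNReal.coe_pow, ENNReal.coe_zero] using h3
      have := ENNReal.Tendsto.const_mul (a := imC d c0) (ENNReal.Tendsto.mul_const h1 (b := volume E0) (Or.inr hvf)) (Or.inr himC)
      simpa using this
    refine le_antisymm (ge_of_tendsto' hlim fun k => ?_) zero_le
    exact key _ (by positivity) E0 hE0m (inter_subset_left.trans hEU) (fun z hz => by
      rw [hz.2]; exact zero_le)
  have hj : ∀ j, μ (u '' A j) ≤ imC d c0 * 2 ^ d * ∫⁻ y in A j, g y ^ d := by
    intro j
    have h1 := key ((2:ℝ≥0) ^ (j+1)) (by positivity) (A j) (hAm j) (inter_subset_left.trans hEU)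
      (fun z hz => by
        refine hz.2.2.trans_eq ?_
        rw [ENNReal.coe_zpow (by norm_num)]; simp)
    refine h1.trans ?_
    rw [mul_assoc]
    refine mul_le_mul_right ?_ _
    rw [← lintegral_const_mul' _ _ (by finiteness), ← setLIntegral_const]
    refine setLIntegral_mono' (hAm j) fun z hz => ?_
    rw [← mul_pow]
    gcongr
    rw [ENNReal.coe_zpow (by norm_num), ENNReal.zpow_add (by norm_num) (by norm_num)]
    simp only [ENNReal.coe_ofNat, zpow_one]
    rw [mul_comm]
    gcongr
    exact hz.2.1.le
  calc μ (u '' E) ≤ μ (u '' E0 ∪ ⋃ j, u '' A j) := by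
        rw [← image_iUnion, ← image_union]; exact measure_mono (image_mono hcov)
    _ ≤ μ (u '' E0) + ∑' j, μ (u '' A j) :=
        (measure_union_le _ _).trans (add_le_add le_rfl (measure_iUnion_le _))
    _ ≤ ∑' j, imC d c0 * 2 ^ d * ∫⁻ y in A j, g y ^ d := by
        rw [h0, zero_add]; exact ENNReal.tsum_le_tsum hj
    _ = imC d c0 * 2 ^ d * ∫⁻ y in ⋃ j, A j, g y ^ d := by
        rw [ENNReal.tsum_mul_left, lintegral_iUnion hAm]
        have hdis : ∀ i j, i < j → Disjoint (A i) (A j) := by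
          intro i j hij
          rw [Set.disjoint_left]
          rintro z ⟨_, hz⟩ ⟨_, hz'⟩
          have h5 : (2:ℝ≥0∞) ^ (i+1) ≤ 2 ^ j := ENNReal.zpow_le_of_le (by norm_num) (by omega)
          exact absurd (hz.2.trans h5) (not_le.2 hz'.1)
        intro i j hij
        rcases lt_or_gt_of_ne hij with h | h
        · exact hdis i j h
        · exact (hdis j i h).symm
    _ ≤ _ := by
        gcongr
        exact iUnion_subset fun j => inter_subset_left

open MeasureTheory Metric Set Filter
open scoped ENNReal NNReal Topology RealInnerProductSpace Classical

noncomputable def mol {d : ℕ} {V : Type*} [NormedAddCommGroup V] [NormedSpace ℝ V]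
    (φ : ContDiffBump (0 : Fin d → ℝ)) (D : (Fin d → ℝ) → V) : (Fin d → ℝ) → V :=
  convolution (φ.normed volume) D (ContinuousLinearMap.lsmul ℝ ℝ) volume

lemma mol_L1_le {d : ℕ} {V : Type*} [NormedAddCommGroup V] [NormedSpace ℝ V]
    (φ : ContDiffBump (0 : Fin d → ℝ)) {D : (Fin d → ℝ) → V} (hD : Integrable D) :
    ∫⁻ x, ‖mol φ D x‖ₑ ≤ ∫⁻ x, ‖D x‖ₑ := by
  have hφ1 : ∫⁻ t, ENNReal.ofReal (φ.normed volume t) = 1 := by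
    rw [← ofReal_integral_eq_lintegral_ofReal φ.integrable_normed
      (Eventually.of_forall fun t => φ.nonneg_normed t), φ.integral_normed, ENNReal.ofReal_one]
  calc ∫⁻ x, ‖mol φ D x‖ₑ
      ≤ ∫⁻ x, ∫⁻ t, ENNReal.ofReal (φ.normed volume t) * ‖D (x - t)‖ₑ := by
        refine lintegral_mono fun x => ?_
        rw [mol, convolution_def]
        refine (enorm_integral_le_lintegral_enorm _).trans_eq (lintegral_congr fun t => ?_)
        rw [ContinuousLinearMap.lsmul_apply, enorm_smul, Real.enorm_eq_ofReal (φ.nonneg_normed t)]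
    _ = ∫⁻ t, ∫⁻ x, ENNReal.ofReal (φ.normed volume t) * ‖D (x - t)‖ₑ := by
        apply lintegral_lintegral_swap
        refine AEMeasurable.mul (f := fun q : (Fin d → ℝ) × (Fin d → ℝ) => ENNReal.ofReal (φ.normed volume q.2))
          (g := fun q => ‖D (q.1 - q.2)‖ₑ) ?_ ?_
        · exact (ENNReal.measurable_ofReal.comp
            (φ.continuous_normed.measurable.comp measurable_snd)).aemeasurable
        · have := hD.aestronglyMeasurable.comp_quasiMeasurePreserving
            (quasiMeasurePreserving_sub (volume : Measure (Fin d → ℝ)) volume)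
          exact this.enorm
    _ = ∫⁻ t, ENNReal.ofReal (φ.normed volume t) * ∫⁻ x, ‖D x‖ₑ := by
        refine lintegral_congr fun t => ?_
        rw [lintegral_const_mul' _ _ ENNReal.ofReal_ne_top, lintegral_sub_right_eq_self (fun x => ‖D x‖ₑ)]
    _ = _ := by
        rw [lintegral_mul_const', hφ1, one_mul]
        exact hD.2.ne

lemma mol_sub {d : ℕ} {V : Type*} [NormedAddCommGroup V] [NormedSpace ℝ V]
    (φ : ContDiffBump (0 : Fin d → ℝ)) {D D' : (Fin d → ℝ) → V} (hD : Integrable D)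
    (hD' : Integrable D') (x : Fin d → ℝ) : mol φ (fun y => D y - D' y) x = mol φ D x - mol φ D' x := by
  have hex : ∀ {D : (Fin d → ℝ) → V}, Integrable D →
      Integrable fun t => φ.normed volume t • D (x - t) := by
    intro D hD
    have := (φ.hasCompactSupport_normed (μ := volume)).convolutionExists_left
      (ContinuousLinearMap.lsmul ℝ ℝ (E := V)) φ.continuous_normed hD.locallyIntegrable x
    exact this
  simp only [mol, convolution_def, ContinuousLinearMap.lsmul_apply, smul_sub]
  exact integral_sub (hex hD) (hex hD')

lemma mol_tendsto_L1 {d : ℕ} {V : Type*} [NormedAddCommGroup V] [NormedSpace ℝ V] [CompleteSpace V]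
    {φ : ℕ → ContDiffBump (0 : Fin d → ℝ)} (hφ : Tendsto (fun i => (φ i).rOut) atTop (𝓝 0))
    {D : (Fin d → ℝ) → V} (hD : Integrable D) {K : Set (Fin d → ℝ)} (hK : IsCompact K) :
    Tendsto (fun k => ∫⁻ x in K, ‖mol (φ k) D x - D x‖ₑ) atTop (𝓝 0) := by
  rw [ENNReal.tendsto_nhds_zero]
  intro ε hε
  have hε3 : ε / 3 ≠ 0 := (ENNReal.div_pos hε.ne' (by norm_num)).ne'
  obtain ⟨g, hgs, hgD, hgc, hgi⟩ := hD.exists_hasCompactSupport_lintegral_sub_le hε3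
  obtain ⟨η, hη, hηK⟩ : ∃ η : ℝ≥0, 0 < η ∧ (η:ℝ≥0∞) * volume K < ε / 3 := by
    obtain ⟨η, h1, h2⟩ := ENNReal.exists_nnreal_pos_mul_lt (hK.measure_lt_top (μ := volume)).ne hε3
    exact ⟨η, h1, h2⟩
  obtain ⟨δ, hδ, hunif⟩ := Metric.uniformContinuous_iff.1
    (hgc.uniformContinuous_of_tendsto_cocompact (hgs.is_zero_at_infty)) η (by positivity)
  filter_upwards [hφ.eventually (gt_mem_nhds hδ)] with k hk
  have hpt : ∀ x, ‖mol (φ k) D x - D x‖ₑ ≤ ‖mol (φ k) (fun y => D y - g y) x‖ₑ + (η + ‖D x - g x‖ₑ) := by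
    intro x
    have h1 : ‖mol (φ k) g x - g x‖ₑ ≤ η := by
      have := (φ k).dist_normed_convolution_le (μ := volume) (g := g) (x₀ := x) (ε := η)
        hgc.aestronglyMeasurable (fun y hy => (hunif (lt_trans hy hk)).le)
      rw [dist_eq_norm] at this
      rw [← ofReal_norm, ← ENNReal.ofReal_coe_nnreal]
      exact ENNReal.ofReal_le_ofReal this
    have h2 : mol (φ k) D x - D x = mol (φ k) (fun y => D y - g y) x +
        ((mol (φ k) g x - g x) + (- (D x - g x))) := by
      rw [mol_sub _ hD hgi]; abel
    rw [h2]
    refine (enorm_add_le _ _).trans ?_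
    gcongr
    refine (enorm_add_le _ _).trans ?_
    rw [enorm_neg]
    gcongr
  calc ∫⁻ x in K, ‖mol (φ k) D x - D x‖ₑ
      ≤ ∫⁻ x in K, (‖mol (φ k) (fun y => D y - g y) x‖ₑ + (η + ‖D x - g x‖ₑ)) := lintegral_mono hpt
    _ = (∫⁻ x in K, ‖mol (φ k) (fun y => D y - g y) x‖ₑ) + (η * volume K + ∫⁻ x in K, ‖D x - g x‖ₑ) := by
        rw [lintegral_add_right', lintegral_add_left measurable_const, setLIntegral_const]
        exact (measurable_const.aemeasurable.add ((hD.sub hgi).aestronglyMeasurable.enorm.restrict))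
    _ ≤ ε / 3 + (ε / 3 + ε / 3) := by
        gcongr
        · refine (setLIntegral_le_lintegral _ _).trans ((mol_L1_le _ (hD.sub hgi)).trans hgD)
        · exact (setLIntegral_le_lintegral _ _).trans hgD
    _ = ε := by rw [← add_assoc]; exact ENNReal.add_thirds ε

lemma mollify {d : ℕ} {W : Type*} [NormedAddCommGroup W] [NormedSpace ℝ W] [FiniteDimensional ℝ W]
    {Ω : Set (Fin d → ℝ)} (hΩ : IsOpen Ω) {F : (Fin d → ℝ) → W} (hF : ContinuousOn F Ω)
    {G : (Fin d → ℝ) → (Fin d → ℝ) →L[ℝ] W} (hG : LocallyIntegrableOn G Ω)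
    (hw : ∀ ψ : (Fin d → ℝ) → ℝ, ContDiff ℝ (⊤ : ℕ∞) ψ → HasCompactSupport ψ → tsupport ψ ⊆ Ω →
      ∀ v, ∫ x, ψ x • G x v = - ∫ x, fderiv ℝ ψ x v • F x)
    {K : Set (Fin d → ℝ)} (hK : IsCompact K) (hKΩ : K ⊆ Ω) :
    ∃ U : ℕ → (Fin d → ℝ) → W, (∀ k, ContDiff ℝ 1 (U k)) ∧
      (∀ y ∈ K, Tendsto (fun k => U k y) atTop (𝓝 (F y))) ∧
      Tendsto (fun k => ∫⁻ y in K, ‖fderiv ℝ (U k) y - G y‖ₑ) atTop (𝓝 0) := by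
  have : CompleteSpace W := FiniteDimensional.complete ℝ W
  obtain ⟨δ, hδ, hδΩ⟩ := hK.exists_cthickening_subset_open hΩ hKΩ
  set K' := cthickening δ K with hK'
  have hK'c : IsCompact K' := hK.cthickening
  have hball : ∀ x ∈ K, closedBall x δ ⊆ K' := fun x hx => closedBall_subset_cthickening hx δ
  set F' := K'.indicator F with hF'
  set G' := K'.indicator G with hG'
  have hF'i : Integrable F' :=
    (integrable_indicator_iff hK'c.measurableSet).2 ((hF.mono hδΩ).integrableOn_compact hK'c)
  have hG'i : Integrable G' := by
    have h0 : IntegrableOn G K' := hG.integrableOn_compact_subset hδΩ hK'c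
    exact (integrable_indicator_iff (μ := volume) (f := G) hK'c.measurableSet).2 h0
  set φ : ℕ → ContDiffBump (0 : Fin d → ℝ) := fun k =>
    ⟨δ / 2 / (k + 2), δ / 2 / (k + 1), by positivity, by gcongr; linarith⟩ with hφdef
  have hφ : Tendsto (fun i => (φ i).rOut) atTop (𝓝 0) := by
    have := (tendsto_one_div_add_atTop_nhds_zero_nat (𝕜 := ℝ)).const_mul (δ / 2)
    simpa [hφdef, div_eq_mul_inv] using this
  have hφδ : ∀ k, (φ k).rOut < δ := by
    intro k
    simp only [hφdef]
    rw [div_lt_iff₀ (by positivity)]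
    nlinarith [(Nat.cast_nonneg k : (0:ℝ) ≤ k)]
  have hcd : ∀ k, ContDiff ℝ 1 (mol (φ k) F') := by
    intro k
    have := (φ k).hasCompactSupport_normed (μ := volume) |>.contDiff_convolution_left (n := 1)
      (ContinuousLinearMap.lsmul ℝ ℝ (E := W)) (φ k).contDiff_normed hF'i.locallyIntegrable
    exact_mod_cast this
  refine ⟨fun k => mol (φ k) F', hcd, ?_, ?_⟩
  · intro y hy
    have hFy : F' y = F y := indicator_of_mem (hball y hy (mem_closedBall_self hδ.le)) _
    have hnb : K' ∈ 𝓝 y := mem_of_superset (closedBall_mem_nhds y hδ) (hball y hy)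
    refine ContDiffBump.convolution_tendsto_right (μ := volume) (k := fun _ => y) (g := fun _ => F') hφ
      (Eventually.of_forall fun _ => hF'i.aestronglyMeasurable) ?_ tendsto_const_nhds
    have h1 : ContinuousAt F' y := by
      have : ContinuousAt F y := hF.continuousAt (hΩ.mem_nhds (hKΩ hy))
      refine this.congr ?_
      filter_upwards [hnb] with z hz
      rw [hF', indicator_of_mem hz]
    rw [← hFy]
    exact h1.tendsto.comp tendsto_snd
  · have hd1 : ∀ k, ∀ x ∈ K, fderiv ℝ (mol (φ k) F') x = mol (φ k) G' x := by
      intro k x hx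
      have h1 := (φ k).hasCompactSupport_normed (μ := volume) |>.hasFDerivAt_convolution_left
        (ContinuousLinearMap.lsmul ℝ ℝ (E := W)) ((φ k).contDiff_normed (n := 1)) hF'i.locallyIntegrable x
      have h2 : fderiv ℝ (mol (φ k) F') x = _ := h1.fderiv
      rw [h2]
      ext1 v
      have hsup : ∀ y, y ∉ closedBall x (φ k).rOut → (φ k).normed volume (x - y) = 0 := by
        intro y hy
        have : x - y ∉ Function.support ((φ k).normed volume) := by
          rw [(φ k).support_normed_eq]
          intro h
          apply hy
          rw [mem_ball, dist_zero_right] at h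
          rw [mem_closedBall, dist_comm, dist_eq_norm]
          exact h.le
        simpa using this
      set ψ : (Fin d → ℝ) → ℝ := fun y => (φ k).normed volume (x - y) with hψ
      have hψc : ContDiff ℝ (⊤ : ℕ∞) ψ := ((φ k).contDiff_normed).comp (contDiff_const.sub contDiff_id)
      have hψs : tsupport ψ ⊆ closedBall x (φ k).rOut := by
        refine closure_minimal (fun y hy => ?_) isClosed_closedBall
        by_contra h
        exact hy (hsup y h)
      have hψK : tsupport ψ ⊆ K' := hψs.trans ((closedBall_subset_closedBall (hφδ k).le).trans (hball x hx))
      have hψcs : HasCompactSupport ψ := hK'c.of_isClosed_subset (isClosed_tsupport _) hψK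
      have hfd : ∀ y, fderiv ℝ ψ y v = - fderiv ℝ ((φ k).normed volume) (x - y) v := by
        intro y
        have h3 : HasFDerivAt ((φ k).normed volume) (fderiv ℝ ((φ k).normed volume) (x - y)) (x - y) :=
          (((φ k).contDiff_normed (n := 1)).differentiable (by norm_num) _).hasFDerivAt
        have h4 : HasFDerivAt (fun y : Fin d → ℝ => x - y) (-(ContinuousLinearMap.id ℝ (Fin d → ℝ))) y :=
          (hasFDerivAt_id y).const_sub x
        have h5 := (h3.comp y h4).fderiv
        have h6 : fderiv ℝ ψ y = _ := h5
        rw [h6]; simp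
      have key := hw ψ hψc hψcs (hψK.trans hδΩ) v
      have hpi : Integrable fun t => (φ k).normed volume (x - t) • G' t := by
        have := (φ k).hasCompactSupport_normed (μ := volume) |>.convolutionExists_left
          (ContinuousLinearMap.lsmul ℝ ℝ (E := (Fin d → ℝ) →L[ℝ] W)) (φ k).continuous_normed
          hG'i.locallyIntegrable x
        exact ((convolutionExistsAt_iff_integrable_swap).1 this)
      have lhs : (mol (φ k) G' x) v = ∫ y, ψ y • G y v := by
        rw [mol, convolution_eq_swap]
        simp only [ContinuousLinearMap.lsmul_apply]
        rw [ContinuousLinearMap.integral_apply hpi]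
        refine integral_congr_ae (Eventually.of_forall fun y => ?_)
        simp only [_root_.smul_apply]
        by_cases hy : y ∈ K'
        · simp only [hG', indicator_of_mem hy, hψ]
        · have : ψ y = 0 := image_eq_zero_of_notMem_tsupport fun h => hy (hψK h)
          rw [this, zero_smul]
          simp only [hψ] at this
          rw [this, zero_smul]
      rw [lhs, key, convolution_eq_swap, ContinuousLinearMap.integral_apply]
      · rw [← integral_neg]
        refine integral_congr_ae (Eventually.of_forall fun y => ?_)
        simp only [ContinuousLinearMap.precompL_apply, ContinuousLinearMap.lsmul_apply]
        rw [hfd, neg_smul, neg_neg]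
        by_cases hy : y ∈ K'
        · simp only [hF', indicator_of_mem hy]
        · have h7 : fderiv ℝ ψ y = 0 := by
            have : y ∉ tsupport (fderiv ℝ ψ) := fun h => hy (hψK (tsupport_fderiv_subset ℝ h))
            exact image_eq_zero_of_notMem_tsupport this
          have h8 := hfd y
          rw [h7] at h8
          have h9 : fderiv ℝ ((φ k).normed volume) (x - y) v = 0 := by simpa using h8.symm
          rw [h9, zero_smul, zero_smul]
      · have := ((φ k).hasCompactSupport_normed (μ := volume)).fderiv ℝ |>.convolutionExists_left
          ((ContinuousLinearMap.lsmul ℝ ℝ (E := W)).precompL (Fin d → ℝ))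
          (((φ k).contDiff_normed (n := 1)).continuous_fderiv (by norm_num)) hF'i.locallyIntegrable x
        exact ((convolutionExistsAt_iff_integrable_swap).1 this)
    refine (mol_tendsto_L1 hφ hG'i hK).congr fun k => ?_
    refine setLIntegral_congr_fun hK.measurableSet fun y hy => ?_
    simp only
    rw [hd1 k y hy, hG', indicator_of_mem (hball y hy (mem_closedBall_self hδ.le))]

open MeasureTheory Metric Set Filter
open scoped ENNReal NNReal Topology RealInnerProductSpace Classical

/-- Fubini in the `i`-th coordinate -/
lemma fubini_ins {m : ℕ} (i : Fin (m+1)) {f : (Fin (m+1) → ℝ) → ℝ≥0∞} (hf : Measurable f) :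
    ∫⁻ x, f x = ∫⁻ s : ℝ, ∫⁻ y : Fin m → ℝ, f (i.insertNth s y) := by
  have h := (volume_preserving_piFinSuccAbove (fun _ : Fin (m+1) => ℝ) i).symm
  rw [← h.lintegral_comp hf]
  have : Measurable fun a : ℝ × (Fin m → ℝ) =>
      f ((MeasurableEquiv.piFinSuccAbove (fun _ : Fin (m+1) => ℝ) i).symm a) :=
    hf.comp (MeasurableEquiv.measurable _)
  rw [Measure.volume_eq_prod, lintegral_prod _ this.aemeasurable]
  rfl

lemma ins_mem_cb {m : ℕ} (i : Fin (m+1)) (z : Fin (m+1) → ℝ) {r : ℝ} (hr : 0 ≤ r) (s : ℝ)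
    (y : Fin m → ℝ) : i.insertNth s y ∈ closedBall z r ↔
      s ∈ closedBall (z i) r ∧ y ∈ closedBall (i.removeNth z) r := by
  rw [mem_closedBall, mem_closedBall, mem_closedBall, dist_pi_le_iff hr, dist_pi_le_iff hr,
    Fin.forall_iff_succAbove i]
  simp [Fin.removeNth]

lemma meas_ins {m : ℕ} (i : Fin (m+1)) :
    Measurable fun q : ℝ × (Fin m → ℝ) => (i.insertNth q.1 q.2 : Fin (m+1) → ℝ) :=
  (MeasurableEquiv.piFinSuccAbove (fun _ : Fin (m+1) => ℝ) i).symm.measurable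

lemma meas_ins1 {m : ℕ} (i : Fin (m+1)) (s : ℝ) :
    Measurable fun y : Fin m → ℝ => (i.insertNth s y : Fin (m+1) → ℝ) :=
  (meas_ins i).comp (measurable_const.prodMk measurable_id)

lemma fubini_cb {m : ℕ} (i : Fin (m+1)) {f : (Fin (m+1) → ℝ) → ℝ≥0∞} (hf : Measurable f)
    (z : Fin (m+1) → ℝ) {r : ℝ} (hr : 0 ≤ r) :
    ∫⁻ x in closedBall z r, f x =
      ∫⁻ s in closedBall (z i) r, ∫⁻ y in closedBall (i.removeNth z) r, f (i.insertNth s y) := by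
  rw [← lintegral_indicator measurableSet_closedBall, fubini_ins i (hf.indicator measurableSet_closedBall),
    ← lintegral_indicator measurableSet_closedBall]
  refine lintegral_congr fun s => ?_
  by_cases hs : s ∈ closedBall (z i) r
  · rw [indicator_of_mem hs, ← lintegral_indicator measurableSet_closedBall]
    refine lintegral_congr fun y => ?_
    by_cases hy : y ∈ closedBall (i.removeNth z) r
    · rw [indicator_of_mem hy, indicator_of_mem ((ins_mem_cb i z hr s y).2 ⟨hs, hy⟩)]
    · rw [indicator_of_notMem hy, indicator_of_notMem fun h => hy ((ins_mem_cb i z hr s y).1 h).2]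
  · rw [indicator_of_notMem hs]
    simp_rw [indicator_of_notMem (fun h => hs ((ins_mem_cb i z hr s _).1 h).1)]
    simp

/-- linear part of `insertNth` -/
noncomputable def insL {m : ℕ} (i : Fin (m+1)) : (Fin m → ℝ) →L[ℝ] (Fin (m+1) → ℝ) :=
  ContinuousLinearMap.pi (i.insertNth (α := fun _ => (Fin m → ℝ) →L[ℝ] ℝ) 0
    (fun j => ContinuousLinearMap.proj j))

lemma insL_apply {m : ℕ} (i : Fin (m+1)) (y : Fin m → ℝ) : insL i y = i.insertNth 0 y := by
  ext j
  refine Fin.succAboveCases i ?_ (fun k => ?_) j <;> simp [insL]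

lemma ins_eq {m : ℕ} (i : Fin (m+1)) (s : ℝ) (y : Fin m → ℝ) :
    (i.insertNth s y : Fin (m+1) → ℝ) = i.insertNth s 0 + insL i y := by
  ext j
  refine Fin.succAboveCases i ?_ (fun k => ?_) j <;> simp [insL_apply]

lemma insL_norm {m : ℕ} (i : Fin (m+1)) : ‖insL i‖ ≤ 1 := by
  refine ContinuousLinearMap.opNorm_le_bound _ zero_le_one fun y => ?_
  rw [one_mul, pi_norm_le_iff_of_nonneg (norm_nonneg _)]
  intro j
  rw [insL_apply]
  refine Fin.succAboveCases i ?_ (fun k => ?_) j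
  · simp
  · simpa using norm_le_pi_norm y k

lemma cont_ins {m : ℕ} (i : Fin (m+1)) (s : ℝ) :
    Continuous fun y : Fin m → ℝ => (i.insertNth s y : Fin (m+1) → ℝ) := by
  have hfe : (fun y : Fin m → ℝ => (i.insertNth s y : Fin (m+1) → ℝ)) = fun y => i.insertNth s 0 + insL i y :=
    funext (ins_eq i s)
  rw [hfe]
  fun_prop

lemma contDiff_ins {m : ℕ} (i : Fin (m+1)) (s : ℝ) :
    ContDiff ℝ 1 fun y : Fin m → ℝ => (i.insertNth s y : Fin (m+1) → ℝ) := by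
  have hfe : (fun y : Fin m → ℝ => (i.insertNth s y : Fin (m+1) → ℝ)) = fun y => i.insertNth s 0 + insL i y :=
    funext (ins_eq i s)
  rw [hfe]
  fun_prop

lemma hasFDerivAt_ins {m : ℕ} (i : Fin (m+1)) (s : ℝ) (y : Fin m → ℝ) :
    HasFDerivAt (fun y : Fin m → ℝ => (i.insertNth s y : Fin (m+1) → ℝ)) (insL i) y := by
  have hfe : (fun y : Fin m → ℝ => (i.insertNth s y : Fin (m+1) → ℝ)) = fun y => i.insertNth s 0 + insL i y :=
    funext (ins_eq i s)
  rw [hfe]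
  exact (insL i).hasFDerivAt.const_add _

/-- standing assumptions -/
structure Setup (m : ℕ) (c0 : ℝ≥0) (Ω : Set (Fin (m+1) → ℝ)) (F : (Fin (m+1) → ℝ) → (Fin (m+1) → ℝ))
    (G : (Fin (m+1) → ℝ) → (Fin (m+1) → ℝ) →L[ℝ] (Fin (m+1) → ℝ))
    (g h : (Fin (m+1) → ℝ) → ℝ≥0∞) (b : ℝ≥0 → ℝ≥0∞) : Prop where
  hm : 2 ≤ m
  hΩ : IsOpen Ω
  hF : ContinuousOn F Ω
  hGm : Measurable G
  hGi : LocallyIntegrableOn G Ω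
  hw : ∀ ψ : (Fin (m+1) → ℝ) → ℝ, ContDiff ℝ (⊤ : ℕ∞) ψ → HasCompactSupport ψ → tsupport ψ ⊆ Ω →
      ∀ v, ∫ x, ψ x • G x v = - ∫ x, fderiv ℝ ψ x v • F x
  hg : Measurable g
  hgt : ∀ x, g x ≠ ⊤
  hGg : ∀ x, ‖G x‖ₑ ≤ c0 * g x
  hh : Measurable h
  hhi : ∀ K ⊆ Ω, IsCompact K → ∫⁻ x in K, h x ≠ ⊤
  hb0 : ∀ t, 0 < t → b t ≠ 0
  hbt : ∀ t, b t ≠ ⊤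
  hbh : ∀ (t : ℝ≥0) x, 0 < t → (t:ℝ≥0∞) < g x → b t ≤ h x
  hS : ∀ t : ℝ≥0, 0 < t → ∑' k : ℕ, (((t:ℝ≥0∞) * 2 ^ k) ^ (m:ℝ) / b (t * 2 ^ k)) ^ (1 / ((m:ℝ) - 1)) ≠ ⊤

lemma ae_subseq {α : Type*} [MeasurableSpace α] {μ : Measure α} {a : ℕ → α → ℝ≥0∞}
    (ha : ∀ k, Measurable (a k)) (h : Tendsto (fun k => ∫⁻ x, a k x ∂μ) atTop (𝓝 0)) :
    ∃ ψ : ℕ → ℕ, StrictMono ψ ∧ ∀ᵐ x ∂μ, Tendsto (fun k => a (ψ k) x) atTop (𝓝 0) := by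
  have hev : ∀ n : ℕ, ∀ᶠ k in atTop, ∫⁻ x, a k x ∂μ ≤ (2⁻¹:ℝ≥0∞) ^ n := fun n =>
    ENNReal.tendsto_nhds_zero.1 h _ (ENNReal.pow_pos (by simp) _)
  obtain ⟨ψ, hψ, hle⟩ := extraction_forall_of_eventually' (P := fun n k => ∫⁻ x, a k x ∂μ ≤ (2⁻¹:ℝ≥0∞) ^ n)
    (fun n => eventually_atTop.1 (hev n))
  refine ⟨ψ, hψ, ?_⟩
  have hs : ∫⁻ x, ∑' k, a (ψ k) x ∂μ ≠ ⊤ := by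
    rw [lintegral_tsum fun k => (ha _).aemeasurable]
    refine ne_top_of_le_ne_top ?_ (ENNReal.tsum_le_tsum hle)
    rw [ENNReal.tsum_geometric]; simp
  filter_upwards [ae_lt_top (Measurable.tsum fun k => ha _) hs] with x hx
  exact ENNReal.tendsto_atTop_zero_of_tsum_ne_top hx.ne

lemma segP_const_mul {d : ℕ} {Q : Set (Fin d → ℝ)} {x : Fin d → ℝ} {η : ℝ}
    {g : (Fin d → ℝ) → ℝ≥0∞} {c : ℝ≥0} :
    segP Q x η (fun z => c * g z) = c * segP Q x η g := by
  unfold segP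
  rw [← lintegral_const_mul' _ _ ENNReal.coe_ne_top]
  refine lintegral_congr fun l => ?_
  rw [lintegral_const_mul' _ _ ENNReal.coe_ne_top]

/-- slice-wise image bound -/
lemma slice_bound {m : ℕ} {c0 : ℝ≥0} {Ω F G g h b} (S : Setup m c0 Ω F G g h b)
    (i : Fin (m+1)) {z : Fin (m+1) → ℝ} {r0 : ℝ} (hr0 : 0 < r0) (hz : closedBall z r0 ⊆ Ω)
    {Z : Type*} [MeasurableSpace Z] [PseudoEMetricSpace Z] (μ : Measure Z)
    (hμ : ∀ S, μ S ≤ ediam S ^ m) {P : (Fin (m+1) → ℝ) → Z} (hP : LipschitzWith 1 P) :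
    ∀ᵐ s ∂(volume.restrict (closedBall (z i) r0)), ∀ E, MeasurableSet E →
      E ⊆ ball (i.removeNth z) r0 →
      μ ((fun y => P (F (i.insertNth s y))) '' E) ≤
        imC m c0 * 2 ^ m * ∫⁻ y in E, g (i.insertNth s y) ^ m := by
  obtain ⟨U, hU, hUlim, hUL⟩ := mollify S.hΩ S.hF S.hGi S.hw (isCompact_closedBall z r0) hz
  set a : ℕ → ℝ → ℝ≥0∞ := fun k s => ∫⁻ y in closedBall (i.removeNth z) r0,
    ‖fderiv ℝ (U k) (i.insertNth s y) - G (i.insertNth s y)‖ₑ with ha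
  have hmeas : ∀ k, Measurable fun x => ‖fderiv ℝ (U k) x - G x‖ₑ := fun k =>
    ((((hU k).continuous_fderiv one_ne_zero).measurable).sub S.hGm).enorm
  have ham : ∀ k, Measurable (a k) := fun k =>
    Measurable.lintegral_prod_right' (f := fun q : ℝ × (Fin m → ℝ) =>
      ‖fderiv ℝ (U k) (i.insertNth q.1 q.2) - G (i.insertNth q.1 q.2)‖ₑ) ((hmeas k).comp (meas_ins i))
  have hat : Tendsto (fun k => ∫⁻ s in closedBall (z i) r0, a k s) atTop (𝓝 0) := by
    refine hUL.congr fun k => ?_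
    rw [fubini_cb i (hmeas k) z hr0.le]
  obtain ⟨ψ, hψ, hae⟩ := ae_subseq ham hat
  have hhf : ∀ᵐ s ∂(volume.restrict (closedBall (z i) r0)),
      ∫⁻ y in closedBall (i.removeNth z) r0, h (i.insertNth s y) < ⊤ := by
    refine ae_lt_top ?_ ?_
    · exact Measurable.lintegral_prod_right' (f := fun q : ℝ × (Fin m → ℝ) => h (i.insertNth q.1 q.2))
        (S.hh.comp (meas_ins i))
    · rw [← fubini_cb i S.hh z hr0.le]
      exact S.hhi _ hz (isCompact_closedBall z r0)
  filter_upwards [hae, hhf, ae_restrict_mem measurableSet_closedBall] with s hs1 hs2 hs3 E hE hEU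
  have hin : ∀ y ∈ closedBall (i.removeNth z) r0, i.insertNth s y ∈ closedBall z r0 := fun y hy =>
    (ins_mem_cb i z hr0.le s y).2 ⟨hs3, hy⟩
  have hcF : ContinuousOn (fun y => F (i.insertNth s y)) (closedBall (i.removeNth z) r0) :=
    S.hF.comp (cont_ins i s).continuousOn fun y hy => hz (hin y hy)
  have hmap : ∀ A : (Fin (m+1) → ℝ) →L[ℝ] (Fin (m+1) → ℝ), ‖A.comp (insL i)‖ₑ ≤ ‖A‖ₑ := by
    intro A
    rw [← ofReal_norm, ← ofReal_norm]
    refine ENNReal.ofReal_le_ofReal ((A.opNorm_comp_le _).trans ?_)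
    exact mul_le_of_le_one_right (norm_nonneg _) (insL_norm i)
  refine image_bound S.hm μ hμ isOpen_ball measure_ball_lt_top.ne (h := fun y => h (i.insertNth s y))
    (S.hg.comp (meas_ins1 i s)) (fun y => S.hgt _) (S.hh.comp (meas_ins1 i s)) ?_ S.hb0 S.hbt
    (fun t y ht => S.hbh t _ ht) S.hS ?_ ?_ hE hEU
  · exact ne_top_of_le_ne_top hs2.ne (lintegral_mono_set ball_subset_closedBall)
  · intro Q hQ hQc hQU x hx ℓ hℓ
    have hQU' := hQU.trans ball_subset_closedBall
    have hfd : ∀ k y, fderiv ℝ (fun y => U k (i.insertNth s y)) y =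
        (fderiv ℝ (U k) (i.insertNth s y)).comp (insL i) := fun k y =>
      ((((hU k).differentiable one_ne_zero) _).hasFDerivAt.comp y (hasFDerivAt_ins i s y)).fderiv
    have := segP_limit (U := fun k y => U (ψ k) (i.insertNth s y)) (u := fun y => F (i.insertNth s y))
      (G := fun y => (G (i.insertNth s y)).comp (insL i)) (fun k => (hU _).comp (contDiff_ins i s))
      ?_ hQ hQc (fun y hy => (hUlim _ (hin y (hQU' hy))).comp hψ.tendsto_atTop) ?_
      (hcF.mono hQU') hx hℓ
    · calc ∫⁻ y in Q, edist (P (F (i.insertNth s y))) (P (F (i.insertNth s x)))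
          ≤ ∫⁻ y in Q, ‖F (i.insertNth s y) - F (i.insertNth s x)‖ₑ := by
            refine lintegral_mono fun y => ?_
            rw [← edist_eq_enorm_sub]
            simpa using hP (F (i.insertNth s y)) (F (i.insertNth s x))
        _ ≤ _ := this
        _ ≤ _ := by
            rw [← segP_const_mul]
            gcongr
            refine segP_mono le_rfl fun y => ?_
            exact (hmap _).trans (S.hGg _)
    · have h1 : Measurable fun A : (Fin (m+1) → ℝ) →L[ℝ] (Fin (m+1) → ℝ) => A.comp (insL i) :=
        (Continuous.clm_comp continuous_id continuous_const).measurable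
      exact h1.comp (S.hGm.comp (meas_ins1 i s))
    · refine tendsto_of_tendsto_of_tendsto_of_le_of_le tendsto_const_nhds hs1 (fun _ => zero_le) fun k => ?_
      simp only
      refine le_trans ?_ (lintegral_mono_set hQU')
      refine lintegral_mono fun y => ?_
      rw [hfd, ← ContinuousLinearMap.sub_comp]
      exact hmap _
  · intro x hx Q hQU hQ
    have h1 : ContinuousOn (fun y => edist (P (F (i.insertNth s y))) (P (F (i.insertNth s x)))) Q := by
      have : ContinuousOn (fun y => P (F (i.insertNth s y))) Q :=
        hP.continuous.comp_continuousOn (hcF.mono (hQU.trans ball_subset_closedBall))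
      exact (continuous_id.edist continuous_const).comp_continuousOn this
    exact h1.aemeasurable hQ

open MeasureTheory Metric Set Filter
open scoped ENNReal NNReal Topology RealInnerProductSpace Classical


lemma vol_cb_smul {d : ℕ} (x : Fin d → ℝ) {r l : ℝ} (hr : 0 ≤ r) (hl : 0 ≤ l) :
    volume (closedBall x (l * r)) = ENNReal.ofReal (l ^ d) * volume (closedBall x r) := by
  rw [Real.volume_pi_closedBall x (mul_nonneg hl hr), Real.volume_pi_closedBall x hr,
    ← ENNReal.ofReal_mul (by positivity)]
  congr 1
  simp only [Fintype.card_fin]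
  rw [← mul_pow]; congr 1; ring

/-- Poincaré type estimate at a point -/
lemma poincare_pt {d : ℕ} {Ω : Set (Fin d → ℝ)} (hΩ : IsOpen Ω) {F : (Fin d → ℝ) → (Fin d → ℝ)}
    (hF : ContinuousOn F Ω)
    {G : (Fin d → ℝ) → (Fin d → ℝ) →L[ℝ] (Fin d → ℝ)} (hGm : Measurable G) (hG : LocallyIntegrableOn G Ω)
    (hw : ∀ ψ : (Fin d → ℝ) → ℝ, ContDiff ℝ (⊤ : ℕ∞) ψ → HasCompactSupport ψ → tsupport ψ ⊆ Ω →
      ∀ v, ∫ x, ψ x • G x v = - ∫ x, fderiv ℝ ψ x v • F x)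
    {x : Fin d → ℝ} {r : ℝ} (hr : 0 < r) (hx : closedBall x r ⊆ Ω) {δ : ℝ≥0∞}
    (hδ : ∀ ρ, 0 < ρ → ρ ≤ r → ∫⁻ y in closedBall x ρ, ‖G y - G x‖ₑ ≤ δ * volume (closedBall x ρ)) :
    ∫⁻ y in closedBall x r, ‖F y - F x - G x (y - x)‖ₑ ≤
      ENNReal.ofReal r * (δ * volume (closedBall x r)) := by
  obtain ⟨U, hU, hUlim, hUL⟩ := mollify hΩ hF hG hw (isCompact_closedBall x r) hx
  have hmeas : Measurable fun y => ‖G y - G x‖ₑ := (hGm.sub_const _).enorm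
  have hfd : ∀ k y, fderiv ℝ (fun y => U k y - G x y) y = fderiv ℝ (U k) y - G x := fun k y =>
    (((((hU k).differentiable one_ne_zero) y).hasFDerivAt).sub (G x).hasFDerivAt).fderiv
  have := segP_limit (U := fun k y => U k y - G x y) (u := fun y => F y - G x y)
    (G := fun y => G y - G x) (fun k => (hU k).sub (G x).contDiff) (hGm.sub_const _)
    (Q := closedBall x r) measurableSet_closedBall (convex_closedBall x r)
    (fun y hy => (hUlim y hy).sub_const _) (by simpa only [hfd, sub_sub_sub_cancel_right] using hUL)
    ((hF.mono hx).sub (G x).continuous.continuousOn) (x := x) (mem_closedBall_self hr.le) (ℓ := r)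
    (fun y hy => by simpa [mem_closedBall, dist_eq_norm] using hy)
  calc ∫⁻ y in closedBall x r, ‖F y - F x - G x (y - x)‖ₑ
      = ∫⁻ y in closedBall x r, ‖(F y - G x y) - (F x - G x x)‖ₑ := by
        refine lintegral_congr fun y => ?_
        congr 1; rw [map_sub]; abel
    _ ≤ _ := this
    _ ≤ _ := by
        gcongr
        unfold segP
        calc ∫⁻ l in Ioc (0:ℝ) 1, ∫⁻ y in closedBall x r, ‖G (x + l • (y - x)) - G x‖ₑ
            ≤ ∫⁻ l in Ioc (0:ℝ) 1, δ * volume (closedBall x r) := by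
              refine setLIntegral_mono' measurableSet_Ioc fun l hl => ?_
              have hl0 : 0 < l := hl.1
              refine (lintegral_homothety_le x hl0 (S := closedBall x (l * r)) measurableSet_closedBall
                measurableSet_closedBall ?_ hmeas).trans ?_
              · intro y hy
                rw [mem_closedBall, dist_eq_norm] at hy ⊢
                rw [add_sub_cancel_left, norm_smul, Real.norm_of_nonneg hl0.le]
                gcongr
              · refine (mul_le_mul_right (hδ (l * r) (by positivity)
                  (mul_le_of_le_one_left hr.le hl.2)) _).trans ?_
                rw [vol_cb_smul x hr.le hl0.le, ENNReal.ofReal_inv_of_pos (by positivity)]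
                rw [mul_left_comm δ, ← mul_assoc, ENNReal.inv_mul_cancel, one_mul]
                · simp; positivity
                · simp
          _ = δ * volume (closedBall x r) := by simp

/-- symmetrization estimate -/
lemma symm_est {d : ℕ} (x : Fin d → ℝ) (ρ : ℝ) (v : Fin d → ℝ)
    (B : (Fin d → ℝ) →L[ℝ] (Fin d → ℝ)) :
    volume (closedBall x ρ) * ‖v‖ₑ ≤ ∫⁻ y in closedBall x ρ, ‖v + B (y - x)‖ₑ := by
  have hmp : MeasurePreserving (fun y : Fin d → ℝ => (x + x) - y) volume volume :=
    Measure.measurePreserving_sub_left volume _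
  have hme : MeasurableEmbedding (fun y : Fin d → ℝ => (x + x) - y) :=
    (MeasurableEquiv.subLeft (x + x)).measurableEmbedding
  have hpre : (fun y : Fin d → ℝ => (x + x) - y) ⁻¹' closedBall x ρ = closedBall x ρ := by
    ext y
    simp only [mem_preimage, mem_closedBall, dist_eq_norm]
    rw [show x + x - y - x = -(y - x) by abel, norm_neg]
  have h1 : ∫⁻ y in closedBall x ρ, ‖v - B (y - x)‖ₑ = ∫⁻ y in closedBall x ρ, ‖v + B (y - x)‖ₑ := by
    rw [← hmp.setLIntegral_comp_preimage_emb hme (fun y => ‖v + B (y - x)‖ₑ) (closedBall x ρ), hpre]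
    refine lintegral_congr fun y => ?_
    rw [show x + x - y - x = -(y - x) by abel, map_neg, sub_eq_add_neg]
  have hm : Measurable fun y => ‖v + B (y - x)‖ₑ := by fun_prop
  have h2 : 2 * (volume (closedBall x ρ) * ‖v‖ₑ) ≤ 2 * ∫⁻ y in closedBall x ρ, ‖v + B (y - x)‖ₑ := by
    calc 2 * (volume (closedBall x ρ) * ‖v‖ₑ) = ∫⁻ y in closedBall x ρ, 2 * ‖v‖ₑ := by
          rw [setLIntegral_const]; ring
      _ ≤ ∫⁻ y in closedBall x ρ, (‖v + B (y - x)‖ₑ + ‖v - B (y - x)‖ₑ) := by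
          refine lintegral_mono fun y => ?_
          calc 2 * ‖v‖ₑ = ‖(2:ℝ) • v‖ₑ := by rw [enorm_smul]; congr 1; simp [enorm_eq_nnnorm]
            _ = ‖(v + B (y - x)) + (v - B (y - x))‖ₑ := by congr 1; rw [two_smul]; abel
            _ ≤ _ := enorm_add_le _ _
      _ = _ := by rw [lintegral_add_left hm, h1, two_mul]
  exact (ENNReal.mul_le_mul_iff_right (by norm_num) (by norm_num)).1 h2

noncomputable def devE {d : ℕ} (F : (Fin d → ℝ) → (Fin d → ℝ))
    (G : (Fin d → ℝ) → (Fin d → ℝ) →L[ℝ] (Fin d → ℝ)) (k : ℕ) (x : Fin d → ℝ) : ℝ≥0∞ :=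
  (∫⁻ y in closedBall x ((2⁻¹:ℝ) ^ k), ‖F y - F x - G x (y - x)‖ₑ) /
    (ENNReal.ofReal ((2⁻¹:ℝ) ^ k) * volume (closedBall x ((2⁻¹:ℝ) ^ k)))

lemma devE_meas {d : ℕ} {F : (Fin d → ℝ) → (Fin d → ℝ)} (hF : Measurable F)
    {G : (Fin d → ℝ) → (Fin d → ℝ) →L[ℝ] (Fin d → ℝ)} (hG : Measurable G) (k : ℕ) :
    Measurable (devE F G k) := by
  have hv : ∀ x : Fin d → ℝ, volume (closedBall x ((2⁻¹:ℝ) ^ k)) =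
      volume (closedBall (0 : Fin d → ℝ) ((2⁻¹:ℝ) ^ k)) := fun x => by
    rw [Real.volume_pi_closedBall _ (by positivity), Real.volume_pi_closedBall _ (by positivity)]
  unfold devE
  simp_rw [hv]
  refine Measurable.div_const ?_ _
  have : ∀ x : Fin d → ℝ, ∫⁻ y in closedBall x ((2⁻¹:ℝ) ^ k), ‖F y - F x - G x (y - x)‖ₑ =
      ∫⁻ y, ({q : (Fin d → ℝ) × (Fin d → ℝ) | dist q.2 q.1 ≤ (2⁻¹:ℝ) ^ k}.indicator
        (fun q => ‖F q.2 - F q.1 - G q.1 (q.2 - q.1)‖ₑ)) (x, y) := by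
    intro x
    rw [← lintegral_indicator measurableSet_closedBall]
    rfl
  simp_rw [this]
  refine Measurable.lintegral_prod_right' (Measurable.indicator ?_ ?_)
  · have h1 : Measurable fun q : (Fin d → ℝ) × (Fin d → ℝ) => G q.1 (q.2 - q.1) := by
      have : Continuous fun q : ((Fin d → ℝ) →L[ℝ] (Fin d → ℝ)) × (Fin d → ℝ) => q.1 q.2 :=
        isBoundedBilinearMap_apply.continuous
      exact this.measurable.comp ((hG.comp measurable_fst).prodMk (measurable_snd.sub measurable_fst))
    exact (((hF.comp measurable_snd).sub (hF.comp measurable_fst)).sub h1).enorm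
  · exact (measurable_snd.dist measurable_fst) measurableSet_Iic

lemma devE_tendsto {d : ℕ} {Ω : Set (Fin d → ℝ)} (hΩ : IsOpen Ω) {F : (Fin d → ℝ) → (Fin d → ℝ)}
    (hF : ContinuousOn F Ω)
    {G : (Fin d → ℝ) → (Fin d → ℝ) →L[ℝ] (Fin d → ℝ)} (hGm : Measurable G) (hG : LocallyIntegrableOn G Ω)
    (hw : ∀ ψ : (Fin d → ℝ) → ℝ, ContDiff ℝ (⊤ : ℕ∞) ψ → HasCompactSupport ψ → tsupport ψ ⊆ Ω →
      ∀ v, ∫ x, ψ x • G x v = - ∫ x, fderiv ℝ ψ x v • F x)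
    {z : Fin d → ℝ} {r0 : ℝ} (hz : closedBall z r0 ⊆ Ω) :
    ∀ᵐ x, x ∈ ball z r0 → Tendsto (fun k => devE ((closedBall z r0).indicator F) G k x) atTop (𝓝 0) := by
  have hGi : Integrable ((closedBall z r0).indicator G) := by
    refine (integrable_indicator_iff (μ := volume) (f := G) (s := closedBall z r0) measurableSet_closedBall).2 ?_
    exact hG.integrableOn_compact_subset hz (isCompact_closedBall z r0)
  filter_upwards [(Besicovitch.vitaliFamily (volume : Measure (Fin d → ℝ))).ae_tendsto_lintegral_enorm_sub_div_of_integrable hGi]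
    with x hx hxz
  have hx2 := hx.comp (Besicovitch.tendsto_filterAt volume x)
  have hxG : (closedBall z r0).indicator G x = G x := indicator_of_mem (ball_subset_closedBall hxz) _
  rw [ENNReal.tendsto_nhds_zero]
  intro δ hδ
  have hev := (ENNReal.tendsto_nhds_zero.1 hx2) δ hδ
  rw [eventually_nhdsWithin_iff, Metric.eventually_nhds_iff] at hev
  obtain ⟨ρ0, hρ0, hρ⟩ := hev
  obtain ⟨ρ1, hρ1, hsub⟩ := Metric.isOpen_iff.1 isOpen_ball x hxz
  have ht : Tendsto (fun k : ℕ => (2⁻¹:ℝ) ^ k) atTop (𝓝 0) :=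
    tendsto_pow_atTop_nhds_zero_of_lt_one (by norm_num) (by norm_num)
  filter_upwards [ht.eventually (gt_mem_nhds hρ0), ht.eventually (gt_mem_nhds hρ1)] with k hk0 hk1
  set r : ℝ := (2⁻¹:ℝ) ^ k with hr
  have hr0 : 0 < r := by positivity
  have hsub2 : ∀ ρ ≤ r, closedBall x ρ ⊆ closedBall z r0 := fun ρ hρr =>
    (closedBall_subset_closedBall hρr).trans ((closedBall_subset_ball hk1).trans (hsub.trans ball_subset_closedBall))
  have key := poincare_pt hΩ hF hGm hG hw hr0 ((hsub2 r le_rfl).trans hz) (δ := δ) ?_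
  · unfold devE
    rw [← hr]
    refine ENNReal.div_le_of_le_mul ?_
    refine le_trans (le_of_eq ?_) (key.trans (le_of_eq (by ring)))
    refine setLIntegral_congr_fun measurableSet_closedBall fun y hy => ?_
    rw [indicator_of_mem (hsub2 r le_rfl hy), indicator_of_mem (ball_subset_closedBall hxz)]
  · intro ρ h0 hρr
    have h1 := hρ (y := ρ) (by rw [Real.dist_eq, sub_zero, abs_of_pos h0]; exact hρr.trans_lt hk0) h0
    simp only [Function.comp] at h1
    rw [ENNReal.div_le_iff (measure_closedBall_pos volume x h0).ne' measure_closedBall_lt_top.ne] at h1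
    refine le_trans (le_of_eq ?_) h1
    refine setLIntegral_congr_fun measurableSet_closedBall fun y hy => ?_
    rw [hxG, indicator_of_mem (hsub2 ρ hρr hy)]

lemma hasFDerivWithin_of_unif {d : ℕ} {F : (Fin d → ℝ) → (Fin d → ℝ)} (hF : Measurable F)
    {G : (Fin d → ℝ) → (Fin d → ℝ) →L[ℝ] (Fin d → ℝ)}
    {E : Set (Fin d → ℝ)} (hE : ∀ η : ℝ, 0 < η → ∀ᶠ k in atTop, ∀ x ∈ E, devE F G k x ≤ ENNReal.ofReal η) :
    ∀ x ∈ E, HasFDerivWithinAt F (G x) E x := by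
  intro x hx
  rw [hasFDerivWithinAt_iff_isLittleO, Asymptotics.isLittleO_iff]
  intro c hc
  set C : ℝ := 2 * (2 ^ (d+1) + 1) with hC
  have hCpos : 0 < C := by positivity
  have hη : 0 < c / C := by positivity
  obtain ⟨k0, hk0⟩ := eventually_atTop.1 (hE (c / C) hη)
  have hnb : ball x ((2⁻¹:ℝ) ^ (k0 + 1)) ∈ 𝓝[E] x :=
    mem_nhdsWithin_of_mem_nhds (ball_mem_nhds x (by positivity))
  filter_upwards [hnb, self_mem_nhdsWithin] with x' hx' hx'E
  by_cases hxx : x' = x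
  · subst hxx; simp
  have hpos : 0 < ‖x' - x‖ := norm_pos_iff.2 (sub_ne_zero.2 hxx)
  have hlt : ‖x' - x‖ < (2⁻¹:ℝ) ^ (k0 + 1) := by simpa [mem_ball, dist_eq_norm] using hx'
  obtain ⟨j, hj1, hj2⟩ := exists_nat_pow_near_of_lt_one hpos
    (hlt.le.trans (pow_le_one₀ (by norm_num) (by norm_num))) (by norm_num : (0:ℝ) < 2⁻¹) (by norm_num)
  have hjk : k0 + 1 ≤ j := by
    by_contra hcon
    have : (2⁻¹:ℝ) ^ (k0 + 1) ≤ (2⁻¹:ℝ) ^ (j + 1) :=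
      pow_le_pow_of_le_one (by norm_num) (by norm_num) (by omega)
    linarith
  obtain ⟨i, rfl⟩ : ∃ i, j = i + 1 := ⟨j - 1, by omega⟩
  set ρ : ℝ := (2⁻¹:ℝ) ^ (i + 1) with hρ
  have hρ0 : 0 < ρ := by positivity
  have hρ2 : (2⁻¹:ℝ) ^ i = 2 * ρ := by rw [hρ, pow_succ]; ring
  have e1 := hk0 i (by omega) x hx
  have e2 := hk0 (i+1) (by omega) x' hx'E
  unfold devE at e1 e2
  rw [← hρ] at e2
  rw [hρ2] at e1
  have dv : ∀ (w : Fin d → ℝ) (s : ℝ), 0 < s → ENNReal.ofReal s * volume (closedBall w s) ≠ 0 := by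
    intro w s hs
    exact mul_ne_zero (by simpa using hs) (measure_closedBall_pos volume w hs).ne'
  have dt : ∀ (w : Fin d → ℝ) (s : ℝ), ENNReal.ofReal s * volume (closedBall w s) ≠ ⊤ := by
    intro w s
    exact ENNReal.mul_ne_top ENNReal.ofReal_ne_top measure_closedBall_lt_top.ne
  rw [ENNReal.div_le_iff (dv _ _ (by positivity)) (dt _ _)] at e1
  rw [ENNReal.div_le_iff (dv _ _ (by positivity)) (dt _ _)] at e2
  set v0 := F x + G x (x' - x) - F x' with hv0
  have hsub : closedBall x' ρ ⊆ closedBall x (2 * ρ) := by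
    refine closedBall_subset_closedBall' ?_
    rw [dist_eq_norm]; linarith
  have hvv : volume (closedBall x' ρ) = volume (closedBall x ρ) := by
    rw [Real.volume_pi_closedBall _ hρ0.le, Real.volume_pi_closedBall _ hρ0.le]
  have hm : Measurable fun y => ‖F y - F x - G x (y - x)‖ₑ := by fun_prop
  have main : volume (closedBall x ρ) * ‖v0‖ₑ ≤
      volume (closedBall x ρ) * ENNReal.ofReal (c / C * ((2 ^ (d+1) + 1) * ρ)) := by
    rw [← hvv]
    refine (symm_est x' ρ v0 (G x - G x')).trans ?_
    calc ∫⁻ y in closedBall x' ρ, ‖v0 + (G x - G x') (y - x')‖ₑ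
        ≤ ∫⁻ y in closedBall x' ρ, (‖F y - F x - G x (y - x)‖ₑ + ‖F y - F x' - G x' (y - x')‖ₑ) := by
          refine lintegral_mono fun y => ?_
          have : v0 + (G x - G x') (y - x') =
              (F y - F x' - G x' (y - x')) - (F y - F x - G x (y - x)) := by
            have h3 : G x (y - x) = G x (x' - x) + G x (y - x') := by rw [← map_add]; congr 1; abel
            rw [hv0, h3, _root_.sub_apply]; abel
          rw [this, add_comm]
          exact enorm_sub_le
      _ = (∫⁻ y in closedBall x' ρ, ‖F y - F x - G x (y - x)‖ₑ) +
            ∫⁻ y in closedBall x' ρ, ‖F y - F x' - G x' (y - x')‖ₑ := lintegral_add_left hm _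
      _ ≤ ENNReal.ofReal (c / C) * (ENNReal.ofReal (2 * ρ) * volume (closedBall x (2 * ρ))) +
            ENNReal.ofReal (c / C) * (ENNReal.ofReal ρ * volume (closedBall x' ρ)) :=
          add_le_add ((lintegral_mono_set hsub).trans e1) e2
      _ = _ := by
          rw [vol_cb_smul x hρ0.le (by norm_num), hvv]
          have : c / C * ((2 ^ (d+1) + 1) * ρ) = c / C * (2 * ρ * 2 ^ d) + c / C * ρ := by ring
          rw [this, ENNReal.ofReal_add (by positivity) (by positivity),
            ENNReal.ofReal_mul hη.le, ENNReal.ofReal_mul (p := 2 * ρ) (by positivity), ENNReal.ofReal_mul hη.le]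
          ring
  rw [ENNReal.mul_le_mul_iff_right (measure_closedBall_pos volume x hρ0).ne' measure_closedBall_lt_top.ne,
    ← ofReal_norm, ENNReal.ofReal_le_ofReal_iff (by positivity)] at main
  rw [show F x' - F x - G x (x' - x) = -v0 by rw [hv0]; abel, norm_neg]
  refine main.trans ?_
  have : ρ < 2 * ‖x' - x‖ := by
    have : (2⁻¹:ℝ) ^ (i + 1 + 1) = ρ / 2 := by rw [hρ, pow_succ]; ring
    linarith
  calc c / C * ((2 ^ (d+1) + 1) * ρ) ≤ c / C * ((2 ^ (d+1) + 1) * (2 * ‖x' - x‖)) := by gcongr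
    _ = c * ‖x' - x‖ := by rw [hC]; field_simp

lemma jac_bound {d : ℕ} {Ω : Set (Fin d → ℝ)} (hΩ : IsOpen Ω) {F : (Fin d → ℝ) → (Fin d → ℝ)}
    (hF : ContinuousOn F Ω) (hinj : InjOn F Ω)
    {G : (Fin d → ℝ) → (Fin d → ℝ) →L[ℝ] (Fin d → ℝ)} (hGm : Measurable G) (hG : LocallyIntegrableOn G Ω)
    (hw : ∀ ψ : (Fin d → ℝ) → ℝ, ContDiff ℝ (⊤ : ℕ∞) ψ → HasCompactSupport ψ → tsupport ψ ⊆ Ω →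
      ∀ v, ∫ x, ψ x • G x v = - ∫ x, fderiv ℝ ψ x v • F x)
    {z : Fin d → ℝ} {r0 : ℝ} (hz : closedBall z r0 ⊆ Ω) {A : Set (Fin d → ℝ)} (hA : MeasurableSet A)
    (hAz : A ⊆ ball z r0) (w : (Fin d → ℝ) → ℝ≥0∞) :
    ∫⁻ x in A, ENNReal.ofReal |(G x).det| * w (F x) ≤ ∫⁻ y in F '' A, w y := by
  set Ft := (closedBall z r0).indicator F with hFt
  have hFtm : Measurable Ft := by
    rw [hFt, ← piecewise_eq_indicator]
    exact (hF.mono hz).measurable_piecewise continuousOn_const measurableSet_closedBall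
  have hFe : ∀ x ∈ ball z r0, Ft x = F x := fun x hx => indicator_of_mem (ball_subset_closedBall hx) _
  set e : ℕ → (Fin d → ℝ) → ℝ := fun k x => (min (devE Ft G k x) 1).toReal with he
  have hem : ∀ k, StronglyMeasurable (e k) := fun k =>
    ((devE_meas hFtm hGm k).min measurable_const).ennreal_toReal.stronglyMeasurable
  have het : ∀ᵐ x, x ∈ ball z r0 → Tendsto (fun k => e k x) atTop (𝓝 0) := by
    filter_upwards [devE_tendsto hΩ hF hGm hG hw hz] with x hx hxz
    have h1 := (hx hxz).min (tendsto_const_nhds (x := (1:ℝ≥0∞)))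
    have h2 := (ENNReal.tendsto_toReal (a := min 0 1) (by simp)).comp h1
    simpa [Function.comp_def, he] using h2
  have hE : ∀ j : ℕ, ∃ E ⊆ ball z r0, MeasurableSet E ∧ volume (ball z r0 \ E) ≤ ENNReal.ofReal ((2⁻¹:ℝ) ^ j) ∧
      ∀ x ∈ E, HasFDerivWithinAt F (G x) E x := by
    intro j
    obtain ⟨t, hts, htm, htv, hun⟩ := tendstoUniformlyOn_of_ae_tendsto (μ := volume) (g := fun _ => (0:ℝ))
      hem stronglyMeasurable_const measurableSet_ball (measure_ball_lt_top (x := z) (r := r0)).ne het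
      (ε := (2⁻¹:ℝ) ^ j) (by positivity)
    refine ⟨ball z r0 \ t, sdiff_subset, measurableSet_ball.diff htm, ?_, ?_⟩
    · rw [sdiff_sdiff_right_self, inter_eq_right.2 hts]; exact htv
    · have := hasFDerivWithin_of_unif hFtm (G := G) (E := ball z r0 \ t) ?_
      · intro x hx
        exact (this x hx).congr (fun y hy => (hFe y hy.1).symm) (hFe x hx.1).symm
      · intro η hη
        rw [Metric.tendstoUniformlyOn_iff] at hun
        filter_upwards [hun (min η 1) (by positivity)] with k hk x hx
        have h1 := hk x hx
        rw [dist_zero_left, Real.norm_of_nonneg ENNReal.toReal_nonneg] at h1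
        have hne : min (devE Ft G k x) 1 ≠ ⊤ := ne_top_of_le_ne_top ENNReal.one_ne_top (min_le_right _ _)
        have h2 : min (devE Ft G k x) 1 < ENNReal.ofReal (min η 1) :=
          (ENNReal.lt_ofReal_iff_toReal_lt hne).2 h1
        have h3 : min (devE Ft G k x) 1 < 1 := h2.trans_le (by
          rw [← ENNReal.ofReal_one]; exact ENNReal.ofReal_le_ofReal (min_le_right _ _))
        have h4 : devE Ft G k x < 1 := by
          rcases min_lt_iff.1 h3 with h | h
          · exact h
          · exact absurd h (lt_irrefl _)
        rw [min_eq_left h4.le] at h2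
        exact h2.le.trans (ENNReal.ofReal_le_ofReal (min_le_left _ _))
  choose E hEs hEm hEv hEd using hE
  have hnull : volume (ball z r0 \ ⋃ j, E j) = 0 := by
    have hle : ∀ j : ℕ, volume (ball z r0 \ ⋃ j, E j) ≤ ENNReal.ofReal ((2⁻¹:ℝ) ^ j) := fun j =>
      (measure_mono (sdiff_subset_sdiff_right (subset_iUnion E j))).trans (hEv j)
    have ht : Tendsto (fun k : ℕ => ENNReal.ofReal ((2⁻¹:ℝ) ^ k)) atTop (𝓝 0) := by
      rw [← ENNReal.ofReal_zero]
      exact ENNReal.tendsto_ofReal (tendsto_pow_atTop_nhds_zero_of_lt_one (by norm_num) (by norm_num))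
    exact le_antisymm (ge_of_tendsto' ht hle) zero_le
  set T : ℕ → Set (Fin d → ℝ) := fun j => A ∩ disjointed E j with hT
  have hTm : ∀ j, MeasurableSet (T j) := fun j => hA.inter (MeasurableSet.disjointed hEm j)
  have hTE : ∀ j, T j ⊆ E j := fun j => inter_subset_right.trans (disjointed_subset E j)
  have hTA : ∀ j, T j ⊆ A := fun j => inter_subset_left
  have hTd : Pairwise (Function.onFun Disjoint T) := fun i j hij =>
    (disjoint_disjointed E hij).mono inter_subset_right inter_subset_right
  have hAΩ : A ⊆ Ω := hAz.trans (ball_subset_closedBall.trans hz)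
  have hd : ∀ j, ∀ x ∈ T j, HasFDerivWithinAt F (G x) (T j) x := fun j x hx =>
    (hEd j x (hTE j hx)).mono (hTE j)
  have hiT : ∀ j, InjOn F (T j) := fun j => hinj.mono ((hTA j).trans hAΩ)
  have hAu : A =ᵐ[volume] ⋃ j, T j := by
    have : ⋃ j, T j ⊆ A := iUnion_subset hTA
    refine (LE.le.eventuallyLE this).antisymm ?_ |>.symm
    rw [ae_le_set]
    refine measure_mono_null ?_ hnull
    intro x hx
    refine ⟨hAz hx.1, fun hxE => hx.2 ?_⟩
    rw [hT, ← inter_iUnion, iUnion_disjointed]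
    exact ⟨hx.1, hxE⟩
  rw [setLIntegral_congr hAu, lintegral_iUnion hTm hTd]
  calc ∑' j, ∫⁻ x in T j, ENNReal.ofReal |(G x).det| * w (F x)
      = ∑' j, ∫⁻ y in F '' T j, w y := by
        congr 1; ext j
        exact (lintegral_image_eq_lintegral_abs_det_fderiv_mul volume (hTm j) (hd j) (hiT j) w).symm
    _ = ∫⁻ y in ⋃ j, F '' T j, w y := by
        rw [lintegral_iUnion]
        · intro j; exact measurable_image_of_fderivWithin (hTm j) (hd j) (hiT j)
        · intro i j hij
          exact (hTd hij).image hinj ((hTA i).trans hAΩ) ((hTA j).trans hAΩ)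
    _ ≤ _ := by
        refine lintegral_mono_set ?_
        rw [← image_iUnion]
        exact image_mono (iUnion_subset hTA)

open MeasureTheory Metric Set Filter
open scoped ENNReal NNReal Topology RealInnerProductSpace Classical


/-- weak Loomis-Whitney inequality -/
lemma loomis_whitney {k : ℕ} (hk : 1 ≤ k) {U : Set (Fin (k+1) → ℝ)} (hU : MeasurableSet U)
    {S : Fin (k+1) → Set (Fin k → ℝ)} (hS : ∀ j, MeasurableSet (S j))
    (hUS : ∀ x ∈ U, ∀ j : Fin (k+1), j.removeNth x ∈ S j) :
    volume U ^ ((k:ℝ) / (k+1)) ≤ ∑ j, volume (S j) := by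
  have hk0 : (0:ℝ) < k := by exact_mod_cast hk
  set p : ℝ := (k+1) / k with hp
  have hconj : Real.HolderConjugate (Fintype.card (Fin (k+1))) p := by
    rw [Real.holderConjugate_iff]
    simp only [Fintype.card_fin, hp]
    push_cast
    refine ⟨by linarith, ?_⟩
    field_simp
    ring
  set f : (Fin (k+1) → ℝ) → ℝ≥0∞ := fun x => ∑ j, (S j).indicator 1 (j.removeNth x) *
    (Icc (0:ℝ) 1).indicator 1 (x j) with hf
  have hrm : ∀ j : Fin (k+1), Measurable fun x : Fin (k+1) → ℝ => j.removeNth x := fun j =>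
    measurable_pi_lambda _ fun i => measurable_pi_apply _
  have hterm : ∀ j : Fin (k+1), Measurable fun x : Fin (k+1) → ℝ =>
      (S j).indicator (1 : (Fin k → ℝ) → ℝ≥0∞) (j.removeNth x) * (Icc (0:ℝ) 1).indicator 1 (x j) := fun j =>
    ((measurable_one.indicator (hS j)).comp (hrm j)).mul
      ((measurable_one.indicator measurableSet_Icc).comp (measurable_pi_apply j))
  have hfm : Measurable f := Finset.measurable_fun_sum _ fun j _ => hterm j
  have hint : ∫⁻ x, f x = ∑ j, volume (S j) := by
    rw [hf, lintegral_finset_sum _ fun j _ => hterm j]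
    refine Finset.sum_congr rfl fun j _ => ?_
    rw [fubini_ins j (hterm j)]
    simp only [Fin.removeNth_insertNth, Fin.insertNth_apply_same]
    have : ∀ s : ℝ, ∫⁻ y, (S j).indicator (1 : (Fin k → ℝ) → ℝ≥0∞) y * (Icc (0:ℝ) 1).indicator 1 s =
        volume (S j) * (Icc (0:ℝ) 1).indicator 1 s := by
      intro s
      rw [lintegral_mul_const _ (measurable_one.indicator (hS j)), lintegral_indicator_one (hS j)]
    simp_rw [this]
    rw [lintegral_const_mul _ (measurable_one.indicator measurableSet_Icc),
      lintegral_indicator_one measurableSet_Icc]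
    simp
  have key := lintegral_prod_lintegral_pow_le (fun _ : Fin (k+1) => (volume : Measure ℝ)) hconj hfm
  rw [← volume_pi, hint] at key
  have hlow : volume U ≤ (∑ j, volume (S j)) ^ p := by
    refine le_trans ?_ key
    calc volume U = ∫⁻ x in U, 1 := by simp
      _ ≤ ∫⁻ x in U, ∏ i, (∫⁻ xi, f (Function.update x i xi)) ^ ((1:ℝ) / (Fintype.card (Fin (k+1)) - 1 : ℝ)) := by
          refine setLIntegral_mono' hU fun x hx => ?_
          refine Finset.one_le_prod' fun i _ => ?_
          refine ENNReal.one_le_rpow ?_ (by simp; omega)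
          calc (1:ℝ≥0∞) = ∫⁻ t : ℝ, (Icc (0:ℝ) 1).indicator 1 t := by
                rw [lintegral_indicator_one measurableSet_Icc]; simp
            _ ≤ _ := by
                refine lintegral_mono fun t => ?_
                refine le_trans ?_ (Finset.single_le_sum (f := fun j => (S j).indicator (1 : (Fin k → ℝ) → ℝ≥0∞) (j.removeNth (Function.update x i t)) *
                  (Icc (0:ℝ) 1).indicator 1 ((Function.update x i t) j)) (fun _ _ => zero_le) (Finset.mem_univ i))
                have h1 : i.removeNth (Function.update x i t) = i.removeNth x := by
                  ext l; simp [Fin.removeNth]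
                simp only [h1, Function.update_self, indicator_of_mem (hUS x hx i)]
                simp
      _ ≤ _ := setLIntegral_le_lintegral _ _
  calc volume U ^ ((k:ℝ) / (k+1)) ≤ ((∑ j, volume (S j)) ^ p) ^ ((k:ℝ) / (k+1)) :=
        ENNReal.rpow_le_rpow hlow (by positivity)
    _ = _ := by
        rw [← ENNReal.rpow_mul, hp]
        rw [show ((k:ℝ) + 1) / k * (k / (k+1)) = 1 by field_simp, ENNReal.rpow_one]

lemma distr_le {Y : Type*} [MeasurableSpace Y] (μ : Measure Y) {ρ : Y → ℝ} (τ : ℝ≥0∞) :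
    μ {y | μ {y' | ρ y' ≤ ρ y} ≤ τ} ≤ τ := by
  set I : Set ℝ := {r | μ {y' | ρ y' ≤ r} ≤ τ} with hI
  have hdown : ∀ r r', r ≤ r' → r' ∈ I → r ∈ I := fun r r' h h' =>
    (measure_mono fun y (hy : ρ y ≤ r) => hy.trans h).trans h'
  change μ {y | ρ y ∈ I} ≤ τ
  by_cases hmax : ∃ r ∈ I, ∀ r' ∈ I, r' ≤ r
  · obtain ⟨r, hr, hr'⟩ := hmax
    exact (measure_mono fun y (hy : ρ y ∈ I) => hr' _ hy).trans hr
  · push Not at hmax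
    have hsub : {y | ρ y ∈ I} ⊆ ⋃ q : {q : ℚ // (q:ℝ) ∈ I}, {y | ρ y ≤ (q.1 : ℝ)} := by
      intro y hy
      obtain ⟨r', hr', hlt⟩ := hmax _ hy
      obtain ⟨q, hq1, hq2⟩ := exists_rat_btwn hlt
      exact mem_iUnion.2 ⟨⟨q, hdown _ _ hq2.le hr'⟩, hq1.le⟩
    refine (measure_mono hsub).trans ?_
    rw [Directed.measure_iUnion]
    · exact iSup_le fun q => q.2
    · intro q q'
      rcases le_total q.1 q'.1 with h | h
      · exact ⟨q', fun y (hy : ρ y ≤ (q.1:ℝ)) => hy.trans (by exact_mod_cast h), le_rfl⟩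
      · exact ⟨q, le_rfl, fun y (hy : ρ y ≤ (q'.1:ℝ)) => hy.trans (by exact_mod_cast h)⟩

lemma geo_sum {c : ℝ} (hc : 0 < c) : ∑' k : ℕ, ((2:ℝ≥0∞) ^ (-c)) ^ k ≠ ⊤ := by
  rw [ENNReal.tsum_geometric]
  simp only [ne_eq, ENNReal.inv_eq_top, tsub_eq_zero_iff_le, not_le]
  exact ENNReal.rpow_lt_one_of_one_lt_of_neg (by norm_num) (by linarith)

lemma dist_high {s : ℝ} (hs : 1 < s) : ∃ C : ℝ≥0∞, C ≠ ⊤ ∧ ∀ {Y : Type} [MeasurableSpace Y] (μ : Measure Y)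
    (A : Y → ℝ≥0∞), Measurable A → (∀ τ, μ {y | A y ≤ τ} ≤ τ) → ∀ v : ℝ≥0∞, v ≠ 0 → v ≠ ⊤ →
    ∫⁻ y in {y | v ≤ A y}, A y ^ (-s) ∂μ ≤ C * v ^ (1 - s) := by
  refine ⟨2 * ∑' k : ℕ, ((2:ℝ≥0∞) ^ (-(s-1))) ^ k, ENNReal.mul_ne_top (by norm_num) (geo_sum (by linarith)), ?_⟩
  intro Y _ μ A hA hd v hv0 hvt
  set T : ℕ → Set Y := fun k => {y | v * 2 ^ k ≤ A y ∧ A y ≤ v * 2 ^ (k+1)} with hT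
  set Ti : Set Y := {y | A y = ⊤} with hTi
  have hcov : {y | v ≤ A y} ⊆ (⋃ k, T k) ∪ Ti := by
    intro y hy
    by_cases ht : A y = ⊤
    · exact Or.inr ht
    left
    have hq1 : 1 ≤ A y / v := by
      rw [ENNReal.le_div_iff_mul_le (Or.inl hv0) (Or.inl hvt), one_mul]; exact hy
    have hqt : A y / v ≠ ⊤ := ENNReal.div_ne_top ht hv0
    lift A y / v to ℝ≥0 using hqt with q hq
    obtain ⟨k, hk1, hk2⟩ := exists_nat_pow_near (x := q) (y := 2) (by exact_mod_cast hq1) (by norm_num)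
    have hAq : A y = v * q := by rw [hq, ENNReal.mul_div_cancel hv0 hvt]
    refine mem_iUnion.2 ⟨k, ?_, ?_⟩
    · rw [hAq]; gcongr; exact_mod_cast hk1
    · rw [hAq]; gcongr; exact_mod_cast hk2.le
  have hTm : ∀ k, MeasurableSet (T k) := fun k =>
    (measurableSet_le measurable_const hA).inter (measurableSet_le hA measurable_const)
  have hTim : MeasurableSet Ti := hA (measurableSet_singleton _)
  refine (lintegral_mono_set hcov).trans ((lintegral_union_le _ _ _).trans ?_)
  have h0 : ∫⁻ y in Ti, A y ^ (-s) ∂μ = 0 := by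
    rw [setLIntegral_congr_fun (g := fun _ => 0) hTim]
    · simp
    · intro y hy
      simp only [show A y = ⊤ from hy]
      rw [ENNReal.top_rpow_of_neg (by linarith)]
  rw [h0, add_zero]
  refine (lintegral_iUnion_le _ _).trans ?_
  rw [mul_assoc, mul_comm (∑' k : ℕ, _), ← mul_assoc, ← ENNReal.tsum_mul_left]
  refine ENNReal.tsum_le_tsum fun k => ?_
  have h2 : (2:ℝ≥0∞) ^ k ≠ 0 := by positivity
  have h2t : (2:ℝ≥0∞) ^ k ≠ ⊤ := by finiteness
  calc ∫⁻ y in T k, A y ^ (-s) ∂μ ≤ ∫⁻ y in T k, (v * 2 ^ k) ^ (-s) ∂μ := by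
        refine setLIntegral_mono' (hTm k) fun y hy => ?_
        rw [ENNReal.rpow_neg, ENNReal.rpow_neg]
        exact ENNReal.inv_le_inv.2 (ENNReal.rpow_le_rpow hy.1 (by linarith))
    _ = (v * 2 ^ k) ^ (-s) * μ (T k) := setLIntegral_const _ _
    _ ≤ (v * 2 ^ k) ^ (-s) * (v * 2 ^ (k+1)) := by
        gcongr
        exact (measure_mono fun y hy => hy.2).trans (hd _)
    _ = 2 * ((v * 2 ^ k) ^ (-s) * (v * 2 ^ k) ^ (1:ℝ)) := by rw [ENNReal.rpow_one, pow_succ]; ring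
    _ = 2 * (v * 2 ^ k) ^ (1 - s) := by
        rw [← ENNReal.rpow_add _ _ (mul_ne_zero hv0 h2) (ENNReal.mul_ne_top hvt h2t)]; congr 2; ring
    _ = _ := by
        rw [ENNReal.mul_rpow_of_ne_top hvt h2t, mul_assoc]; congr 2
        rw [← ENNReal.rpow_natCast, ← ENNReal.rpow_natCast, ← ENNReal.rpow_mul, ← ENNReal.rpow_mul]
        congr 1; ring

lemma dist_low {θ : ℝ} (h0 : 0 < θ) (hθ : θ < 1) : ∃ C : ℝ≥0∞, C ≠ ⊤ ∧ ∀ {Y : Type} [MeasurableSpace Y] (μ : Measure Y)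
    (A : Y → ℝ≥0∞), Measurable A → (∀ τ, μ {y | A y ≤ τ} ≤ τ) → ∀ v : ℝ≥0∞, v ≠ 0 → v ≠ ⊤ →
    ∫⁻ y in {y | A y ≤ v}, A y ^ (-θ) ∂μ ≤ C * v ^ (1 - θ) := by
  refine ⟨2 ^ θ * ∑' k : ℕ, ((2:ℝ≥0∞) ^ (-(1-θ))) ^ k, ENNReal.mul_ne_top (by finiteness) (geo_sum (by linarith)), ?_⟩
  intro Y _ μ A hA hd v hv0 hvt
  set T : ℕ → Set Y := fun k => {y | v * 2⁻¹ ^ (k+1) ≤ A y ∧ A y ≤ v * 2⁻¹ ^ k} with hT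
  set Ti : Set Y := {y | A y = 0} with hTi
  have hcov : {y | A y ≤ v} ⊆ (⋃ k, T k) ∪ Ti := by
    intro y hy
    by_cases ht : A y = 0
    · exact Or.inr ht
    left
    have hq1 : A y / v ≤ 1 := by
      rw [ENNReal.div_le_iff hv0 hvt, one_mul]; exact hy
    have hq0 : A y / v ≠ 0 := ENNReal.div_ne_zero.2 ⟨ht, hvt⟩
    have hqt : A y / v ≠ ⊤ := ne_top_of_le_ne_top ENNReal.one_ne_top hq1
    lift A y / v to ℝ≥0 using hqt with q hq
    obtain ⟨k, hk1, hk2⟩ := exists_nat_pow_near_of_lt_one (x := q) (y := 2⁻¹)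
      (pos_iff_ne_zero.2 (by exact_mod_cast hq0)) (by exact_mod_cast hq1) (by norm_num) (by
        exact inv_lt_one_of_one_lt₀ (by norm_num))
    have hAq : A y = v * q := by rw [hq, ENNReal.mul_div_cancel hv0 hvt]
    have hpow : ∀ j : ℕ, (2⁻¹:ℝ≥0∞) ^ j = ((2⁻¹ ^ j : ℝ≥0) : ℝ≥0∞) := fun j => by
      rw [ENNReal.coe_pow, ENNReal.coe_inv (by norm_num)]; rfl
    refine mem_iUnion.2 ⟨k, ?_, ?_⟩
    · rw [hAq, hpow]; gcongr
    · rw [hAq, hpow]; gcongr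
  have hTm : ∀ k, MeasurableSet (T k) := fun k =>
    (measurableSet_le measurable_const hA).inter (measurableSet_le hA measurable_const)
  refine (lintegral_mono_set hcov).trans ((lintegral_union_le _ _ _).trans ?_)
  have h0' : ∫⁻ y in Ti, A y ^ (-θ) ∂μ = 0 := by
    refine setLIntegral_measure_zero _ _ (le_antisymm ?_ zero_le)
    exact (measure_mono fun y (hy : A y = 0) => hy.le).trans (hd 0)
  rw [h0', add_zero]
  refine (lintegral_iUnion_le _ _).trans ?_
  rw [mul_assoc, mul_comm (∑' k : ℕ, _), ← mul_assoc, ← ENNReal.tsum_mul_left]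
  refine ENNReal.tsum_le_tsum fun k => ?_
  have h2 : (2⁻¹:ℝ≥0∞) ^ k ≠ 0 := by simp
  have h2t : (2⁻¹:ℝ≥0∞) ^ k ≠ ⊤ := by simp
  calc ∫⁻ y in T k, A y ^ (-θ) ∂μ ≤ ∫⁻ y in T k, (v * 2⁻¹ ^ (k+1)) ^ (-θ) ∂μ := by
        refine setLIntegral_mono' (hTm k) fun y hy => ?_
        rw [ENNReal.rpow_neg, ENNReal.rpow_neg]
        exact ENNReal.inv_le_inv.2 (ENNReal.rpow_le_rpow hy.1 (by linarith))
    _ = (v * 2⁻¹ ^ (k+1)) ^ (-θ) * μ (T k) := setLIntegral_const _ _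
    _ ≤ (v * 2⁻¹ ^ (k+1)) ^ (-θ) * (v * 2⁻¹ ^ k) := by
        gcongr
        exact (measure_mono fun y hy => hy.2).trans (hd _)
    _ = 2 ^ θ * ((v * 2⁻¹ ^ k) ^ (-θ) * (v * 2⁻¹ ^ k) ^ (1:ℝ)) := by
        rw [ENNReal.rpow_one, pow_succ, ← mul_assoc v, ENNReal.mul_rpow_of_ne_top (ENNReal.mul_ne_top hvt h2t) (by simp)]
        rw [ENNReal.inv_rpow, ENNReal.rpow_neg 2, inv_inv]
        ring
    _ = 2 ^ θ * (v * 2⁻¹ ^ k) ^ (1 - θ) := by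
        rw [← ENNReal.rpow_add _ _ (mul_ne_zero hv0 h2) (ENNReal.mul_ne_top hvt h2t)]; congr 2; ring
    _ = _ := by
        rw [ENNReal.mul_rpow_of_ne_top hvt h2t, mul_assoc]; congr 2
        rw [← ENNReal.rpow_natCast, ← ENNReal.rpow_natCast, ← ENNReal.rpow_mul, ← ENNReal.rpow_mul,
          ENNReal.inv_rpow, ← ENNReal.rpow_neg]
        congr 1; ring

open MeasureTheory Metric Set Filter
open scoped ENNReal NNReal Topology RealInnerProductSpace Classical


noncomputable def sg (b : Bool) : ℝ := if b then 1 else -1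

/-- point on the boundary of a cube -/
noncomputable def spt {m : ℕ} (z : Fin (m+1) → ℝ) (q : Fin (m+1) × Bool) (r : ℝ) (y : Fin m → ℝ) :
    Fin (m+1) → ℝ := q.1.insertNth (z q.1 + sg q.2 * r) y

/-- integral over the boundary of a cube -/
noncomputable def sph {m : ℕ} (z : Fin (m+1) → ℝ) (r : ℝ) (w : (Fin (m+1) → ℝ) → ℝ≥0∞) : ℝ≥0∞ :=
  ∑ q : Fin (m+1) × Bool, ∫⁻ y in closedBall (q.1.removeNth z) r, w (spt z q r y)

lemma abs_sg (b : Bool) : |sg b| = 1 := by cases b <;> simp [sg]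

lemma mp_sg (b : Bool) (c : ℝ) : MeasurePreserving (fun r : ℝ => c + sg b * r) volume volume := by
  cases b
  · simpa [sg, sub_eq_add_neg] using Measure.measurePreserving_sub_left (volume : Measure ℝ) c
  · simpa [sg] using measurePreserving_add_left (volume : Measure ℝ) c

lemma spt_mem {m : ℕ} (z : Fin (m+1) → ℝ) (q : Fin (m+1) × Bool) {r : ℝ} (hr : 0 ≤ r) {y : Fin m → ℝ}
    (hy : y ∈ closedBall (q.1.removeNth z) r) : dist (spt z q r y) z = r := by
  refine le_antisymm ?_ ?_
  · refine (ins_mem_cb q.1 z hr _ y).2 ⟨?_, hy⟩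
    rw [mem_closedBall, Real.dist_eq, add_sub_cancel_left, abs_mul, abs_sg, one_mul, abs_of_nonneg hr]
  · refine le_trans (le_of_eq ?_) (dist_le_pi_dist _ _ q.1)
    rw [spt, Fin.insertNth_apply_same, Real.dist_eq, add_sub_cancel_left, abs_mul, abs_sg, one_mul, abs_of_nonneg hr]

lemma sphere_spt {m : ℕ} (z : Fin (m+1) → ℝ) {r : ℝ} (hr : 0 ≤ r) {x : Fin (m+1) → ℝ} (hx : dist x z = r) :
    ∃ q : Fin (m+1) × Bool, ∃ y ∈ closedBall (q.1.removeNth z) r, x = spt z q r y := by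
  have : ∃ i, dist (x i) (z i) = r := by
    by_contra hcon
    push Not at hcon
    have h1 : ∀ i, dist (x i) (z i) < r := fun i =>
      lt_of_le_of_ne ((dist_le_pi_dist x z i).trans hx.le) (hcon i)
    have hr' : 0 < r := dist_nonneg.trans_lt (h1 0)
    exact (((dist_pi_lt_iff hr').2 h1).ne hx)
  obtain ⟨i, hi⟩ := this
  have hy : i.removeNth x ∈ closedBall (i.removeNth z) r := by
    rw [mem_closedBall, dist_pi_le_iff hr]
    exact fun j => (dist_le_pi_dist x z _).trans hx.le
  rw [Real.dist_eq] at hi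
  rcases abs_choice (x i - z i) with h | h
  · refine ⟨(i, true), i.removeNth x, hy, ?_⟩
    rw [spt]
    simp only [sg, if_true, one_mul]
    rw [show z i + r = x i by linarith, Fin.insertNth_self_removeNth]
  · refine ⟨(i, false), i.removeNth x, hy, ?_⟩
    rw [spt]
    simp only [sg]
    rw [show z i + (if false = true then 1 else -1) * r = x i by simp; linarith, Fin.insertNth_self_removeNth]

lemma sph_weight {m : ℕ} (z : Fin (m+1) → ℝ) {r : ℝ} (hr : 0 ≤ r) {w w' : (Fin (m+1) → ℝ) → ℝ≥0∞}
    (h : ∀ x, dist x z = r → w x ≤ w' x) : sph z r w ≤ sph z r w' := by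
  refine Finset.sum_le_sum fun q _ => setLIntegral_mono' measurableSet_closedBall fun y hy => ?_
  exact h _ (spt_mem z q hr hy)

lemma sph_coarea {m : ℕ} (z : Fin (m+1) → ℝ) {R R' : ℝ} (hR : 0 ≤ R)
    {w : (Fin (m+1) → ℝ) → ℝ≥0∞} (hw : Measurable w) :
    ∫⁻ r in Icc R R', sph z r w ≤ 2 * (m+1) * ∫⁻ x in closedBall z R' \ ball z R, w x := by
  set A := closedBall z R' \ ball z R with hA
  have hAm : MeasurableSet A := measurableSet_closedBall.diff measurableSet_ball
  set W := A.indicator w with hW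
  have hWm : Measurable W := hw.indicator hAm
  have hmr : ∀ q : Fin (m+1) × Bool, Measurable fun s : ℝ => ∫⁻ y, W (q.1.insertNth s y) := fun q =>
    Measurable.lintegral_prod_right' (f := fun a : ℝ × (Fin m → ℝ) => W (q.1.insertNth a.1 a.2))
      (hWm.comp (meas_ins q.1))
  calc ∫⁻ r in Icc R R', sph z r w
      ≤ ∫⁻ r in Icc R R', ∑ q : Fin (m+1) × Bool, ∫⁻ y, W (spt z q r y) := by
        refine setLIntegral_mono' measurableSet_Icc fun r hr => ?_
        have hr0 : 0 ≤ r := hR.trans hr.1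
        refine Finset.sum_le_sum fun q _ => ?_
        refine le_trans (setLIntegral_mono' measurableSet_closedBall fun y hy => ?_) (setLIntegral_le_lintegral _ _)
        have hd := spt_mem z q hr0 hy
        rw [hW, indicator_of_mem]
        refine ⟨?_, ?_⟩
        · rw [mem_closedBall, hd]; exact hr.2
        · rw [mem_ball, hd, not_lt]; exact hr.1
    _ ≤ ∫⁻ r, ∑ q : Fin (m+1) × Bool, ∫⁻ y, W (spt z q r y) := setLIntegral_le_lintegral _ _
    _ = ∑ q : Fin (m+1) × Bool, ∫⁻ r, ∫⁻ y, W (spt z q r y) := by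
        rw [lintegral_finsetSum]
        intro q _
        exact (hmr q).comp (mp_sg q.2 (z q.1)).measurable
    _ = ∑ q : Fin (m+1) × Bool, ∫⁻ x, W x := by
        refine Finset.sum_congr rfl fun q _ => ?_
        rw [fubini_ins q.1 hWm, ← (mp_sg q.2 (z q.1)).lintegral_comp (hmr q)]
        rfl
    _ = _ := by
        rw [Finset.sum_const, Finset.card_univ, hW, lintegral_indicator hAm]
        simp only [Fintype.card_prod, Fintype.card_fin, Fintype.card_bool, nsmul_eq_mul]
        push_cast
        ring

/-- measure domination -/
lemma weighted_image {Y Z : Type*} [MeasurableSpace Y] [MeasurableSpace Z] {ν : Measure Y} {μ : Measure Z}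
    {u : Y → Z} (hu : Measurable u) {E : Set Y} (hE : MeasurableSet E) {γ : Y → ℝ≥0∞} (hγ : Measurable γ)
    {C : ℝ≥0∞}
    (h : ∀ E', MeasurableSet E' → E' ⊆ E → μ (u '' E') ≤ C * ∫⁻ y in E', γ y ∂ν)
    {ω : Z → ℝ≥0∞} (hω : Measurable ω) :
    ∫⁻ q in u '' E, ω q ∂μ ≤ C * ∫⁻ y in E, ω (u y) * γ y ∂ν := by
  have hle : μ.restrict (u '' E) ≤ C • Measure.map u ((ν.restrict E).withDensity γ) := by
    refine Measure.le_intro fun T hT _ => ?_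
    rw [Measure.restrict_apply hT, Measure.smul_apply, Measure.map_apply hu hT,
      withDensity_apply _ (hu hT), Measure.restrict_restrict (hu hT), smul_eq_mul, inter_comm T]
    rw [← image_inter_preimage]
    refine (h _ (hE.inter (hu hT)) inter_subset_left).trans ?_
    rw [inter_comm]
  calc ∫⁻ q in u '' E, ω q ∂μ ≤ ∫⁻ q, ω q ∂(C • Measure.map u ((ν.restrict E).withDensity γ)) :=
        lintegral_mono' hle le_rfl
    _ = C * ∫⁻ y in E, ω (u y) * γ y ∂ν := by
        rw [lintegral_smul_measure, lintegral_map hω hu,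
          lintegral_withDensity_eq_lintegral_mul _ hγ (show Measurable (fun a => ω (u a)) from hω.comp hu), smul_eq_mul]
        congr 1
        refine lintegral_congr fun y => ?_
        simp [mul_comm]

noncomputable def Cs (m : ℕ) (c0 : ℝ≥0) : ℝ≥0∞ := imC m c0 * 2 ^ m

lemma Cs_ne_top (m : ℕ) (c0 : ℝ≥0) : Cs m c0 ≠ ⊤ := by unfold Cs imC; finiteness

lemma sph_meas {m : ℕ} {c0 : ℝ≥0} {Ω F G g h b} (S : Setup m c0 Ω F G g h b) (hFm : Measurable F)
    {z : Fin (m+1) → ℝ} {R : ℝ} (hR : 0 < R) (hz : closedBall z (3 * R) ⊆ Ω)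
    {Z : Type*} [MeasurableSpace Z] [PseudoEMetricSpace Z] [BorelSpace Z] (μ : Measure Z)
    (hμ : ∀ S, μ S ≤ ediam S ^ m) {P : (Fin (m+1) → ℝ) → Z} (hP : LipschitzWith 1 P) :
    ∀ᵐ r ∂(volume.restrict (Icc R (2 * R))), ∀ ω : Z → ℝ≥0∞, Measurable ω →
      ∫⁻ q in (fun x => P (F x)) '' sphere z r, ω q ∂μ ≤
        Cs m c0 * sph z r (fun x => ω (P (F x)) * g x ^ m) := by
  have hq : ∀ q : Fin (m+1) × Bool, ∀ᵐ r, r ∈ Icc R (2 * R) → ∀ E, MeasurableSet E →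
      E ⊆ ball (q.1.removeNth z) (3 * R) →
      μ ((fun y => P (F (spt z q r y))) '' E) ≤ Cs m c0 * ∫⁻ y in E, g (spt z q r y) ^ m := by
    intro q
    have h1 := slice_bound S q.1 (by positivity : 0 < 3 * R) hz μ hμ hP
    rw [ae_restrict_iff' measurableSet_closedBall] at h1
    have h2 := (mp_sg q.2 (z q.1)).quasiMeasurePreserving.ae h1
    filter_upwards [h2] with r hr hrR
    refine hr ?_
    rw [mem_closedBall, Real.dist_eq, add_sub_cancel_left, abs_mul, abs_sg, one_mul]
    rw [abs_of_nonneg (hR.le.trans hrR.1)]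
    linarith [hrR.2]
  rw [ae_restrict_iff' measurableSet_Icc]
  filter_upwards [ae_all_iff.2 hq] with r hr hrR ω hω
  have hr0 : 0 ≤ r := hR.le.trans hrR.1
  set u : Fin (m+1) × Bool → (Fin m → ℝ) → Z := fun q y => P (F (spt z q r y)) with hu
  have hum : ∀ q, Measurable (u q) := fun q =>
    hP.continuous.measurable.comp (hFm.comp (meas_ins1 q.1 _))
  have hcov : (fun x => P (F x)) '' sphere z r ⊆ ⋃ q, u q '' closedBall (q.1.removeNth z) r := by
    rintro _ ⟨x, hx, rfl⟩
    obtain ⟨q, y, hy, rfl⟩ := sphere_spt z hr0 hx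
    exact mem_iUnion.2 ⟨q, y, hy, rfl⟩
  refine (lintegral_mono_set hcov).trans ((lintegral_iUnion_le _ _).trans ?_)
  rw [tsum_fintype, sph, Finset.mul_sum]
  refine Finset.sum_le_sum fun q _ => ?_
  refine weighted_image (hum q) measurableSet_closedBall ((S.hg.comp (meas_ins1 q.1 _)).pow_const m) ?_ hω
  intro E' hE' hsub
  exact hr q hrR E' hE' (hsub.trans (closedBall_subset_ball (by linarith [hrR.2])))

/-- every line through an image point in a coordinate direction hits the image of the sphere -/
lemma line_hits {n : ℕ} {Ω : Set (Fin n → ℝ)} {F : (Fin n → ℝ) → (Fin n → ℝ)} (hF : ContinuousOn F Ω)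
    (hopen : ∀ U ⊆ Ω, IsOpen U → IsOpen (F '' U)) {z : Fin n → ℝ} {r : ℝ} (hz : closedBall z r ⊆ Ω)
    (k : Fin n) {x : Fin n → ℝ} (hx : x ∈ closedBall z r) :
    ∃ x' ∈ sphere z r, ∀ l, l ≠ k → F x' l = F x l := by
  set L : Set (Fin n → ℝ) := {y | ∀ l, l ≠ k → y l = F x l} with hL
  have hLc : IsClosed L := by
    have : L = ⋂ l, ⋂ (_ : l ≠ k), {y : Fin n → ℝ | y l = F x l} := by
      ext y; simp [hL]
    rw [this]
    exact isClosed_iInter fun l => isClosed_iInter fun _ => isClosed_eq (continuous_apply l) continuous_const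
  have hK : IsCompact (F '' closedBall z r ∩ L) :=
    ((isCompact_closedBall z r).image_of_continuousOn (hF.mono hz)).inter_right hLc
  obtain ⟨y, ⟨⟨x', hx', rfl⟩, hyL⟩, hmax⟩ := hK.exists_isMaxOn
    ⟨F x, ⟨x, hx, rfl⟩, fun l _ => rfl⟩ (continuous_apply k).continuousOn
  refine ⟨x', ?_, hyL⟩
  by_contra hns
  have hb : x' ∈ ball z r := by
    rw [mem_ball]
    exact lt_of_le_of_ne hx' hns
  have ho := hopen (ball z r) (ball_subset_closedBall.trans hz) isOpen_ball
  obtain ⟨ε, hε, hsub⟩ := Metric.isOpen_iff.1 ho (F x') ⟨x', hb, rfl⟩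
  set y2 := Function.update (F x') k (F x' k + ε / 2) with hy2
  have hy2b : y2 ∈ ball (F x') ε := by
    rw [mem_ball, dist_pi_lt_iff hε]
    intro l
    by_cases hl : l = k
    · subst hl; rw [hy2, Function.update_self, Real.dist_eq, add_sub_cancel_left, abs_of_pos (by positivity)]; linarith
    · rw [hy2, Function.update_of_ne hl, dist_self]; exact hε
  have hy2m : y2 ∈ F '' closedBall z r ∩ L := by
    refine ⟨image_mono ball_subset_closedBall (hsub hy2b), fun l hl => ?_⟩
    rw [hy2, Function.update_of_ne hl]; exact hyL l hl
  have := hmax hy2m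
  simp only [hy2, mem_ofPred_eq, Function.update_self] at this
  linarith

/-- radial function of the inverse -/
noncomputable def rho {n : ℕ} (F : (Fin n → ℝ) → (Fin n → ℝ)) (z : Fin n → ℝ) (R : ℝ) (y : Fin n → ℝ) : ℝ :=
  if y ∈ F '' closedBall z R then dist (Function.invFunOn F (closedBall z R) y) z else R + 1

lemma rho_apply {n : ℕ} {F : (Fin n → ℝ) → (Fin n → ℝ)} {z : Fin n → ℝ} {R : ℝ}
    (hinj : InjOn F (closedBall z R)) {x : Fin n → ℝ} (hx : x ∈ closedBall z R) :
    rho F z R (F x) = dist x z := by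
  rw [rho, if_pos ⟨x, hx, rfl⟩, hinj.leftInvOn_invFunOn hx]

lemma rho_le_iff {n : ℕ} {F : (Fin n → ℝ) → (Fin n → ℝ)} {z : Fin n → ℝ} {R : ℝ}
    (hinj : InjOn F (closedBall z R)) {r : ℝ} (hr : r ≤ R) (y : Fin n → ℝ) :
    rho F z R y ≤ r ↔ y ∈ F '' closedBall z r := by
  constructor
  · intro h
    by_cases hy : y ∈ F '' closedBall z R
    · obtain ⟨x, hx, rfl⟩ := hy
      rw [rho_apply hinj hx] at h
      exact ⟨x, h, rfl⟩
    · rw [rho, if_neg hy] at h; linarith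
  · rintro ⟨x, hx, rfl⟩
    rw [rho_apply hinj (closedBall_subset_closedBall hr hx)]
    exact hx

lemma rho_meas {n : ℕ} {F : (Fin n → ℝ) → (Fin n → ℝ)} {z : Fin n → ℝ} {R : ℝ}
    (hc : ContinuousOn F (closedBall z R)) (hinj : InjOn F (closedBall z R)) :
    Measurable (rho F z R) := by
  refine measurable_of_Iic fun r => ?_
  have hcm : ∀ s ≤ R, MeasurableSet (F '' closedBall z s) := fun s hs =>
    ((isCompact_closedBall z s).image_of_continuousOn (hc.mono (closedBall_subset_closedBall hs))).measurableSet
  by_cases h1 : r ≤ R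
  · have : rho F z R ⁻¹' Iic r = F '' closedBall z r := by
      ext y; exact rho_le_iff hinj h1 y
    rw [this]; exact hcm r h1
  · have hin : ∀ y ∈ F '' closedBall z R, rho F z R y ≤ R := fun y hy => (rho_le_iff hinj le_rfl y).2 hy
    by_cases h2 : r < R + 1
    · have : rho F z R ⁻¹' Iic r = F '' closedBall z R := by
        ext y
        constructor
        · intro h
          by_contra hy
          rw [mem_preimage, mem_Iic, rho, if_neg hy] at h; linarith
        · intro hy; exact (hin y hy).trans (by linarith)
      rw [this]; exact hcm R le_rfl
    · have : rho F z R ⁻¹' Iic r = univ := by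
        refine eq_univ_of_forall fun y => ?_
        by_cases hy : y ∈ F '' closedBall z R
        · exact (hin y hy).trans (by linarith)
        · rw [mem_preimage, mem_Iic, rho, if_neg hy]; linarith
      rw [this]; exact MeasurableSet.univ

open MeasureTheory Metric Set Filter
open scoped ENNReal NNReal Topology RealInnerProductSpace Classical


structure Full (m : ℕ) (c0 : ℝ≥0) (p : ℝ) (Ω : Set (Fin (m+1) → ℝ)) (F : (Fin (m+1) → ℝ) → (Fin (m+1) → ℝ))
    (G : (Fin (m+1) → ℝ) → (Fin (m+1) → ℝ) →L[ℝ] (Fin (m+1) → ℝ))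
    (g h : (Fin (m+1) → ℝ) → ℝ≥0∞) (b : ℝ≥0 → ℝ≥0∞) (k : (Fin (m+1) → ℝ) → ℝ≥0∞) : Prop where
  S : Setup m c0 Ω F G g h b
  hFm : Measurable F
  hinj : InjOn F Ω
  hopen : ∀ U ⊆ Ω, IsOpen U → IsOpen (F '' U)
  hk : AEMeasurable k (volume.restrict Ω)
  hgk : ∀ᵐ x, x ∈ Ω → g x ^ m ≤ k x ^ ((p - m) / p) * ENNReal.ofReal |(G x).det| ^ ((m:ℝ) / p)

lemma holder_jac {m : ℕ} {c0 : ℝ≥0} {p : ℝ} {Ω F G g h b k} (T : Full m c0 p Ω F G g h b k)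
    (hp : (m:ℝ) + 1 < p) {z : Fin (m+1) → ℝ} {r0 : ℝ} (hz : closedBall z r0 ⊆ Ω)
    {A : Set (Fin (m+1) → ℝ)} (hA : MeasurableSet A) (hAz : A ⊆ ball z r0)
    {W : (Fin (m+1) → ℝ) → ℝ≥0∞} (hW : Measurable W) :
    ∫⁻ x in A, W (F x) * g x ^ m ≤ (∫⁻ x in A, k x) ^ ((p - m) / p) *
      (∫⁻ y in F '' A, W y ^ (p / m)) ^ ((m:ℝ) / p) := by
  have hm0 : (0:ℝ) < m := by exact_mod_cast (by have := T.S.hm; omega : 0 < m)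
  have hp0 : 0 < p := by linarith
  have hpm : 0 < p - m := by linarith
  have hAΩ : A ⊆ Ω := hAz.trans (ball_subset_closedBall.trans hz)
  set J : (Fin (m+1) → ℝ) → ℝ≥0∞ := fun x => ENNReal.ofReal |(G x).det| with hJ
  have hJm : Measurable J := by
    refine ENNReal.measurable_ofReal.comp ?_
    exact (continuous_abs.comp ContinuousLinearMap.continuous_det).measurable.comp T.S.hGm
  have hkA : AEMeasurable k (volume.restrict A) := T.hk.mono_measure (Measure.restrict_mono_set _ hAΩ)
  have hconj : (p / (p - m)).HolderConjugate (p / m) := by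
    rw [Real.holderConjugate_iff]
    refine ⟨by rw [one_lt_div hpm]; linarith, ?_⟩
    field_simp
    ring
  calc ∫⁻ x in A, W (F x) * g x ^ m
      ≤ ∫⁻ x in A, ((fun x => k x ^ ((p - m) / p)) * (fun x => W (F x) * J x ^ ((m:ℝ) / p))) x := by
        refine setLIntegral_mono_ae' hA ?_
        filter_upwards [T.hgk] with x hx hxA
        simp only [Pi.mul_apply]
        rw [mul_left_comm]
        exact mul_le_mul_right (hx (hAΩ hxA)) _
    _ ≤ _ := ENNReal.lintegral_mul_le_Lp_mul_Lq _ hconj (hkA.pow_const _)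
          (((hW.comp T.hFm).mul (hJm.pow_const _)).aemeasurable)
    _ ≤ _ := by
        rw [one_div_div, one_div_div]
        refine mul_le_mul' (le_of_eq ?_) (ENNReal.rpow_le_rpow ?_ (by positivity))
        · congr 1
          refine lintegral_congr fun x => ?_
          rw [← ENNReal.rpow_mul, show (p - m) / p * (p / (p - m)) = 1 by field_simp, ENNReal.rpow_one]
        · refine le_trans (le_of_eq ?_) (jac_bound T.S.hΩ T.S.hF T.hinj T.S.hGm T.S.hGi T.S.hw hz hA hAz
            (fun y => W y ^ (p / m)))
          refine lintegral_congr fun x => ?_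
          rw [ENNReal.mul_rpow_of_nonneg _ _ (by positivity), ← ENNReal.rpow_mul,
            show (m:ℝ) / p * (p / m) = 1 by field_simp, ENNReal.rpow_one, mul_comm]

lemma removeNth_lip {m : ℕ} (j : Fin (m+1)) :
    LipschitzWith 1 (fun x : Fin (m+1) → ℝ => (j.removeNth x : Fin m → ℝ)) := by
  refine LipschitzWith.of_dist_le_mul fun x y => ?_
  rw [NNReal.coe_one, one_mul, dist_pi_le_iff dist_nonneg]
  exact fun i => dist_le_pi_dist x y _

lemma volume_pi_le {m : ℕ} (S : Set (Fin m → ℝ)) : volume S ≤ ediam S ^ m := by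
  simpa using Real.volume_pi_le_diam_pow S

lemma vol_image_pos {m : ℕ} {c0 : ℝ≥0} {p : ℝ} {Ω F G g h b k} (T : Full m c0 p Ω F G g h b k)
    {z : Fin (m+1) → ℝ} {r : ℝ} (hr : 0 < r) (hz : closedBall z r ⊆ Ω) :
    volume (F '' closedBall z r) ≠ 0 := by
  have h1 := T.hopen (ball z r) (ball_subset_closedBall.trans hz) isOpen_ball
  have h2 : 0 < volume (F '' ball z r) := h1.measure_pos volume ((nonempty_ball.2 hr).image F)
  exact (h2.trans_le (measure_mono (image_mono ball_subset_closedBall))).ne'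

lemma compact_image {m : ℕ} {c0 : ℝ≥0} {p : ℝ} {Ω F G g h b k} (T : Full m c0 p Ω F G g h b k)
    {z : Fin (m+1) → ℝ} {r : ℝ} (hz : closedBall z r ⊆ Ω) :
    IsCompact (F '' closedBall z r) :=
  (isCompact_closedBall z r).image_of_continuousOn (T.S.hF.mono hz)

lemma sphV {m : ℕ} {c0 : ℝ≥0} {p : ℝ} {Ω F G g h b k} (T : Full m c0 p Ω F G g h b k)
    {z : Fin (m+1) → ℝ} {R : ℝ} (hR : 0 < R) (hz : closedBall z (3 * R) ⊆ Ω) :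
    ∀ᵐ r ∂(volume.restrict (Icc R (2 * R))), ∀ c : ℝ≥0∞,
      c * volume (F '' closedBall z r) ^ ((m:ℝ) / (m+1)) ≤ (m+1) * Cs m c0 * sph z r (fun x => c * g x ^ m) := by
  have h1 : ∀ j : Fin (m+1), _ := fun j =>
    sph_meas T.S T.hFm hR hz (volume : Measure (Fin m → ℝ)) volume_pi_le (removeNth_lip j)
  filter_upwards [ae_all_iff.2 h1, ae_restrict_mem measurableSet_Icc] with r hr hrR c
  have hzr : closedBall z r ⊆ Ω := (closedBall_subset_closedBall (by linarith [hrR.2])).trans hz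
  have hK := compact_image T hzr
  have hLW := loomis_whitney (k := m) (by have := T.S.hm; omega) hK.measurableSet
    (S := fun j => (fun x => j.removeNth x) '' (F '' closedBall z r))
    (fun j => (hK.image (removeNth_lip j).continuous).measurableSet)
    (fun x hx j => ⟨x, hx, rfl⟩)
  calc c * volume (F '' closedBall z r) ^ ((m:ℝ) / (m+1))
      ≤ c * ∑ j : Fin (m+1), volume ((fun x : Fin (m+1) → ℝ => (j.removeNth x : Fin m → ℝ)) '' (F '' closedBall z r)) := by gcongr
    _ ≤ ∑ j : Fin (m+1), Cs m c0 * sph z r (fun x => c * g x ^ m) := by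
        rw [Finset.mul_sum]
        refine Finset.sum_le_sum fun j _ => ?_
        refine le_trans ?_ (hr j (fun _ => c) measurable_const)
        rw [setLIntegral_const]
        refine mul_le_mul_right (measure_mono ?_) _
        rintro _ ⟨_, ⟨x, hx, rfl⟩, rfl⟩
        obtain ⟨x', hx', he⟩ := line_hits T.S.hF T.hopen hzr j hx
        refine ⟨x', hx', ?_⟩
        ext i
        exact he _ (Fin.succAbove_ne j i)
    _ = _ := by
        rw [Finset.sum_const, Finset.card_univ, Fintype.card_fin, nsmul_eq_mul]; push_cast; ring

lemma vol_lower {m : ℕ} (c0 : ℝ≥0) {p : ℝ} (hp : (m:ℝ) + 1 < p) : ∃ C : ℝ≥0∞, C ≠ ⊤ ∧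
    ∀ {Ω F G g h b k}, Full m c0 p Ω F G g h b k → ∀ {z : Fin (m+1) → ℝ} {R : ℝ}, 0 < R →
      closedBall z (3 * R) ⊆ Ω →
      ENNReal.ofReal R ≤ C * (∫⁻ x in closedBall z (2 * R), k x) ^ ((p - m) / p) *
        volume (F '' closedBall z R) ^ ((1 - p / (m+1)) * (m / p)) := by
  have hs : 1 < p / (m+1) := by rw [one_lt_div (by positivity)]; exact hp
  obtain ⟨C1, hC1, hdist⟩ := dist_high hs
  have hp0 : 0 < p := by have : (0:ℝ) ≤ m := by positivity
                         linarith
  refine ⟨(m+1) * Cs m c0 * (2 * (m+1)) * C1 ^ ((m:ℝ)/p), ?_, ?_⟩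
  · have := Cs_ne_top m c0
    have : C1 ^ ((m:ℝ)/p) ≠ ⊤ := ENNReal.rpow_ne_top_of_nonneg (by positivity) hC1
    finiteness
  intro Ω F G g h b k T z R hR hz
  have hm0 : (0:ℝ) < m := by exact_mod_cast (by have := T.S.hm; omega : 0 < m)
  have hz2 : closedBall z (2 * R) ⊆ Ω := (closedBall_subset_closedBall (by linarith)).trans hz
  have hinj2 : InjOn F (closedBall z (2 * R)) := T.hinj.mono hz2
  set ρ := rho F z (2 * R) with hρ
  have hρm : Measurable ρ := rho_meas (T.S.hF.mono hz2) hinj2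
  set μ := volume.restrict (F '' closedBall z (2 * R)) with hμ
  set A : (Fin (m+1) → ℝ) → ℝ≥0∞ := fun y => μ {y' | ρ y' ≤ ρ y} with hA
  have hAm : Measurable A := by
    have : Monotone fun r : ℝ => μ {y' | ρ y' ≤ r} := fun r r' hrr =>
      measure_mono fun y (hy : ρ y ≤ r) => hy.trans hrr
    exact this.measurable.comp hρm
  have hAV : ∀ x ∈ closedBall z (2 * R), A (F x) = volume (F '' closedBall z (dist x z)) := by
    intro x hx
    have hset : {y' | ρ y' ≤ ρ (F x)} = F '' closedBall z (dist x z) := by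
      ext y
      rw [mem_ofPred_eq, hρ, rho_apply hinj2 hx]
      exact rho_le_iff hinj2 hx y
    have hsub : closedBall z (dist x z) ⊆ closedBall z (2 * R) := closedBall_subset_closedBall hx
    simp only [hA, hset, hμ]
    rw [Measure.restrict_apply (compact_image T (hsub.trans hz2)).measurableSet,
      inter_eq_left.2 (image_mono hsub)]
  set W : (Fin (m+1) → ℝ) → ℝ≥0∞ := fun y => A y ^ (-((m:ℝ)/(m+1))) with hW
  have hWm : Measurable W := hAm.pow_const _
  have hstep : ENNReal.ofReal R ≤ (m+1) * Cs m c0 * (2 * (m+1) *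
      ∫⁻ x in closedBall z (2 * R) \ ball z R, W (F x) * g x ^ m) := by
    calc ENNReal.ofReal R = ∫⁻ r in Icc R (2 * R), 1 := by
          simp; congr 1; ring
      _ ≤ ∫⁻ r in Icc R (2 * R), (m+1) * Cs m c0 * sph z r (fun x => W (F x) * g x ^ m) := by
          refine lintegral_mono_ae ?_
          filter_upwards [sphV T hR hz, ae_restrict_mem measurableSet_Icc] with r hr hrR
          have hr0 : 0 < r := hR.trans_le hrR.1
          have hzr : closedBall z r ⊆ Ω := (closedBall_subset_closedBall (by linarith [hrR.2])).trans hz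
          set V := volume (F '' closedBall z r) with hV
          have hV0 : V ≠ 0 := vol_image_pos T hr0 hzr
          have hVt : V ≠ ⊤ := (compact_image T hzr).measure_lt_top.ne
          have h1 := hr (V ^ (-((m:ℝ)/(m+1))))
          rw [← ENNReal.rpow_add _ _ hV0 hVt, neg_add_cancel, ENNReal.rpow_zero] at h1
          refine h1.trans (mul_le_mul_right (sph_weight z hr0.le fun x hx => ?_) _)
          have hx2 : x ∈ closedBall z (2 * R) := by rw [mem_closedBall, hx]; exact hrR.2
          simp only [hW]
          rw [hAV x hx2, hx]
      _ = (m+1) * Cs m c0 * ∫⁻ r in Icc R (2 * R), sph z r (fun x => W (F x) * g x ^ m) := by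
          rw [lintegral_const_mul']
          have := Cs_ne_top m c0
          finiteness
      _ ≤ _ := mul_le_mul_right (sph_coarea z hR.le ((hWm.comp T.hFm).mul (T.S.hg.pow_const m))) _
  set B := closedBall z (2 * R) \ ball z R with hB
  have hBm : MeasurableSet B := measurableSet_closedBall.diff measurableSet_ball
  have hol := holder_jac T hp hz hBm (sdiff_subset.trans (closedBall_subset_ball (by linarith))) hWm
  set V := volume (F '' closedBall z R) with hV
  have hzR : closedBall z R ⊆ Ω := (closedBall_subset_closedBall (by linarith)).trans hz
  have hV0 : V ≠ 0 := vol_image_pos T hR hzR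
  have hVt : V ≠ ⊤ := (compact_image T hzR).measure_lt_top.ne
  have hlast : ∫⁻ y in F '' B, W y ^ (p / m) ≤ C1 * V ^ (1 - p / (m+1)) := by
    refine le_trans ?_ (hdist μ A hAm (fun τ => distr_le μ τ) V hV0 hVt)
    have hsub : F '' B ⊆ {y | V ≤ A y} := by
      rintro _ ⟨x, hx, rfl⟩
      rw [mem_ofPred_eq, hAV x hx.1]
      refine measure_mono (image_mono (closedBall_subset_closedBall ?_))
      simpa using hx.2
    calc ∫⁻ y in F '' B, W y ^ (p / m) = ∫⁻ y in F '' B, A y ^ (-(p / (m+1))) ∂μ := by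
          rw [hμ, Measure.restrict_restrict_of_subset (image_mono sdiff_subset)]
          refine lintegral_congr fun y => ?_
          simp only [hW]
          rw [← ENNReal.rpow_mul]
          congr 1
          field_simp
      _ ≤ _ := lintegral_mono_set hsub
  refine hstep.trans ?_
  calc (m+1) * Cs m c0 * (2 * (m+1) * ∫⁻ x in B, W (F x) * g x ^ m)
      ≤ (m+1) * Cs m c0 * (2 * (m+1) * ((∫⁻ x in closedBall z (2 * R), k x) ^ ((p - m) / p) *
          (C1 * V ^ (1 - p / (m+1))) ^ ((m:ℝ) / p))) := by
        gcongr
        refine hol.trans (mul_le_mul' (ENNReal.rpow_le_rpow (lintegral_mono_set sdiff_subset) ?_)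
          (ENNReal.rpow_le_rpow hlast (by positivity)))
        exact div_nonneg (by linarith) hp0.le
    _ = _ := by
        rw [ENNReal.mul_rpow_of_nonneg _ _ (by positivity), ← ENNReal.rpow_mul]; ring

open MeasureTheory Metric Set Filter
open scoped ENNReal NNReal Topology RealInnerProductSpace Classical

lemma prod_vol_le {k : ℕ} (S : Set (ℝ × (Fin k → ℝ))) :
    (volume : Measure (ℝ × (Fin k → ℝ))) S ≤ ediam S ^ (k+1) := by
  have hsub : S ⊆ (Prod.fst '' S) ×ˢ (Prod.snd '' S) := fun x hx => ⟨⟨x, hx, rfl⟩, ⟨x, hx, rfl⟩⟩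
  refine (measure_mono hsub).trans ?_
  rw [Measure.volume_eq_prod, Measure.prod_prod, pow_succ']
  refine mul_le_mul' ((Real.volume_le_diam _).trans ?_) ((volume_pi_le _).trans ?_)
  · simpa using (LipschitzWith.prod_fst (α := ℝ) (β := Fin k → ℝ)).ediam_image_le S
  · refine pow_le_pow_left' ?_ k
    simpa using (LipschitzWith.prod_snd (α := ℝ) (β := Fin k → ℝ)).ediam_image_le S

/-- projection onto coordinate `i` and the coordinates other than `i`, `i.succAbove j` -/
noncomputable def prj {k : ℕ} (i : Fin (k+2)) (j : Fin (k+1)) (y : Fin (k+2) → ℝ) : ℝ × (Fin k → ℝ) :=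
  (y i, j.removeNth (i.removeNth y))

lemma prj_lip {k : ℕ} (i : Fin (k+2)) (j : Fin (k+1)) : LipschitzWith 1 (prj i j) := by
  have h1 : LipschitzWith 1 (fun y : Fin (k+2) → ℝ => y i) := LipschitzWith.eval i
  have h2 := (removeNth_lip j).comp (removeNth_lip i)
  have := h1.prodMk h2
  rw [mul_one, max_self] at this
  exact this

lemma sphW {k : ℕ} (hk1 : 1 ≤ k) {c0 : ℝ≥0} {p : ℝ} {Ω F G g h b q} (T : Full (k+1) c0 p Ω F G g h b q)
    {z : Fin (k+2) → ℝ} {R : ℝ} (hR : 0 < R) (hz : closedBall z (3 * R) ⊆ Ω) (i : Fin (k+2)) :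
    ∀ᵐ r ∂(volume.restrict (Icc R (2 * R))), ∀ ω : ℝ → ℝ≥0∞, Measurable ω →
      ∫⁻ t, ω t * volume {y : Fin (k+1) → ℝ | i.insertNth t y ∈ F '' closedBall z r} ^ ((k:ℝ) / (k+1))
        ≤ (k+1) * Cs (k+1) c0 * sph z r (fun x => ω (F x i) * g x ^ (k+1)) := by
  have h1 : ∀ j : Fin (k+1), _ := fun j =>
    sph_meas T.S T.hFm hR hz (volume : Measure (ℝ × (Fin k → ℝ))) prod_vol_le (prj_lip i j)
  filter_upwards [ae_all_iff.2 h1, ae_restrict_mem measurableSet_Icc] with r hr hrR ω hω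
  have hzr : closedBall z r ⊆ Ω := (closedBall_subset_closedBall (by linarith [hrR.2])).trans hz
  have hK := compact_image T hzr
  set SS : Fin (k+1) → Set (ℝ × (Fin k → ℝ)) := fun j => prj i j '' (F '' closedBall z r) with hSS
  have hSm : ∀ j, MeasurableSet (SS j) := fun j => (hK.image (prj_lip i j).continuous).measurableSet
  have hSt : ∀ j t, MeasurableSet (Prod.mk t ⁻¹' (SS j)) := fun j t => measurable_prodMk_left (hSm j)
  have hSv : ∀ j, Measurable fun t => volume (Prod.mk t ⁻¹' (SS j)) := fun j =>
    measurable_measure_prodMk_left (hSm j)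
  have hLW : ∀ t, volume {y : Fin (k+1) → ℝ | i.insertNth t y ∈ F '' closedBall z r} ^ ((k:ℝ) / (k+1)) ≤
      ∑ j, volume (Prod.mk t ⁻¹' (SS j)) := by
    intro t
    refine loomis_whitney hk1 (meas_ins1 i t hK.measurableSet) (hSt · t) ?_
    intro y hy j
    refine ⟨i.insertNth t y, hy, ?_⟩
    simp [prj]
  calc ∫⁻ t, ω t * volume {y : Fin (k+1) → ℝ | i.insertNth t y ∈ F '' closedBall z r} ^ ((k:ℝ) / (k+1))
      ≤ ∫⁻ t, ∑ j, ω t * volume (Prod.mk t ⁻¹' (SS j)) := by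
        refine lintegral_mono fun t => ?_
        rw [← Finset.mul_sum]
        exact mul_le_mul_right (hLW t) _
    _ = ∑ j, ∫⁻ t, ω t * volume (Prod.mk t ⁻¹' (SS j)) :=
        lintegral_finsetSum _ fun j _ => hω.mul (hSv j)
    _ ≤ ∑ j : Fin (k+1), Cs (k+1) c0 * sph z r (fun x => ω (F x i) * g x ^ (k+1)) := by
        refine Finset.sum_le_sum fun j _ => ?_
        refine le_trans ?_ (hr j (fun q => ω q.1) (hω.comp measurable_fst))
        have hsub : SS j ⊆ (fun x => prj i j (F x)) '' sphere z r := by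
          rintro _ ⟨_, ⟨x, hx, rfl⟩, rfl⟩
          obtain ⟨x', hx', he⟩ := line_hits T.S.hF T.hopen hzr (i.succAbove j) hx
          refine ⟨x', hx', ?_⟩
          refine Prod.ext (he _ (Fin.succAbove_ne i j).symm) ?_
          ext l
          refine he _ fun hc => ?_
          exact Fin.succAbove_ne j l (Fin.succAbove_right_injective hc)
        refine le_trans (le_of_eq ?_) (lintegral_mono_set hsub)
        rw [← lintegral_indicator (hSm j), Measure.volume_eq_prod,
          lintegral_prod _ (Measurable.aemeasurable (Measurable.indicator (hω.comp measurable_fst) (hSm j) :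
            Measurable ((SS j).indicator (fun q : ℝ × (Fin k → ℝ) => ω q.1))))]
        refine lintegral_congr fun t => ?_
        have : (fun y => (SS j).indicator (fun q => ω q.1) (t, y)) =
            (Prod.mk t ⁻¹' (SS j)).indicator (fun _ => ω t) := by
          ext y; simp only [indicator, mem_preimage]
        rw [this, lintegral_indicator (hSt j t), setLIntegral_const]
    _ = _ := by
        rw [Finset.sum_const, Finset.card_univ, Fintype.card_fin, nsmul_eq_mul]; push_cast; ring

lemma slice_pos {m : ℕ} {c0 : ℝ≥0} {p : ℝ} {Ω F G g h b q} (T : Full m c0 p Ω F G g h b q)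
    {z : Fin (m+1) → ℝ} {R r : ℝ} (hz : closedBall z r ⊆ Ω) (hRr : R ≤ r) (i : Fin (m+1))
    {x x' : Fin (m+1) → ℝ} (hx : x ∈ ball z R) (hx' : x' ∈ ball z R) {t : ℝ}
    (ht : t ∈ Ioo (F x i) (F x' i)) :
    volume {y : Fin m → ℝ | i.insertNth t y ∈ F '' closedBall z r} ≠ 0 := by
  have hb : ball z R ⊆ closedBall z r := ball_subset_closedBall.trans (closedBall_subset_closedBall hRr)
  have hc : ContinuousOn (fun x => F x i) (ball z R) :=
    (continuous_apply i).comp_continuousOn (T.S.hF.mono (hb.trans hz))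
  obtain ⟨w, hw, hwt⟩ := (convex_ball z R).isPreconnected.intermediate_value hx hx' hc (Ioo_subset_Icc_self ht)
  have ho : IsOpen {y : Fin m → ℝ | i.insertNth t y ∈ F '' ball z R} :=
    (T.hopen _ (hb.trans hz) isOpen_ball).preimage (cont_ins i t)
  have hne : {y : Fin m → ℝ | i.insertNth t y ∈ F '' ball z R}.Nonempty := by
    refine ⟨i.removeNth (F w), w, hw, ?_⟩
    simp only at hwt
    rw [← hwt, Fin.insertNth_self_removeNth]
  refine ((ho.measure_pos volume hne).trans_le (measure_mono ?_)).ne'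
  exact fun y hy => image_mono hb hy

lemma slice_fin {m : ℕ} {c0 : ℝ≥0} {p : ℝ} {Ω F G g h b q} (T : Full m c0 p Ω F G g h b q)
    {z : Fin (m+1) → ℝ} {r : ℝ} (hz : closedBall z r ⊆ Ω) (i : Fin (m+1)) (t : ℝ) :
    volume {y : Fin m → ℝ | i.insertNth t y ∈ F '' closedBall z r} ≠ ⊤ := by
  refine ne_top_of_le_ne_top ((compact_image T hz).image (removeNth_lip i).continuous).measure_lt_top.ne
    (measure_mono fun y hy => ⟨_, hy, ?_⟩)
  simp

lemma dist_upper {k : ℕ} (hk1 : 1 ≤ k) (c0 : ℝ≥0) {p : ℝ} (hp : ((k+1:ℕ):ℝ) + 1 < p)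
    (hp2 : p * k < (k+1)^2) : ∃ C : ℝ≥0∞, C ≠ ⊤ ∧
    ∀ {Ω F G g h b q}, Full (k+1) c0 p Ω F G g h b q → ∀ {z : Fin (k+2) → ℝ} {R : ℝ}, 0 < R →
      closedBall z (3 * R) ⊆ Ω → ∀ i, ∀ x ∈ ball z R, ∀ x' ∈ ball z R,
      ENNReal.ofReal (F x' i - F x i) ^ (1 / ((k:ℝ)+1)) * ENNReal.ofReal R ≤
        C * (∫⁻ x in closedBall z (2 * R), q x) ^ ((p - (k+1)) / p) *
        volume (F '' closedBall z (2 * R)) ^ ((1 - k * p / (k+1)^2) * ((k+1) / p)) := by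
  have hk0 : (0:ℝ) < k := by exact_mod_cast hk1
  have hp' : (k:ℝ) + 1 + 1 < p := by push_cast at hp; exact hp
  have hp0 : 0 < p := by linarith
  set θ : ℝ := k * p / (k+1)^2 with hθ
  have hθ0 : 0 < θ := by positivity
  have hθ1 : θ < 1 := by rw [hθ, div_lt_one (by positivity)]; linarith
  set σ : ℝ := k / (k+1) with hσ
  obtain ⟨C1, hC1, hdist⟩ := dist_low hθ0 hθ1
  refine ⟨(k+1) * Cs (k+1) c0 * (2 * ((k+1:ℕ)+1)) * C1 ^ (((k:ℝ)+1)/p), ?_, ?_⟩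
  · have := Cs_ne_top (k+1) c0
    have : C1 ^ (((k:ℝ)+1)/p) ≠ ⊤ := ENNReal.rpow_ne_top_of_nonneg (by positivity) hC1
    finiteness
  intro Ω F G g h b q T z R hR hz i x hx x' hx'
  have hz2 : closedBall z (2 * R) ⊆ Ω := (closedBall_subset_closedBall (by linarith)).trans hz
  have hinj2 : InjOn F (closedBall z (2 * R)) := T.hinj.mono hz2
  rcases le_or_gt (F x' i) (F x i) with hle | hlt
  · rw [ENNReal.ofReal_of_nonpos (by linarith), ENNReal.zero_rpow_of_pos (by positivity), zero_mul]
    exact zero_le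
  set d := ENNReal.ofReal (F x' i - F x i) with hd
  have hd0 : d ≠ 0 := by rw [hd]; simp; exact hlt
  have hdt : d ≠ ⊤ := ENNReal.ofReal_ne_top
  set T0 : Set ℝ := Ioo (F x i) (F x' i) with hT0
  have hT0m : MeasurableSet T0 := measurableSet_Ioo
  have hT0v : volume T0 = d := Real.volume_Ioo
  set ρ := rho F z (2 * R) with hρ
  have hρm : Measurable ρ := rho_meas (T.S.hF.mono hz2) hinj2
  set a : ℝ → ℝ → ℝ≥0∞ := fun r t => volume {y : Fin (k+1) → ℝ | ρ (i.insertNth t y) ≤ r} with ha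
  have ham : Measurable fun w : ℝ × ℝ => a w.1 w.2 := by
    have hs : MeasurableSet {w : (ℝ × ℝ) × (Fin (k+1) → ℝ) | ρ (i.insertNth w.1.2 w.2) ≤ w.1.1} :=
      measurableSet_le (hρm.comp ((meas_ins i).comp ((measurable_snd.comp measurable_fst).prodMk measurable_snd)))
        (measurable_fst.comp measurable_fst)
    exact measurable_measure_prodMk_left hs
  have hat : ∀ r, Measurable (a r) := fun r => ham.comp (measurable_const.prodMk measurable_id)
  have hae : ∀ r ≤ 2 * R, ∀ t, a r t = volume {y : Fin (k+1) → ℝ | i.insertNth t y ∈ F '' closedBall z r} := by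
    intro r hr t
    simp only [ha]
    congr 1
    ext y
    exact rho_le_iff hinj2 hr _
  have ha0 : ∀ r, R ≤ r → r ≤ 2 * R → ∀ t ∈ T0, a r t ≠ 0 := by
    intro r h1 h2 t ht
    rw [hae r h2]
    exact slice_pos T ((closedBall_subset_closedBall h2).trans hz2) h1 i hx hx' ht
  have haT : ∀ r ≤ 2 * R, ∀ t, a r t ≠ ⊤ := by
    intro r h2 t
    rw [hae r h2]
    exact slice_fin T ((closedBall_subset_closedBall h2).trans hz2) i t
  set W : (Fin (k+2) → ℝ) → ℝ≥0∞ := fun y => T0.indicator 1 (y i) * a (ρ y) (y i) ^ (-σ) with hW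
  have hWm : Measurable W :=
    ((measurable_one.indicator hT0m).comp (measurable_pi_apply i)).mul
      ((ham.comp (hρm.prodMk (measurable_pi_apply i))).pow_const _)
  have hstep : d * ENNReal.ofReal R ≤ (k+1) * Cs (k+1) c0 * (2 * ((k+1:ℕ)+1) *
      ∫⁻ x in closedBall z (2 * R) \ ball z R, W (F x) * g x ^ (k+1)) := by
    calc d * ENNReal.ofReal R = ∫⁻ r in Icc R (2 * R), d := by
          simp; congr 2; ring
      _ ≤ ∫⁻ r in Icc R (2 * R), (k+1) * Cs (k+1) c0 * sph z r (fun x => W (F x) * g x ^ (k+1)) := by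
          refine lintegral_mono_ae ?_
          filter_upwards [sphW hk1 T hR hz i, ae_restrict_mem measurableSet_Icc] with r hr hrR
          have hr0 : 0 < r := hR.trans_le hrR.1
          have h1 := hr (fun t => T0.indicator 1 t * a r t ^ (-σ))
            ((measurable_one.indicator hT0m).mul ((hat r).pow_const _))
          have h2 : d ≤ ∫⁻ t, T0.indicator 1 t * a r t ^ (-σ) *
              volume {y : Fin (k+1) → ℝ | i.insertNth t y ∈ F '' closedBall z r} ^ ((k:ℝ) / (k+1)) := by
            rw [← hT0v, ← lintegral_indicator_one hT0m]
            refine lintegral_mono fun t => ?_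
            by_cases ht : t ∈ T0
            · rw [← hae r hrR.2, indicator_of_mem ht, Pi.one_apply, one_mul,
                ← ENNReal.rpow_add _ _ (ha0 r hrR.1 hrR.2 t ht) (haT r hrR.2 t), ← hσ, neg_add_cancel,
                ENNReal.rpow_zero]
            · rw [indicator_of_notMem ht]; exact zero_le
          refine (h2.trans h1).trans (mul_le_mul_right (sph_weight z hr0.le fun x hx => ?_) _)
          have hx2 : x ∈ closedBall z (2 * R) := by rw [mem_closedBall, hx]; exact hrR.2
          simp only [hW]
          rw [hρ, rho_apply hinj2 hx2, hx]
      _ = (k+1) * Cs (k+1) c0 * ∫⁻ r in Icc R (2 * R), sph z r (fun x => W (F x) * g x ^ (k+1)) := by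
          rw [lintegral_const_mul']
          have := Cs_ne_top (k+1) c0
          finiteness
      _ ≤ _ := mul_le_mul_right (sph_coarea z hR.le ((hWm.comp T.hFm).mul (T.S.hg.pow_const (k+1)))) _
  set B := closedBall z (2 * R) \ ball z R with hB
  have hBm : MeasurableSet B := measurableSet_closedBall.diff measurableSet_ball
  have hol := holder_jac T hp hz hBm (sdiff_subset.trans (closedBall_subset_ball (by linarith))) hWm
  push_cast at hol
  set V := volume (F '' closedBall z (2 * R)) with hV
  have hKm : MeasurableSet (F '' closedBall z (2 * R)) := (compact_image T hz2).measurableSet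
  have haV : ∫⁻ t in T0, a (2 * R) t ≤ V := by
    calc ∫⁻ t in T0, a (2 * R) t ≤ ∫⁻ t, a (2 * R) t := setLIntegral_le_lintegral _ _
      _ = ∫⁻ y, (F '' closedBall z (2 * R)).indicator 1 y := by
          rw [fubini_ins i (measurable_one.indicator hKm)]
          refine lintegral_congr fun t => ?_
          rw [hae _ le_rfl]
          exact (lintegral_indicator_one (meas_ins1 i t hKm)).symm
      _ = V := lintegral_indicator_one hKm
  have hlast : ∫⁻ y in F '' B, W y ^ (p / (k+1)) ≤ C1 * (V ^ (1 - θ) * d ^ θ) := by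
    calc ∫⁻ y in F '' B, W y ^ (p / (k+1)) ≤ ∫⁻ y in F '' closedBall z (2 * R), W y ^ (p / (k+1)) :=
          lintegral_mono_set (image_mono sdiff_subset)
      _ = ∫⁻ t, ∫⁻ y : Fin (k+1) → ℝ, (F '' closedBall z (2 * R)).indicator (fun y => W y ^ (p / (k+1)))
            (i.insertNth t y) := by
          rw [← lintegral_indicator hKm, fubini_ins i ((hWm.pow_const _).indicator hKm)]
      _ ≤ ∫⁻ t, T0.indicator (fun t => C1 * a (2 * R) t ^ (1 - θ)) t := by
          refine lintegral_mono fun t => ?_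
          by_cases ht : t ∈ T0
          · rw [indicator_of_mem ht]
            have hAm : Measurable fun y : Fin (k+1) → ℝ => a (ρ (i.insertNth t y)) t :=
              ham.comp ((hρm.comp (meas_ins1 i t)).prodMk measurable_const)
            have h3 := hdist volume (fun y : Fin (k+1) → ℝ => a (ρ (i.insertNth t y)) t) hAm
              (fun τ => distr_le (ρ := fun y : Fin (k+1) → ℝ => ρ (i.insertNth t y)) volume τ)
              (a (2 * R) t) (ha0 _ (by linarith) le_rfl t ht) (haT _ le_rfl t)
            refine le_trans ?_ h3
            rw [← lintegral_indicator (measurableSet_le hAm measurable_const)]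
            refine lintegral_mono fun y => ?_
            by_cases hy : (i.insertNth t y : Fin (k+2) → ℝ) ∈ F '' closedBall z (2 * R)
            · have hρy : ρ (i.insertNth t y) ≤ 2 * R := (rho_le_iff hinj2 le_rfl _).2 hy
              have hmem : y ∈ {y : Fin (k+1) → ℝ | a (ρ (i.insertNth t y)) t ≤ a (2 * R) t} :=
                measure_mono fun w (hw : _ ≤ _) => hw.trans hρy
              rw [indicator_of_mem hy, indicator_of_mem hmem]
              simp only [hW]
              rw [Fin.insertNth_apply_same, indicator_of_mem ht, Pi.one_apply, one_mul, ← ENNReal.rpow_mul]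
              refine le_of_eq ?_
              congr 1
              rw [hσ, hθ]; field_simp
            · rw [indicator_of_notMem hy]; exact zero_le
          · rw [indicator_of_notMem ht]
            refine le_of_eq ((lintegral_congr fun y => ?_).trans (lintegral_zero (μ := volume)))
            simp only [indicator, Pi.zero_apply, hW, Fin.insertNth_apply_same, ht, if_false, zero_mul]
            rw [ENNReal.zero_rpow_of_pos (by positivity)]
            simp
      _ = C1 * ∫⁻ t in T0, a (2 * R) t ^ (1 - θ) := by
          rw [lintegral_indicator hT0m, lintegral_const_mul' _ _ hC1]
      _ ≤ _ := by
          refine mul_le_mul_right ?_ _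
          have hconj : (1 / (1 - θ)).HolderConjugate (1 / θ) := by
            rw [Real.holderConjugate_iff]
            refine ⟨by rw [lt_div_iff₀ (by linarith)]; linarith, ?_⟩
            simp
          have h4 := ENNReal.lintegral_mul_le_Lp_mul_Lq (volume.restrict T0) hconj
            ((hat (2 * R)).pow_const (1 - θ)).aemeasurable (measurable_const (a := (1:ℝ≥0∞))).aemeasurable
          simp only [Pi.mul_apply, mul_one, ENNReal.one_rpow, one_div_one_div, lintegral_const, one_mul,
            Measure.restrict_apply MeasurableSet.univ, univ_inter, hT0v, ← ENNReal.rpow_mul] at h4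
          refine h4.trans (mul_le_mul_left (ENNReal.rpow_le_rpow ?_ (by linarith)) _)
          refine le_trans (le_of_eq ?_) haV
          refine lintegral_congr fun t => ?_
          rw [mul_one_div_cancel (by linarith), ENNReal.rpow_one]
  set I := (∫⁻ x in closedBall z (2 * R), q x) with hI
  have hfin : d * ENNReal.ofReal R ≤ (k+1) * Cs (k+1) c0 * (2 * ((k+1:ℕ)+1) * (I ^ ((p - (k+1)) / p) *
          (C1 * (V ^ (1 - θ) * d ^ θ)) ^ (((k:ℝ)+1) / p))) := by
    refine hstep.trans ?_
    gcongr
    refine hol.trans (mul_le_mul' (ENNReal.rpow_le_rpow (lintegral_mono_set sdiff_subset) ?_)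
          (ENNReal.rpow_le_rpow hlast (by positivity)))
    exact div_nonneg (by linarith) hp0.le
  have hexp : θ * (((k:ℝ)+1) / p) = σ := by rw [hθ, hσ]; field_simp
  rw [ENNReal.mul_rpow_of_nonneg _ _ (by positivity), ENNReal.mul_rpow_of_nonneg _ _ (by positivity),
    ← ENNReal.rpow_mul, ← ENNReal.rpow_mul, hexp] at hfin
  have hσ1 : 1 / ((k:ℝ)+1) = 1 + -σ := by rw [hσ]; field_simp; ring
  rw [hσ1, ENNReal.rpow_add _ _ hd0 hdt, ENNReal.rpow_one]
  calc d * d ^ (-σ) * ENNReal.ofReal R = d ^ (-σ) * (d * ENNReal.ofReal R) := by ring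
    _ ≤ d ^ (-σ) * _ := mul_le_mul_right hfin _
    _ = (d ^ (-σ) * d ^ σ) * ((k+1) * Cs (k+1) c0 * (2 * ((k+1:ℕ)+1)) * C1 ^ (((k:ℝ)+1)/p) *
          I ^ ((p - (k+1)) / p) * V ^ ((1 - θ) * ((k+1) / p))) := by ring
    _ = _ := by rw [← ENNReal.rpow_add _ _ hd0 hdt, neg_add_cancel, ENNReal.rpow_zero, one_mul]

open MeasureTheory Metric Set Filter
open scoped ENNReal NNReal Topology RealInnerProductSpace Classical

lemma ennreal_comb {m β γ : ℝ} (hm : 0 < m) (hβ : 0 ≤ β) (hγ : 0 < γ) {d r A B V C C' : ℝ≥0∞}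
    (hr0 : r ≠ 0) (hrt : r ≠ ⊤) (hV0 : V ≠ 0) (hVt : V ≠ ⊤)
    (h1 : d ^ (1 / m) * r ≤ C * A * V ^ β) (h2 : r ≤ C' * B * V ^ (-γ)) :
    d ≤ (C * C' ^ (β / γ)) ^ m * B ^ (β / γ * m) * A ^ m * r ^ (-(m * (1 + β / γ))) := by
  have hVg0 : V ^ γ ≠ 0 := by simp [hV0, hVt]
  have hVgt : V ^ γ ≠ ⊤ := ENNReal.rpow_ne_top_of_nonneg hγ.le hVt
  have hs : 0 ≤ β / γ := by positivity
  have h3 : V ^ γ ≤ C' * B * r⁻¹ := by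
    rw [ENNReal.rpow_neg] at h2
    have h4 : V ^ γ * r ≤ C' * B := by
      calc V ^ γ * r ≤ V ^ γ * (C' * B * (V ^ γ)⁻¹) := mul_le_mul_right h2 _
        _ = C' * B * (V ^ γ * (V ^ γ)⁻¹) := by ring
        _ = C' * B := by rw [ENNReal.mul_inv_cancel hVg0 hVgt, mul_one]
    calc V ^ γ = V ^ γ * r * r⁻¹ := by rw [mul_assoc, ENNReal.mul_inv_cancel hr0 hrt, mul_one]
      _ ≤ _ := mul_le_mul_left h4 _
  have h5 : V ^ β ≤ C' ^ (β / γ) * B ^ (β / γ) * r ^ (-(β / γ)) := by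
    calc V ^ β = (V ^ γ) ^ (β / γ) := by rw [← ENNReal.rpow_mul]; congr 1; field_simp
      _ ≤ (C' * B * r⁻¹) ^ (β / γ) := ENNReal.rpow_le_rpow h3 hs
      _ = _ := by rw [ENNReal.mul_rpow_of_nonneg _ _ hs, ENNReal.mul_rpow_of_nonneg _ _ hs, ENNReal.inv_rpow,
                    ENNReal.rpow_neg]
  have h6 : d ^ (1 / m) ≤ C * A * (C' ^ (β / γ) * B ^ (β / γ) * r ^ (-(β / γ))) * r ^ (-1:ℝ) := by
    calc d ^ (1 / m) = d ^ (1 / m) * r * r⁻¹ := by rw [mul_assoc, ENNReal.mul_inv_cancel hr0 hrt, mul_one]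
      _ ≤ C * A * V ^ β * r⁻¹ := mul_le_mul_left h1 _
      _ ≤ _ := by rw [ENNReal.rpow_neg_one]; gcongr
  calc d = (d ^ (1 / m)) ^ m := by rw [← ENNReal.rpow_mul, one_div_mul_cancel hm.ne', ENNReal.rpow_one]
    _ ≤ (C * A * (C' ^ (β / γ) * B ^ (β / γ) * r ^ (-(β / γ))) * r ^ (-1:ℝ)) ^ m := ENNReal.rpow_le_rpow h6 hm.le
    _ = ((C * C' ^ (β / γ)) * B ^ (β / γ) * A * r ^ (-(1 + β / γ))) ^ m := by
        congr 1
        rw [neg_add, ENNReal.rpow_add _ _ hr0 hrt]; ring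
    _ = _ := by
        rw [ENNReal.mul_rpow_of_nonneg _ _ hm.le, ENNReal.mul_rpow_of_nonneg _ _ hm.le,
          ENNReal.mul_rpow_of_nonneg (C * C' ^ (β / γ)) _ hm.le, ← ENNReal.rpow_mul, ← ENNReal.rpow_mul]
        congr 2
        ring

lemma comb {k : ℕ} (hk1 : 1 ≤ k) (c0 : ℝ≥0) {p : ℝ} (hp : ((k+1:ℕ):ℝ) + 1 < p)
    (hp2 : p * k < (k+1)^2) {j1 j2 s : ℝ} (hs : s = p / ((k+1) * (p - (k+2))))
    (hj1 : j1 = (s - (k+1)) * ((p - (k+1)) / p)) (hj2 : j2 = (k+1) * ((p - (k+1)) / p)) :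
    ∃ C : ℝ≥0∞, C ≠ ⊤ ∧
    ∀ {Ω F G g h b q}, Full (k+1) c0 p Ω F G g h b q → ∀ {z : Fin (k+2) → ℝ} {R : ℝ}, 0 < R →
      closedBall z (6 * R) ⊆ Ω → ∀ i, ∀ x ∈ ball z R, ∀ x' ∈ ball z R,
      ENNReal.ofReal (F x' i - F x i) ≤
        C * (∫⁻ x in closedBall z (4 * R), q x) ^ j1 * (∫⁻ x in closedBall z (2 * R), q x) ^ j2 *
        ENNReal.ofReal R ^ (-s) := by
  have hk0 : (0:ℝ) < k := by exact_mod_cast hk1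
  have hp' : (k:ℝ) + 2 < p := by push_cast at hp; linarith
  have hp0 : 0 < p := by linarith
  have hpn : 0 < p - (k+2) := by linarith
  obtain ⟨C, hC, H⟩ := dist_upper hk1 c0 hp hp2
  obtain ⟨C', hC', H'⟩ := vol_lower c0 hp
  set β : ℝ := (1 - k * p / (k+1)^2) * ((k+1) / p) with hβ
  set γ : ℝ := (p / (k+2) - 1) * ((k+1) / p) with hγ
  have hβ0 : 0 ≤ β := by
    refine mul_nonneg ?_ (by positivity)
    rw [sub_nonneg, div_le_one (by positivity)]; linarith
  have hγ0 : 0 < γ := by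
    refine mul_pos ?_ (by positivity)
    rw [sub_pos, one_lt_div (by positivity)]; linarith
  have hk' : (0:ℝ) < k + 1 := by positivity
  have hsE : s = (k+1) * (1 + β / γ) := by
    rw [hs, hβ, hγ]
    have : p / ((k:ℝ)+2) - 1 = (p - (k+2)) / (k+2) := by field_simp
    rw [this]
    field_simp
    ring
  refine ⟨(C * C' ^ (β / γ)) ^ ((k:ℝ)+1), ?_, ?_⟩
  · have : C' ^ (β / γ) ≠ ⊤ := ENNReal.rpow_ne_top_of_nonneg (by positivity) hC'
    exact ENNReal.rpow_ne_top_of_nonneg hk'.le (by finiteness)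
  intro Ω F G g h b q T z R hR hz i x hx x' hx'
  have h1 := H T hR ((closedBall_subset_closedBall (by linarith)).trans hz) i x hx x' hx'
  have h2 := H' T (z := z) (R := 2 * R) (by positivity) (by rw [← mul_assoc]; norm_num; exact hz)
  have hz2 : closedBall z (2 * R) ⊆ Ω := (closedBall_subset_closedBall (by linarith)).trans hz
  have h2' : ENNReal.ofReal R ≤ C' * (∫⁻ x in closedBall z (4 * R), q x) ^ ((p - (k+1)) / p) *
      volume (F '' closedBall z (2 * R)) ^ (-γ) := by
    refine (ENNReal.ofReal_le_ofReal (by linarith : R ≤ 2 * R)).trans (h2.trans (le_of_eq ?_))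
    have e1 : (2:ℝ) * (2 * R) = 4 * R := by ring
    have e2 : (1 - p / (((k+1:ℕ):ℝ)+1)) * (((k+1:ℕ):ℝ) / p) = -γ := by rw [hγ]; push_cast; ring
    rw [e1, e2]
    push_cast
    rfl
  have h3 := ennreal_comb hk' hβ0 hγ0 (by simpa using hR) ENNReal.ofReal_ne_top
    (vol_image_pos T (by positivity) hz2) (compact_image T hz2).measure_lt_top.ne h1 h2'
  refine h3.trans (le_of_eq ?_)
  rw [← ENNReal.rpow_mul, ← ENNReal.rpow_mul, ← hsE]
  congr 3
  · congr 1
    rw [hj1, hsE]; ring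
  · rw [hj2]; ring

open MeasureTheory Metric Set Filter
open scoped ENNReal NNReal Topology RealInnerProductSpace Classical

lemma calderon_term {m : ℕ} (hm : 2 ≤ m) {φ : ℝ → ℝ} (hφ : NondecPos φ) {T : ℝ} (hT : 0 < T) :
    (ENNReal.ofReal T ^ (m:ℝ) / ENNReal.ofReal (φ T)) ^ (1 / ((m:ℝ) - 1)) ≤
      ENNReal.ofReal (2 ^ ((m:ℝ) * (1 / ((m:ℝ) - 1)))) *
        ∫⁻ s in Ioc (T / 2) T, ENNReal.ofReal ((s / φ s) ^ (1 / ((m:ℝ) - 1))) := by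
  have hm1 : (0:ℝ) < (m:ℝ) - 1 := by
    have : (2:ℝ) ≤ m := by exact_mod_cast hm
    linarith
  set a : ℝ := 1 / ((m:ℝ) - 1) with ha
  have ha0 : 0 < a := by positivity
  have hf : 0 < φ T := hφ.2 T hT
  have hlow : ENNReal.ofReal ((T / 2 / φ T) ^ a) * ENNReal.ofReal (T / 2) ≤
      ∫⁻ s in Ioc (T / 2) T, ENNReal.ofReal ((s / φ s) ^ a) := by
    calc ENNReal.ofReal ((T / 2 / φ T) ^ a) * ENNReal.ofReal (T / 2)
        = ∫⁻ s in Ioc (T / 2) T, ENNReal.ofReal ((T / 2 / φ T) ^ a) := by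
          rw [setLIntegral_const, Real.volume_Ioc]; congr 2; ring
      _ ≤ _ := by
          refine setLIntegral_mono' measurableSet_Ioc fun s hs => ?_
          have hs0 : 0 < s := lt_trans (by positivity) hs.1
          refine ENNReal.ofReal_le_ofReal (Real.rpow_le_rpow (by positivity) ?_ ha0.le)
          exact div_le_div₀ hs0.le hs.1.le (hφ.2 s hs0) (hφ.1 s T hs0 hs.2)
  refine le_trans (le_of_eq ?_) (mul_le_mul_right hlow _)
  rw [ENNReal.ofReal_rpow_of_pos hT, ← ENNReal.ofReal_div_of_pos hf,
    ENNReal.ofReal_rpow_of_pos (by positivity), ← ENNReal.ofReal_mul (by positivity),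
    ← ENNReal.ofReal_mul (by positivity)]
  congr 1
  have h1 : T / 2 = ((T / 2) ^ ((m:ℝ) - 1)) ^ a := by
    rw [← Real.rpow_mul (by positivity), ha, mul_one_div_cancel hm1.ne', Real.rpow_one]
  have h2 : (2:ℝ) ^ ((m:ℝ) * a) = ((2:ℝ) ^ (m:ℝ)) ^ a := by rw [← Real.rpow_mul (by norm_num)]
  have h3 : (T / 2) ^ (m:ℝ) = (T / 2) * (T / 2) ^ ((m:ℝ) - 1) := by
    rw [Real.rpow_sub_one (by positivity)]; field_simp
  calc (T ^ (m:ℝ) / φ T) ^ a = ((2:ℝ) ^ (m:ℝ) * ((T / 2 / φ T) * (T / 2) ^ ((m:ℝ) - 1))) ^ a := by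
        congr 1
        have : T ^ (m:ℝ) = 2 ^ (m:ℝ) * (T / 2) ^ (m:ℝ) := by
          rw [← Real.mul_rpow (by norm_num) (by positivity)]; congr 1; ring
        rw [this, h3]; ring
    _ = _ := by
        rw [Real.mul_rpow (by positivity) (by positivity), Real.mul_rpow (by positivity) (by positivity), ← h2, ← h1]

lemma calderon_sum {m : ℕ} (hm : 2 ≤ m) {φ : ℝ → ℝ} (hφ : NondecPos φ) (hc : CalderonCond (m+1) φ)
    (t : ℝ≥0) (ht : 0 < t) :
    ∑' k : ℕ, (((t:ℝ≥0∞) * 2 ^ k) ^ (m:ℝ) / ENNReal.ofReal (φ ((t * 2 ^ k : ℝ≥0) : ℝ))) ^ (1 / ((m:ℝ) - 1)) ≠ ⊤ := by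
  obtain ⟨t₀, ht₀, hint⟩ := hc
  have hm1 : (0:ℝ) < (m:ℝ) - 1 := by
    have : (2:ℝ) ≤ m := by exact_mod_cast hm
    linarith
  have he : ((m+1:ℕ):ℝ) - 2 = (m:ℝ) - 1 := by push_cast; ring
  rw [he] at hint
  have ht' : (0:ℝ) < t := ht
  obtain ⟨N, hN⟩ : ∃ N : ℕ, t₀ ≤ t * 2 ^ N := by
    obtain ⟨N, hN⟩ := pow_unbounded_of_one_lt (t₀ / t) (by norm_num : (1:ℝ) < 2)
    refine ⟨N, ?_⟩
    rw [div_lt_iff₀ ht'] at hN; linarith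
  set T : ℕ → ℝ := fun k => t * 2 ^ k with hT
  have hTp : ∀ k, 0 < T k := fun k => by positivity
  set u : ℕ → ℝ≥0∞ := fun k => (((t:ℝ≥0∞) * 2 ^ k) ^ (m:ℝ) / ENNReal.ofReal (φ ((t * 2 ^ k : ℝ≥0) : ℝ))) ^ (1 / ((m:ℝ) - 1)) with hu
  have huT : ∀ k, u k = (ENNReal.ofReal (T k) ^ (m:ℝ) / ENNReal.ofReal (φ (T k))) ^ (1 / ((m:ℝ) - 1)) := by
    intro k
    have e1 : ENNReal.ofReal (T k) = (t:ℝ≥0∞) * 2 ^ k := by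
      rw [hT]; simp only; rw [ENNReal.ofReal_mul (NNReal.coe_nonneg t), ENNReal.ofReal_pow (by norm_num)]; simp
    have e2 : ((t * 2 ^ k : ℝ≥0) : ℝ) = T k := by simp [hT]
    simp only [hu]
    rw [e1, e2]
  have hfin : ∀ k, u k ≠ ⊤ := by
    intro k
    rw [huT]
    refine ENNReal.rpow_ne_top_of_nonneg (by positivity) (ENNReal.div_ne_top ?_ ?_)
    · exact ENNReal.rpow_ne_top_of_nonneg (by positivity) ENNReal.ofReal_ne_top
    · simpa using hφ.2 _ (hTp k)
  rw [← Summable.sum_add_tsum_nat_add' (k := N + 1) ENNReal.summable]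
  refine ENNReal.add_ne_top.2 ⟨ENNReal.sum_ne_top.2 fun k _ => hfin k, ?_⟩
  set c := ENNReal.ofReal (2 ^ ((m:ℝ) * (1 / ((m:ℝ) - 1)))) with hcdef
  have hTm : Monotone T := by
    refine monotone_nat_of_le_succ fun k => ?_
    simp only [hT, pow_succ]
    nlinarith [hTp k, (by positivity : (0:ℝ) < t * 2 ^ k)]
  have hsucc : ∀ k, T (k + 1) / 2 = T k := fun k => by simp only [hT, pow_succ]; ring
  refine ne_top_of_le_ne_top (b := c * ∫⁻ s in Ioi t₀, ENNReal.ofReal ((s / φ s) ^ (1 / ((m:ℝ) - 1)))) ?_ ?_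
  · exact ENNReal.mul_ne_top ENNReal.ofReal_ne_top hint.lintegral_lt_top.ne
  · calc ∑' k, u (k + (N + 1)) ≤ ∑' k, c * ∫⁻ s in Ioc (T (k + N)) (T (k + N + 1)),
          ENNReal.ofReal ((s / φ s) ^ (1 / ((m:ℝ) - 1))) := by
          refine ENNReal.tsum_le_tsum fun k => ?_
          rw [← add_assoc, huT]
          have := calderon_term hm hφ (hTp (k + N + 1))
          rwa [hsucc] at this
      _ = c * ∫⁻ s in ⋃ k, Ioc (T (k + N)) (T (k + N + 1)), ENNReal.ofReal ((s / φ s) ^ (1 / ((m:ℝ) - 1))) := by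
          rw [ENNReal.tsum_mul_left, lintegral_iUnion (fun _ => measurableSet_Ioc)]
          have hmon : Monotone fun k => T (k + N) := fun i j hij => hTm (by omega)
          have := hmon.pairwise_disjoint_on_Ioc_succ
          simpa [Order.succ_eq_add_one, add_right_comm] using this
      _ ≤ _ := by
          refine mul_le_mul_right (lintegral_mono_set ?_) _
          refine iUnion_subset fun k s hs => ?_
          exact lt_of_le_of_lt (hN.trans (hTm (by omega : N ≤ k + N))) hs.1

lemma op_le_frob {n m : ℕ} (A : Eucl n →L[ℝ] Eucl m) : ‖A‖ ≤ frobNorm A := by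
  refine ContinuousLinearMap.opNorm_le_bound _ (Real.sqrt_nonneg _) fun x => ?_
  rw [EuclideanSpace.norm_eq, EuclideanSpace.norm_eq, frobNorm, ← Real.sqrt_mul (by positivity)]
  refine Real.sqrt_le_sqrt ?_
  rw [Finset.sum_mul]
  refine Finset.sum_le_sum fun i _ => ?_
  have hx : x = ∑ j, x j • EuclideanSpace.single j (1:ℝ) := by
    ext l
    simp [Pi.single_apply]
  have hAx : A x i = ∑ j, A (EuclideanSpace.single j 1) i * x j := by
    conv_lhs => rw [hx]
    simp [map_sum, mul_comm]
  rw [hAx]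
  simp only [Real.norm_eq_abs, sq_abs]
  exact Finset.sum_mul_sq_le_sq_mul_sq _ _ _

open MeasureTheory Metric Set Filter
open scoped ENNReal NNReal Topology RealInnerProductSpace Classical

noncomputable def cL (n : ℕ) : Eucl n ≃L[ℝ] (Fin n → ℝ) := EuclideanSpace.equiv (Fin n) ℝ

lemma cL_mp (n : ℕ) : MeasurePreserving (cL n) volume volume := PiLp.volume_preserving_ofLp (Fin n)

lemma cL_symm_mp (n : ℕ) : MeasurePreserving (cL n).symm volume volume := PiLp.volume_preserving_toLp (Fin n)

lemma cL_emb (n : ℕ) : MeasurableEmbedding (cL n) := (cL n).toHomeomorph.measurableEmbedding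

lemma cL_symm_emb (n : ℕ) : MeasurableEmbedding (cL n).symm := (cL n).symm.toHomeomorph.measurableEmbedding

noncomputable def cc (n : ℕ) : ℝ≥0 := ‖((cL n : Eucl n →L[ℝ] (Fin n → ℝ)))‖₊ * ‖((cL n).symm : (Fin n → ℝ) →L[ℝ] Eucl n)‖₊

/-- transport of a linear map -/
noncomputable def cG {n : ℕ} (A : Eucl n →L[ℝ] Eucl n) : (Fin n → ℝ) →L[ℝ] (Fin n → ℝ) :=
  (cL n : Eucl n →L[ℝ] (Fin n → ℝ)).comp (A.comp ((cL n).symm : (Fin n → ℝ) →L[ℝ] Eucl n))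

lemma cG_norm {n : ℕ} (A : Eucl n →L[ℝ] Eucl n) : ‖cG A‖ ≤ cc n * ‖A‖ := by
  refine (ContinuousLinearMap.opNorm_comp_le _ _).trans ?_
  refine (mul_le_mul_of_nonneg_left (ContinuousLinearMap.opNorm_comp_le _ _) (norm_nonneg _)).trans (le_of_eq ?_)
  simp only [cc, NNReal.coe_mul, coe_nnnorm]
  ring

lemma cG_cont {n : ℕ} : Continuous (cG (n := n)) := by
  unfold cG
  fun_prop

lemma cG_det {n : ℕ} (A : Eucl n →L[ℝ] Eucl n) : (cG A).det = A.det :=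
  LinearMap.det_conj (A : Eucl n →ₗ[ℝ] Eucl n) (cL n).toLinearEquiv

lemma frob_cont {n m : ℕ} : Continuous (frobNorm (n := n) (m := m)) := by
  unfold frobNorm
  refine Real.continuous_sqrt.comp ?_
  refine continuous_finsetSum _ fun i _ => continuous_finsetSum _ fun j _ => ?_
  refine Continuous.pow ?_ 2
  have h1 : Continuous fun A : Eucl n →L[ℝ] Eucl m => A (EuclideanSpace.single j 1) := by fun_prop
  exact (EuclideanSpace.proj i : Eucl m →L[ℝ] ℝ).continuous.comp h1

lemma kp_meas {n : ℕ} (p : ℝ) {H : Eucl n → Eucl n →L[ℝ] Eucl n} (hH : Measurable H) :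
    Measurable (distortionKp p H) := by
  unfold distortionKp
  have hdet : Measurable fun x => (H x).det := ContinuousLinearMap.continuous_det.measurable.comp hH
  refine Measurable.ite (hdet (measurableSet_singleton 0).compl) ?_ (Measurable.ite (hH (measurableSet_singleton 0)) measurable_const measurable_const)
  exact ENNReal.measurable_ofReal.comp ((hH.norm.pow_const p).div hdet)

lemma kp_ineq {m : ℕ} {p : ℝ} (hp : (m:ℝ) + 1 < p) (hm : 2 ≤ m) {Df : Eucl (m+1) → Eucl (m+1) →L[ℝ] Eucl (m+1)}
    {x : Eucl (m+1)} {K : ℝ} (hK : 1 ≤ K) (h : ‖Df x‖ ^ (m+1) ≤ K * (Df x).det) :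
    ‖Df x‖ₑ ^ m ≤ (distortionKp p Df x ^ ((m:ℝ) / (p - m))) ^ ((p - m) / p) *
      ENNReal.ofReal |(Df x).det| ^ ((m:ℝ) / p) := by
  have hm0 : (0:ℝ) < m := by exact_mod_cast (by omega : 0 < m)
  have hp0 : 0 < p := by linarith
  have hpm : 0 < p - m := by linarith
  by_cases hd : (Df x).det = 0
  · rw [hd, mul_zero] at h
    have h0 : ‖Df x‖ = 0 := by
      by_contra hc
      have : 0 < ‖Df x‖ ^ (m+1) := by positivity
      linarith
    have h1 : ‖Df x‖ₑ = 0 := by rw [← ofReal_norm, h0, ENNReal.ofReal_zero]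
    rw [h1, zero_pow (by omega)]
    exact zero_le
  · have hdp : 0 < (Df x).det := by
      have : 0 ≤ K * (Df x).det := le_trans (by positivity) h
      have h2 : 0 ≤ (Df x).det := nonneg_of_mul_nonneg_right this (by linarith)
      exact lt_of_le_of_ne h2 (Ne.symm hd)
    rw [← ENNReal.rpow_mul, show (m:ℝ) / (p - m) * ((p - m) / p) = m / p by field_simp,
      ← ENNReal.mul_rpow_of_nonneg _ _ (by positivity), distortionKp, if_pos hd, abs_of_pos hdp,
      ← ENNReal.ofReal_mul (by positivity), div_mul_cancel₀ _ hd,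
      ← ENNReal.ofReal_rpow_of_nonneg (norm_nonneg _) hp0.le, ← ENNReal.rpow_mul,
      show p * ((m:ℝ) / p) = m by field_simp, ENNReal.rpow_natCast, ofReal_norm]

lemma build {m : ℕ} (hm : 2 ≤ m) {p : ℝ} (hp : (m:ℝ) + 1 < p) {D D' : Set (Eucl (m+1))} (hD : IsOpen D)
    {φ : ℝ → ℝ} (hφ : NondecPos φ) (hc : CalderonCond (m+1) φ)
    {f : Eucl (m+1) → Eucl (m+1)} {Df : Eucl (m+1) → Eucl (m+1) →L[ℝ] Eucl (m+1)}
    (hf : IsHomeoOn f D D') (hS : MemOrliczSobolevOn φ D f Df) (hK : HasFiniteDistortionOn D Df) :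
    ∃ F G g h b, Full m (cc (m+1)) p ((cL (m+1)).symm ⁻¹' D) F G g h b
        (fun x => distortionKp p Df ((cL (m+1)).symm x) ^ ((m:ℝ) / (p - m))) ∧
      ∀ y ∈ D, F (cL (m+1) y) = cL (m+1) (f y) := by
  obtain ⟨⟨hfi, hDi, hwk⟩, hfrob⟩ := hS
  obtain ⟨K, -, hKae⟩ := hK
  set L := cL (m+1) with hL
  have hLmp : MeasurePreserving L volume volume := cL_mp _
  have hLsmp : MeasurePreserving L.symm volume volume := cL_symm_mp _
  have hLe : MeasurableEmbedding L := cL_emb _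
  have hLse : MeasurableEmbedding L.symm := cL_symm_emb _
  set Ω := L.symm ⁻¹' D with hΩ
  have hDae : AEStronglyMeasurable Df (volume.restrict D) := hDi.aestronglyMeasurable
  set H := hDae.mk Df with hH
  have hHm : Measurable H := hDae.stronglyMeasurable_mk.measurable
  have hHe : ∀ᵐ x ∂volume.restrict D, Df x = H x := hDae.ae_eq_mk
  have hHe' : ∀ᵐ x, x ∈ D → Df x = H x := (ae_restrict_iff' hD.measurableSet).1 hHe
  set f1 := D.indicator f with hf1
  have hf1m : Measurable f1 := by
    rw [hf1, ← piecewise_eq_indicator]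
    exact hf.continuousOn.measurable_piecewise continuousOn_const hD.measurableSet
  have hf1e : ∀ x ∈ D, f1 x = f x := fun x hx => indicator_of_mem hx f
  set Φ : ℝ → ℝ≥0∞ := fun s => if 0 < s then ENNReal.ofReal (φ s) else 0 with hΦ
  have hΦm : Monotone Φ := by
    intro s t hst
    simp only [hΦ]
    by_cases hs : 0 < s
    · rw [if_pos hs, if_pos (hs.trans_le hst)]
      exact ENNReal.ofReal_le_ofReal (hφ.1 s t hs hst)
    · rw [if_neg hs]; exact zero_le
  have himg : ∀ U : Set (Fin (m+1) → ℝ), (fun x => L (f1 (L.symm x))) '' U = L '' (f1 '' (L.symm '' U)) := by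
    intro U
    rw [image_image, image_image]
  have hsub : ∀ U ⊆ Ω, L.symm '' U ⊆ D := fun U hU => by
    rintro _ ⟨x, hx, rfl⟩; exact hU hx
  refine ⟨fun x => L (f1 (L.symm x)), fun x => cG (H (L.symm x)), fun x => ‖H (L.symm x)‖ₑ,
    fun x => Φ (frobNorm (H (L.symm x))), fun t => ENNReal.ofReal (φ t), ⟨?_, ?_, ?_, ?_, ?_, ?_⟩, ?_⟩
  · refine ⟨hm, hD.preimage L.symm.continuous, ?_, ?_, ?_, ?_, ?_, ?_, ?_, ?_, ?_, ?_, ?_, ?_, ?_⟩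
    · refine L.continuous.comp_continuousOn ?_
      refine ContinuousOn.comp (t := D) (hf.continuousOn.congr hf1e) L.symm.continuous.continuousOn ?_
      exact fun x hx => hx
    · exact cG_cont.measurable.comp (hHm.comp L.symm.continuous.measurable)
    · have hHi : LocallyIntegrableOn H D volume := by
        rw [locallyIntegrableOn_iff hD.isLocallyClosed] at hDi ⊢
        intro C hC hCc
        exact (hDi C hC hCc).congr (ae_restrict_of_ae_restrict_of_subset hC hHe)
      rw [locallyIntegrableOn_iff (hD.preimage L.symm.continuous).isLocallyClosed]
      rw [locallyIntegrableOn_iff hD.isLocallyClosed] at hHi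
      intro C hC hCc
      have h1 := hHi (L.symm '' C) (hsub C hC) (hCc.image L.symm.continuous)
      rw [← hLsmp.integrableOn_comp_preimage hLse, preimage_image_eq _ L.symm.injective] at h1
      have h2 : Integrable (fun x => ‖(H ∘ L.symm) x‖) (volume.restrict C) := Integrable.norm h1
      refine Integrable.mono' (h2.const_mul (cc (m+1) : ℝ)) ?_ ?_
      · exact (cG_cont.measurable.comp (hHm.comp L.symm.continuous.measurable)).aestronglyMeasurable
      · exact Eventually.of_forall fun x => cG_norm _
    · intro ψ hψ hψc hψs v
      set ψ' : Eucl (m+1) → ℝ := fun y => ψ (L y) with hψ'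
      have hts : tsupport ψ' ⊆ L ⁻¹' tsupport ψ := by
        refine closure_minimal (fun y hy => ?_) ((isClosed_tsupport ψ).preimage L.continuous)
        exact subset_tsupport ψ hy
      have htD : tsupport ψ' ⊆ D := by
        intro y hy
        have := hψs (hts hy)
        simpa [hΩ] using this
      have h1 := hwk ψ' (hψ.comp L.contDiff) (hψc.comp_homeomorph L.toHomeomorph) htD (L.symm v)
      have hfd : ∀ y, fderiv ℝ ψ' y (L.symm v) = fderiv ℝ ψ (L y) v := by
        intro y
        have h2 : HasFDerivAt ψ' ((fderiv ℝ ψ (L y)).comp (L : Eucl (m+1) →L[ℝ] (Fin (m+1) → ℝ))) y :=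
          ((hψ.differentiable (by simp)) (L y)).hasFDerivAt.comp y L.hasFDerivAt
        rw [h2.fderiv]
        simp
      have e1 : ∫ x, ψ x • cG (H (L.symm x)) v = L (∫ y, ψ' y • Df y (L.symm v)) := by
        rw [← hLmp.integral_comp hLe, ← ContinuousLinearEquiv.integral_comp_comm]
        refine integral_congr_ae ?_
        filter_upwards [hHe'] with y hy
        by_cases hyD : y ∈ D
        · simp [cG, hψ', ← hy hyD, ← hL]
        · have : ψ (L y) = 0 := by
            have := image_eq_zero_of_notMem_tsupport (fun h => hyD (htD h))
            exact this
          simp [hψ', this]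
      have e2 : ∫ x, fderiv ℝ ψ x v • L (f1 (L.symm x)) = L (∫ y, fderiv ℝ ψ' y (L.symm v) • f y) := by
        rw [← hLmp.integral_comp hLe, ← ContinuousLinearEquiv.integral_comp_comm]
        refine integral_congr_ae (Eventually.of_forall fun y => ?_)
        simp only [hfd, L.symm_apply_apply]
        by_cases hyD : y ∈ D
        · rw [hf1e y hyD]; simp
        · have h3 : fderiv ℝ ψ' y = 0 := by
            by_contra hne
            exact hyD (htD (support_fderiv_subset ℝ hne))
          have h4 : fderiv ℝ ψ (L y) v = 0 := by rw [← hfd, h3]; simp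
          simp [h4]
      rw [e1, e2, h1, map_neg]
    · exact hHm.enorm.comp L.symm.continuous.measurable
    · exact fun x => enorm_ne_top
    · intro x
      have := cG_norm (H (L.symm x))
      rw [← ofReal_norm, ← ofReal_norm, ← ENNReal.ofReal_coe_nnreal,
        ← ENNReal.ofReal_mul (NNReal.coe_nonneg _)]
      exact ENNReal.ofReal_le_ofReal this
    · exact hΦm.measurable.comp (frob_cont.measurable.comp (hHm.comp L.symm.continuous.measurable))
    · intro C hC hCc
      have h1 := hfrob (L.symm '' C) (hsub C hC) (hCc.image L.symm.continuous)
      refine ne_top_of_le_ne_top h1.ne ?_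
      have h2 := hLsmp.setLIntegral_comp_emb hLse (fun y => Φ (frobNorm (H y))) C
      rw [h2]
      refine lintegral_mono_ae ?_
      filter_upwards [ae_restrict_of_ae_restrict_of_subset (hsub C hC) hHe] with y hy
      rw [← hy]
      simp only [hΦ]
      split_ifs
      · exact le_rfl
      · exact zero_le
    · intro t ht
      simpa using hφ.2 t ht
    · exact fun t => ENNReal.ofReal_ne_top
    · intro t x ht hx
      have h1 : (t:ℝ) < ‖H (L.symm x)‖ := by
        rw [← ofReal_norm, ← ENNReal.ofReal_coe_nnreal] at hx
        exact (ENNReal.ofReal_lt_ofReal_iff_of_nonneg (NNReal.coe_nonneg t)).1 hx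
      have h2 : (t:ℝ) ≤ frobNorm (H (L.symm x)) := h1.le.trans (op_le_frob _)
      have ht' : (0:ℝ) < t := ht
      simp only [hΦ]
      rw [if_pos (ht'.trans_le h2)]
      exact ENNReal.ofReal_le_ofReal (hφ.1 _ _ ht' h2)
    · exact fun t ht => calderon_sum hm hφ hc t ht
  · exact L.continuous.measurable.comp (hf1m.comp L.symm.continuous.measurable)
  · intro x hx y hy hxy
    have h1 := L.injective hxy
    rw [hf1e _ hx, hf1e _ hy] at h1
    exact L.symm.injective (hf.injOn hx hy h1)
  · intro U hU hUo
    rw [himg]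
    refine L.toHomeomorph.isOpenMap _ ?_
    rw [image_congr (fun x hx => hf1e x (hsub U hU hx))]
    exact hf.isOpenMapOn _ (hsub U hU) (L.symm.toHomeomorph.isOpenMap _ hUo)
  · refine AEMeasurable.pow_const ?_ _
    refine ⟨fun x => distortionKp p H (L.symm x), (kp_meas p hHm).comp L.symm.continuous.measurable, ?_⟩
    rw [Filter.EventuallyEq, ae_restrict_iff' (hD.preimage L.symm.continuous).measurableSet]
    filter_upwards [hLsmp.quasiMeasurePreserving.ae hHe'] with x hx hxD
    unfold distortionKp
    rw [hx hxD]
  · have hK' := (ae_restrict_iff' hD.measurableSet).1 hKae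
    filter_upwards [hLsmp.quasiMeasurePreserving.ae hHe', hLsmp.quasiMeasurePreserving.ae hK'] with x hx hxK hxD
    obtain ⟨h1, h2⟩ := hxK hxD
    rw [cG_det, ← hx hxD]
    exact kp_ineq hp hm h1 h2
  · intro y hy
    simp only [L.symm_apply_apply]
    rw [hf1e y hy]

open MeasureTheory Metric Set Filter
open scoped ENNReal NNReal Topology RealInnerProductSpace Classical

lemma eucl_le_sum {n : ℕ} (v : Eucl n) : ‖v‖ ≤ ∑ i, |v i| := by
  have hx : v = ∑ j, v j • EuclideanSpace.single j (1:ℝ) := by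
    ext l
    simp [Pi.single_apply]
  conv_lhs => rw [hx]
  refine (norm_sum_le _ _).trans (Finset.sum_le_sum fun i _ => ?_)
  rw [norm_smul]
  simp

lemma cL_dist_le {n : ℕ} (x y : Eucl n) : dist (cL n x) (cL n y) ≤ dist x y := by
  rw [dist_pi_le_iff dist_nonneg]
  intro i
  rw [dist_eq_norm x y, Real.dist_eq]
  exact PiLp.norm_apply_le (x - y) i

lemma cL_dist_ge {n : ℕ} (x y : Eucl n) : dist x y ≤ n * dist (cL n x) (cL n y) := by
  rw [dist_eq_norm x y]
  refine (eucl_le_sum _).trans ?_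
  calc ∑ i, |(x - y) i| ≤ ∑ i : Fin n, dist (cL n x) (cL n y) :=
        Finset.sum_le_sum fun i _ => dist_le_pi_dist (cL n x) (cL n y) i
    _ = _ := by simp

lemma step {k : ℕ} {c0 : ℝ≥0} {p : ℝ} {D : Set (Eucl (k+2))} {f : Eucl (k+2) → Eucl (k+2)} {F G g h b}
    {q : Eucl (k+2) → ℝ≥0∞}
    (T : Full (k+1) c0 p ((cL (k+2)).symm ⁻¹' D) F G g h b (fun x => q ((cL (k+2)).symm x)))
    (hFf : ∀ y ∈ D, F (cL (k+2) y) = cL (k+2) (f y)) {C : ℝ≥0∞} {j1 j2 s : ℝ} (hj1 : 0 ≤ j1) (hj2 : 0 ≤ j2)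
    (H : ∀ {z : Fin (k+2) → ℝ} {R : ℝ}, 0 < R →
      closedBall z (6 * R) ⊆ ((cL (k+2)).symm ⁻¹' D) → ∀ i, ∀ x ∈ ball z R, ∀ x' ∈ ball z R,
      ENNReal.ofReal (F x' i - F x i) ≤
        C * (∫⁻ x in closedBall z (4 * R), q ((cL (k+2)).symm x)) ^ j1 *
          (∫⁻ x in closedBall z (2 * R), q ((cL (k+2)).symm x)) ^ j2 * ENNReal.ofReal R ^ (-s))
    {x₀ : Eucl (k+2)} {ε R : ℝ} (hε : 0 < ε) (hR : R = ε / (6 * (k+2))) (hD : ball x₀ (4 * ε) ⊆ D)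
    {w y : Eucl (k+2)} (hw : w ∈ ball x₀ ε) (hwy : dist w y < R) :
    edist (f w) (f y) ≤ (k+2) * (C * (∫⁻ x in ball x₀ (4 * ε), q x) ^ j1 *
          (∫⁻ x in ball x₀ (2 * ε), q x) ^ j2 * ENNReal.ofReal R ^ (-s)) := by
  have hR0 : 0 < R := by rw [hR]; positivity
  have hR6 : (k+2) * (6 * R) = ε := by rw [hR]; field_simp
  set L := cL (k+2) with hL
  have hsub : ∀ r, r ≤ 6 * R → L.symm '' closedBall (L w) r ⊆ ball x₀ (2 * ε) := by
    rintro r hr _ ⟨x, hx, rfl⟩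
    have h1 := cL_dist_ge (L.symm x) w
    rw [← hL, L.apply_symm_apply] at h1
    have h2 : dist x (L w) ≤ 6 * R := (mem_closedBall.1 hx).trans hr
    have h3 : ((k+2:ℕ):ℝ) * dist x (L w) ≤ ε := by
      rw [← hR6]; push_cast; gcongr
    rw [mem_ball] at hw ⊢
    linarith [dist_triangle (L.symm x) w x₀]
  have h24 : ball x₀ (2 * ε) ⊆ ball x₀ (4 * ε) := ball_subset_ball (by linarith)
  have hz : closedBall (L w) (6 * R) ⊆ L.symm ⁻¹' D := by
    rw [← image_subset_iff]
    exact (hsub _ le_rfl).trans (h24.trans hD)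
  have hwb : L w ∈ ball (L w) R := mem_ball_self hR0
  have hyb : L y ∈ ball (L w) R := by
    rw [mem_ball, dist_comm]
    exact (cL_dist_le w y).trans_lt hwy
  have hwD : w ∈ D := by
    have := hz (ball_subset_closedBall (ball_subset_ball (by linarith : R ≤ 6 * R) hwb))
    simpa using this
  have hyD : y ∈ D := by
    have := hz (ball_subset_closedBall (ball_subset_ball (by linarith : R ≤ 6 * R) hyb))
    simpa using this
  have hint : ∀ r, r ≤ 6 * R → ∀ B : Set (Eucl (k+2)), ball x₀ (2 * ε) ⊆ B →
      ∫⁻ x in closedBall (L w) r, q (L.symm x) ≤ ∫⁻ x in B, q x := by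
    intro r hr B hB
    rw [(cL_symm_mp (k+2)).setLIntegral_comp_emb (cL_symm_emb (k+2)) q]
    exact lintegral_mono_set ((hsub r hr).trans hB)
  set Q := C * (∫⁻ x in ball x₀ (4 * ε), q x) ^ j1 *
          (∫⁻ x in ball x₀ (2 * ε), q x) ^ j2 * ENNReal.ofReal R ^ (-s) with hQ
  have hle : ∀ u ∈ ball (L w) R, ∀ u' ∈ ball (L w) R, ∀ i, ENNReal.ofReal (F u' i - F u i) ≤ Q := by
    intro u hu u' hu' i
    refine (H hR0 hz i u hu u' hu').trans ?_
    rw [hQ]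
    refine mul_le_mul_left (mul_le_mul' (mul_le_mul_right ?_ _) ?_) _
    · exact ENNReal.rpow_le_rpow (hint _ (by linarith) _ h24) hj1
    · exact ENNReal.rpow_le_rpow (hint _ (by linarith) _ subset_rfl) hj2
  rw [edist_dist, dist_eq_norm]
  calc ENNReal.ofReal ‖f w - f y‖ ≤ ENNReal.ofReal (∑ i, |(f w - f y) i|) :=
        ENNReal.ofReal_le_ofReal (eucl_le_sum _)
    _ = ∑ i, ENNReal.ofReal |(f w - f y) i| := ENNReal.ofReal_sum_of_nonneg fun i _ => abs_nonneg _
    _ ≤ ∑ i : Fin (k+2), Q := by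
        refine Finset.sum_le_sum fun i _ => ?_
        have e : (f w - f y) i = F (L w) i - F (L y) i := by
          rw [hFf w hwD, hFf y hyD]; rfl
        rw [e]
        rcases abs_cases (F (L w) i - F (L y) i) with ⟨h1, -⟩ | ⟨h1, -⟩
        · rw [h1]; exact hle _ hyb _ hwb i
        · rw [h1, neg_sub]; exact hle _ hwb _ hyb i
    _ = _ := by
        rw [Finset.sum_const, Finset.card_univ, Fintype.card_fin, nsmul_eq_mul]; push_cast; ring

lemma chain {k : ℕ} {f : Eucl (k+2) → Eucl (k+2)} {x₀ : Eucl (k+2)} {ε R : ℝ} (hε : 0 < ε)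
    (hR : R = ε / (6 * (k+2))) {Q : ℝ≥0∞}
    (H : ∀ w ∈ ball x₀ ε, ∀ y, dist w y < R → edist (f w) (f y) ≤ Q) :
    ediam (f '' ball x₀ ε) ≤ (12 * (k+2)) * Q := by
  refine ediam_image_le_iff.2 fun x hx y hy => ?_
  set N : ℕ := 12 * (k+2) with hN
  have hN0 : (0:ℝ) < N := by rw [hN]; positivity
  set u : ℕ → Eucl (k+2) := fun l => AffineMap.lineMap x y ((l:ℝ) / N) with hu
  have hu0 : u 0 = x := by simp [hu]
  have huN : u N = y := by simp [hu, div_self hN0.ne']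
  have hub : ∀ l < N, u l ∈ ball x₀ ε := by
    intro l hl
    have hl' : (l:ℝ) ≤ N := by exact_mod_cast hl.le
    refine (convex_ball x₀ ε).lineMap_mem hx hy ⟨by positivity, ?_⟩
    rw [div_le_one hN0]; exact hl'
  have hd : ∀ l, dist (u l) (u (l+1)) < R := by
    intro l
    simp only [hu]
    rw [dist_lineMap_lineMap, Real.dist_eq]
    have e1 : ((l:ℝ) / N - ((l+1:ℕ):ℝ) / N) = -(1 / N) := by push_cast; ring
    rw [e1, abs_neg, abs_of_pos (by positivity)]
    have h2 : dist x y < 2 * ε := by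
      rw [mem_ball] at hx hy
      linarith [dist_triangle_right x y x₀]
    have e2 : R = 1 / N * (2 * ε) := by
      rw [hR, hN]; push_cast; field_simp; norm_num
    rw [e2]
    gcongr
  calc edist (f x) (f y) = edist (f (u 0)) (f (u N)) := by rw [hu0, huN]
    _ ≤ ∑ l ∈ Finset.range N, edist (f (u l)) (f (u (l+1))) :=
        edist_le_range_sum_edist (fun l => f (u l)) N
    _ ≤ ∑ l ∈ Finset.range N, Q :=
        Finset.sum_le_sum fun l hl => H _ (hub l (Finset.mem_range.1 hl)) _ (hd l)
    _ = _ := by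
        rw [Finset.sum_const, Finset.card_range, nsmul_eq_mul, hN]; push_cast; rfl

lemma normalize_est {n : ℕ} {j1 j2 s a : ℝ} (hj1 : 0 ≤ j1) (hj2 : 0 ≤ j2) (hexp : n * j1 + n * j2 - s = 1)
    (ha : 0 < a) : ∃ c : ℝ≥0∞, c ≠ ⊤ ∧ ∀ (x₀ : Eucl n) (ε : ℝ) (J J' : ℝ≥0∞), 0 < ε →
      J ^ j1 * J' ^ j2 * ENNReal.ofReal (ε / a) ^ (-s) ≤
      c * (J / volume (ball x₀ (4 * ε))) ^ j1 * (J' / volume (ball x₀ (2 * ε))) ^ j2 * ENNReal.ofReal ε := by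
  set ω := volume (ball (0 : Eucl n) 1) with hω
  have hω0 : ω ≠ 0 := (measure_ball_pos volume _ one_pos).ne'
  have hωt : ω ≠ ⊤ := measure_ball_lt_top.ne
  have hv : ∀ (x₀ : Eucl n) (b ε : ℝ), 0 < b → 0 < ε →
      volume (ball x₀ (b * ε)) = ENNReal.ofReal ε ^ (n:ℝ) * (ENNReal.ofReal b ^ (n:ℝ) * ω) := by
    intro x₀ b ε hb hε
    rw [Measure.addHaar_ball_of_pos volume x₀ (by positivity : 0 < b * ε), finrank_euclideanSpace_fin, ENNReal.ofReal_pow (by positivity),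
      ENNReal.ofReal_mul hb.le, ENNReal.rpow_natCast, ENNReal.rpow_natCast]
    ring
  refine ⟨(ENNReal.ofReal 4 ^ (n:ℝ) * ω) ^ j1 * (ENNReal.ofReal 2 ^ (n:ℝ) * ω) ^ j2 * ENNReal.ofReal a⁻¹ ^ (-s), ?_, ?_⟩
  · have h1 : (ENNReal.ofReal 4 ^ (n:ℝ) * ω) ^ j1 ≠ ⊤ := ENNReal.rpow_ne_top_of_nonneg hj1
      (ENNReal.mul_ne_top (ENNReal.rpow_ne_top_of_nonneg (by positivity) ENNReal.ofReal_ne_top) hωt)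
    have h2 : (ENNReal.ofReal 2 ^ (n:ℝ) * ω) ^ j2 ≠ ⊤ := ENNReal.rpow_ne_top_of_nonneg hj2
      (ENNReal.mul_ne_top (ENNReal.rpow_ne_top_of_nonneg (by positivity) ENNReal.ofReal_ne_top) hωt)
    have h3 : ENNReal.ofReal a⁻¹ ^ (-s) ≠ ⊤ := by
      rw [ENNReal.ofReal_rpow_of_pos (by positivity)]; exact ENNReal.ofReal_ne_top
    exact ENNReal.mul_ne_top (ENNReal.mul_ne_top h1 h2) h3
  intro x₀ ε J J' hε
  set e := ENNReal.ofReal ε with he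
  have he0 : e ≠ 0 := by simpa [he] using hε
  have het : e ≠ ⊤ := ENNReal.ofReal_ne_top
  have hJ : ∀ b > 0, ∀ J : ℝ≥0∞, ∀ j : ℝ, 0 ≤ j →
      J ^ j = (J / volume (ball x₀ (b * ε))) ^ j * (e ^ (n * j) * (ENNReal.ofReal b ^ (n:ℝ) * ω) ^ j) := by
    intro b hb J j hj
    rw [ENNReal.rpow_mul, ← ENNReal.mul_rpow_of_nonneg _ _ hj, ← hv x₀ b ε hb hε, ← ENNReal.mul_rpow_of_nonneg _ _ hj,
      ENNReal.div_mul_cancel (measure_ball_pos volume _ (by positivity)).ne' measure_ball_lt_top.ne]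
  have hR : ENNReal.ofReal (ε / a) ^ (-s) = e ^ (-s) * ENNReal.ofReal a⁻¹ ^ (-s) := by
    rw [div_eq_mul_inv, ENNReal.ofReal_mul hε.le, ENNReal.mul_rpow_of_ne_top het ENNReal.ofReal_ne_top]
  have hpow : e ^ (n * j1) * e ^ (n * j2) * e ^ (-s) = e := by
    rw [← ENNReal.rpow_add _ _ he0 het, ← ENNReal.rpow_add _ _ he0 het, ← sub_eq_add_neg, hexp, ENNReal.rpow_one]
  refine le_of_eq ?_
  set A := (J / volume (ball x₀ (4 * ε))) ^ j1 with hA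
  set A' := (J' / volume (ball x₀ (2 * ε))) ^ j2 with hA'
  rw [hR, hJ 4 (by norm_num) J j1 hj1, hJ 2 (by norm_num) J' j2 hj2, ← hA, ← hA']
  conv_rhs => rw [← hpow]
  ring

open MeasureTheory Metric Set Filter
open scoped ENNReal NNReal Topology RealInnerProductSpace Classical

/-- for `p ∈ (n, n+1/(n-2))` there is a constant `c₅ = c₅(n,p)` such that for
every homeomorphism of finite distortion `f : D → D'` of class `W^{1,φ}_loc` (Calderón-type
condition on `φ`), every `x₀ ∈ D` and `ε > 0` with `B(x₀,4ε) ⊆ D`: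
`d(fB(x₀,ε))/ε ≤ c₅ (⨍_{B(x₀,4ε)} K_p^{(n-1)/(p-n+1)})^{j₁} (⨍_{B(x₀,2ε)} K_p^{(n-1)/(p-n+1)})^{j₂}`,
with `j₁ = n((1-n)(p-n+1)+p)(p-n+1)/(p(n(p-n+1)-p))` and `j₂ = (n-1)(p-n+1)/p`. -/
theorem stmt_13 (n : ℕ) (hn : 3 ≤ n) (p : ℝ)
    (hp : p ∈ Ioo (n : ℝ) ((n : ℝ) + 1 / ((n : ℝ) - 2))) :
    ∃ c : ℝ≥0∞, 0 < c ∧ c < ⊤ ∧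
      ∀ (D D' : Set (Eucl n)), IsOpen D → IsConnected D → IsOpen D' → IsConnected D' →
      ∀ φ : ℝ → ℝ, NondecPos φ → CalderonCond n φ →
      ∀ (f : Eucl n → Eucl n) (Df : Eucl n → Eucl n →L[ℝ] Eucl n),
        IsHomeoOn f D D' → MemOrliczSobolevOn φ D f Df → HasFiniteDistortionOn D Df →
      ∀ x₀ ∈ D, ∀ ε : ℝ, 0 < ε → ball x₀ (4 * ε) ⊆ D →
        EMetric.diam (f '' ball x₀ ε) / ENNReal.ofReal ε ≤
          c * ((∫⁻ x in ball x₀ (4 * ε),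
                  distortionKp p Df x ^ (((n:ℝ)-1)/(p-(n:ℝ)+1))) /
                volume (ball x₀ (4 * ε)))
              ^ ((n:ℝ)*((1-(n:ℝ))*(p-(n:ℝ)+1)+p)*(p-(n:ℝ)+1)/(p*((n:ℝ)*(p-(n:ℝ)+1)-p)))
            * ((∫⁻ x in ball x₀ (2 * ε),
                  distortionKp p Df x ^ (((n:ℝ)-1)/(p-(n:ℝ)+1))) /
                volume (ball x₀ (2 * ε)))
              ^ (((n:ℝ)-1)*(p-(n:ℝ)+1)/p) := by
  obtain ⟨k, rfl⟩ : ∃ k, n = k + 2 := ⟨n - 2, by omega⟩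
  have hk1 : 1 ≤ k := by omega
  have hk0 : (0:ℝ) < k := by exact_mod_cast hk1
  obtain ⟨hp1, hp3⟩ := hp
  push_cast at hp1 hp3
  have hp' : ((k+1:ℕ):ℝ) + 1 < p := by push_cast; linarith
  have hp2 : p * k < (k+1)^2 := by
    have h1 : (k:ℝ) + 2 - 2 = k := by ring
    rw [h1] at hp3
    calc p * k < ((k:ℝ) + 2 + 1 / k) * k := by gcongr
      _ = (k+1)^2 := by field_simp; ring
  have hp0 : 0 < p := by linarith
  have hpn : 0 < p - (k+2) := by linarith
  have hq0 : 0 < p - (k+1) := by linarith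
  obtain ⟨s, hs⟩ : ∃ s, s = p / ((k+1) * (p - (k+2))) := ⟨_, rfl⟩
  obtain ⟨j1, hj1⟩ : ∃ j1, j1 = (s - (k+1)) * ((p - (k+1)) / p) := ⟨_, rfl⟩
  obtain ⟨j2, hj2⟩ : ∃ j2, j2 = ((k:ℝ)+1) * ((p - (k+1)) / p) := ⟨_, rfl⟩
  have hsk : (k:ℝ) + 1 ≤ s := by
    rw [hs, le_div_iff₀ (by positivity)]
    nlinarith
  have hj10 : 0 ≤ j1 := by
    rw [hj1]; exact mul_nonneg (by linarith) (by positivity)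
  have hj20 : 0 ≤ j2 := by rw [hj2]; positivity
  have hexp : ((k+2:ℕ):ℝ) * j1 + ((k+2:ℕ):ℝ) * j2 - s = 1 := by
    rw [hj1, hj2, hs]; push_cast; field_simp; ring
  have e0 : (((k+2:ℕ):ℝ) - 1) / (p - ((k+2:ℕ):ℝ) + 1) = ((k+1:ℕ):ℝ) / (p - ((k+1:ℕ):ℝ)) := by
    push_cast; congr 1 <;> ring
  have e1 : ((k+2:ℕ):ℝ)*((1-((k+2:ℕ):ℝ))*(p-((k+2:ℕ):ℝ)+1)+p)*(p-((k+2:ℕ):ℝ)+1)/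
      (p*(((k+2:ℕ):ℝ)*(p-((k+2:ℕ):ℝ)+1)-p)) = j1 := by
    have h1 : ((k+2:ℕ):ℝ)*(p-((k+2:ℕ):ℝ)+1)-p = (k+1) * (p - (k+2)) := by push_cast; ring
    rw [h1, hj1, hs]; push_cast; field_simp; ring
  have e2 : (((k+2:ℕ):ℝ)-1)*(p-((k+2:ℕ):ℝ)+1)/p = j2 := by
    rw [hj2]; push_cast; field_simp; ring
  rw [e0, e1, e2]
  obtain ⟨C, hC, H⟩ := comb hk1 (cc (k+2)) hp' hp2 hs hj1 hj2
  obtain ⟨c, hc, Hn⟩ := normalize_est (n := k+2) (a := 6 * ((k:ℝ)+2)) hj10 hj20 hexp (by positivity)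
  have hkt : ((k:ℝ≥0∞) + 2) ≠ ⊤ := by
    exact_mod_cast ENNReal.natCast_ne_top (k+2)
  refine ⟨12 * (k+2) * (k+2) * C * c + 1, by simp, ?_, ?_⟩
  · refine lt_top_iff_ne_top.2 (ENNReal.add_ne_top.2 ⟨?_, ENNReal.one_ne_top⟩)
    exact ENNReal.mul_ne_top (ENNReal.mul_ne_top (ENNReal.mul_ne_top
      (ENNReal.mul_ne_top (by norm_num) hkt) hkt) hC) hc
  intro D D' hD _ _ _ φ hφ hcal f Df hf hS hK x₀ _ ε hε hball
  obtain ⟨F, G, g, h, b, T, hFf⟩ := build (m := k+1) (by omega) hp' hD hφ hcal hf hS hK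
  have hstep : ∀ w ∈ ball x₀ ε, ∀ y, dist w y < ε / (6 * (k+2)) → edist (f w) (f y) ≤ _ :=
    fun w hw y hwy => step (q := fun x => distortionKp p Df x ^ (((k+1:ℕ):ℝ) / (p - ((k+1:ℕ):ℝ))))
      T hFf hj10 hj20 (H T) hε rfl hball hw hwy
  have hch := chain hε rfl hstep
  have he0 : ENNReal.ofReal ε ≠ 0 := by simpa using hε
  refine (ENNReal.div_le_iff he0 ENNReal.ofReal_ne_top).2 (hch.trans ?_)
  have hn2 := Hn x₀ ε (∫⁻ x in ball x₀ (4 * ε), distortionKp p Df x ^ (((k+1:ℕ):ℝ) / (p - ((k+1:ℕ):ℝ))))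
    (∫⁻ x in ball x₀ (2 * ε), distortionKp p Df x ^ (((k+1:ℕ):ℝ) / (p - ((k+1:ℕ):ℝ)))) hε
  generalize (∫⁻ x in ball x₀ (4 * ε), distortionKp p Df x ^ (((k+1:ℕ):ℝ) / (p - ((k+1:ℕ):ℝ)))) = J4 at hn2 ⊢
  generalize (∫⁻ x in ball x₀ (2 * ε), distortionKp p Df x ^ (((k+1:ℕ):ℝ) / (p - ((k+1:ℕ):ℝ)))) = J2 at hn2 ⊢
  calc _ = (12 * ((k:ℝ≥0∞)+2) * (k+2) * C) * (J4 ^ j1 * J2 ^ j2 * ENNReal.ofReal (ε / (6 * (k+2))) ^ (-s)) := by ring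
    _ ≤ (12 * ((k:ℝ≥0∞)+2) * (k+2) * C) * _ := mul_le_mul_right hn2 _
    _ = (12 * ((k:ℝ≥0∞)+2) * (k+2) * C * c) * (J4 / volume (ball x₀ (4 * ε))) ^ j1
          * (J2 / volume (ball x₀ (2 * ε))) ^ j2 * ENNReal.ofReal ε := by ring
    _ ≤ _ := by gcongr; exact le_self_add
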